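/- arXiv:2602.07552 — 3 statements merged into one kernel-verified Lean document; each statement's English description precedes it below -/
import Mathlib

section
/- Let d ≥ 1 be an integer, let Δ_{2d+2} = {x ∈ ℝ^{2d+3} : x_i ≥ 0 for all i, ∑_{i=1}^{2d+3} x_i = 1} be the standard (2d+2)-dimensional simplex, and let Σ = {x ∈ Δ_{2d+2} : |supp(x)| ≤ d+1} be its d-skeleton. For every continuous map f : Σ → ℝ^d there exist disjoint subsets S, T ⊆ {1,…,2d+3} and points x, y ∈ Σ with supp(x) ⊆ S, supp(y) ⊆ T and f(x) = f(y). -/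
theorem Polynomial.exists_isRoot_of_monic_of_odd_natDegree {p : Polynomial ℝ} (hp : p.Monic)
    (hodd : Odd p.natDegree) : ∃ x, p.IsRoot x := by
  have hdeg : 0 < p.degree := Polynomial.natDegree_pos_iff_degree_pos.1 hodd.pos
  have hq : (p.comp (-X)).natDegree = p.natDegree := by simp [natDegree_comp]
  have hdeg' : 0 < (p.comp (-X)).degree := by
    rw [← Polynomial.natDegree_pos_iff_degree_pos, hq]; exact hodd.pos
  have h1 := p.tendsto_atTop_of_leadingCoeff_nonneg hdeg (by simp [hp.leadingCoeff])
  have h2 := (p.comp (-X)).tendsto_atBot_of_leadingCoeff_nonpos hdeg' (by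
    rw [leadingCoeff_comp (by simp)]
    simp [hp.leadingCoeff, hodd.neg_one_pow])
  obtain ⟨a, ha⟩ := (h1.eventually_ge_atTop 0).exists
  obtain ⟨b, hb⟩ := (h2.eventually_le_atBot 0).exists
  have hb' : p.eval (-b) ≤ 0 := by simpa using hb
  have := mem_range_of_exists_le_of_exists_ge (c := (0 : ℝ)) p.continuous ⟨-b, hb'⟩ ⟨a, ha⟩
  obtain ⟨x, hx⟩ := this
  exact ⟨x, hx⟩

theorem Module.End.exists_hasEigenvalue_of_odd_finrank {V : Type*} [AddCommGroup V] [Module ℝ V]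
    [FiniteDimensional ℝ V] (hV : Odd (Module.finrank ℝ V)) (f : Module.End ℝ V) :
    ∃ c : ℝ, f.HasEigenvalue c := by
  obtain ⟨c, hc⟩ := Polynomial.exists_isRoot_of_monic_of_odd_natDegree (LinearMap.charpoly_monic f)
    (by rwa [LinearMap.charpoly_natDegree])
  exact ⟨c, (Module.End.hasEigenvalue_iff_isRoot_charpoly f c).2 hc⟩

/-- Commuting endomorphisms which preserve an odd-dimensional real space have a common
eigenvector in it. -/
theorem Module.End.exists_common_eigenvector_of_odd_finrank {V ι : Type*} [AddCommGroup V]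
    [Module ℝ V] (L : ι → Module.End ℝ V) (hL : ∀ i j, Commute (L i) (L j)) (M : Submodule ℝ V)
    (hodd : Odd (Module.finrank ℝ M)) (hM : ∀ i, ∀ v ∈ M, L i v ∈ M) :
    ∃ v ∈ M, v ≠ 0 ∧ ∀ i, ∃ c : ℝ, L i v = c • v := by
  induction hn : Module.finrank ℝ M using Nat.strong_induction_on generalizing M with
  | _ n ih =>
  have : FiniteDimensional ℝ M := Module.finite_of_finrank_pos hodd.pos
  by_cases hs : ∀ i, ∃ c : ℝ, ∀ v ∈ M, L i v = c • v
  · have : Nontrivial M := Module.nontrivial_of_finrank_pos hodd.pos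
    obtain ⟨v, hv⟩ := exists_ne (0 : M)
    refine ⟨v, v.2, by simpa using hv, fun i => ?_⟩
    obtain ⟨c, hc⟩ := hs i
    exact ⟨c, hc v v.2⟩
  push Not at hs
  obtain ⟨i, hi⟩ := hs
  obtain ⟨c, hc⟩ := Module.End.exists_hasEigenvalue_of_odd_finrank hodd ((L i).restrict (hM i))
  let B : Module.End ℝ M := (L i).restrict (hM i) - algebraMap ℝ _ c
  have hB (v : M) : ((B v : M) : V) = L i v - c • (v : V) := by simp [B]
  have hsum := B.finrank_range_add_finrank_ker
  have hker : 0 < Module.finrank ℝ B.ker := by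
    obtain ⟨v, hv⟩ := hc.exists_hasEigenvector
    have hv1 : v ∈ B.ker := by
      rw [LinearMap.mem_ker]
      have := hv.apply_eq_smul
      simp [B, this]
    have : Nontrivial B.ker := ⟨⟨⟨v, hv1⟩, 0, fun h => hv.2 (by simpa using congrArg Subtype.val h)⟩⟩
    exact Module.finrank_pos
  have hrange : 0 < Module.finrank ℝ B.range := by
    obtain ⟨v, hv, hne⟩ := hi c
    have : Nontrivial B.range := by
      refine ⟨⟨⟨B ⟨v, hv⟩, ⟨v, hv⟩, rfl⟩, 0, fun h => hne ?_⟩⟩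
      have h1 := congrArg (fun x : B.range => ((x : M) : V)) h
      simp only [hB] at h1
      simpa [sub_eq_zero] using h1
    exact Module.finrank_pos
  have hcomm (j : ι) (v : V) : L i (L j v) = L j (L i v) := LinearMap.congr_fun (hL i j) v
  rcases Nat.even_or_odd (Module.finrank ℝ B.ker) with he | ho
  · have hro : Odd (Module.finrank ℝ B.range) := by
      rw [← hsum] at hodd
      exact (Nat.odd_add.1 hodd).2 he
    obtain ⟨v, hv, h0, h⟩ := ih (Module.finrank ℝ (B.range.map M.subtype))
      (by rw [Submodule.finrank_map_subtype_eq]; omega) (B.range.map M.subtype)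
      (by rwa [Submodule.finrank_map_subtype_eq]) (by
        rintro j _ ⟨_, ⟨w, rfl⟩, rfl⟩
        refine ⟨_, ⟨⟨L j w, hM j w w.2⟩, rfl⟩, ?_⟩
        simp [hB, hcomm]) rfl
    obtain ⟨w, -, rfl⟩ := hv
    exact ⟨_, w.2, h0, h⟩
  · obtain ⟨v, hv, h0, h⟩ := ih (Module.finrank ℝ (B.ker.map M.subtype))
      (by rw [Submodule.finrank_map_subtype_eq]; omega) (B.ker.map M.subtype)
      (by rwa [Submodule.finrank_map_subtype_eq]) (by
        rintro j _ ⟨w, hw, rfl⟩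
        refine ⟨⟨L j w, hM j w w.2⟩, ?_, rfl⟩
        have h1 : L i w - c • (w : V) = 0 := by rw [← hB, show B w = 0 from hw]; rfl
        refine Subtype.ext ?_
        rw [hB]
        simp [hcomm, sub_eq_zero.1 h1]) rfl
    obtain ⟨w, -, rfl⟩ := hv
    exact ⟨_, w.2, h0, h⟩

namespace MvPolynomial

/-- `p` is the sum of the monomial with exponent `m` and of terms of smaller degree. -/
def HasLeadingMonomial {ι : Type*} (p : MvPolynomial ι ℝ) (m : ι →₀ ℕ) : Prop :=
  ∀ k ∈ (p - monomial m 1).support, k.degree < m.degree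

namespace HasLeadingMonomial

variable {ι : Type*} {p q : MvPolynomial ι ℝ} {m k : ι →₀ ℕ}

theorem monomial (m : ι →₀ ℕ) : HasLeadingMonomial (monomial m (1 : ℝ)) m := by
  simp [HasLeadingMonomial]

theorem degree_le (hp : p.HasLeadingMonomial m) (hk : k ∈ p.support) :
    k.degree ≤ m.degree := by
  classical
  have h1 : p = (p - MvPolynomial.monomial m 1) + MvPolynomial.monomial m 1 := by ring
  rw [h1] at hk
  rcases Finset.mem_union.1 (support_add hk) with h | h
  · exact (hp k h).le
  · rw [Finset.mem_singleton.1 (support_monomial_subset h)]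

theorem coeff_eq [DecidableEq ι] (hp : p.HasLeadingMonomial m) (hk : m.degree ≤ k.degree) :
    p.coeff k = if m = k then 1 else 0 := by
  have h : (p - MvPolynomial.monomial m 1).coeff k = 0 := by
    by_contra h
    exact absurd (hp k (mem_support_iff.2 h)) (by omega)
  rw [coeff_sub, coeff_monomial] at h
  linarith

theorem mul (hp : p.HasLeadingMonomial m) (hq : q.HasLeadingMonomial k) :
    (p * q).HasLeadingMonomial (m + k) := by
  classical
  have h1 : p * q - MvPolynomial.monomial (m + k) 1 = (p - MvPolynomial.monomial m 1) * q +
      MvPolynomial.monomial m 1 * (q - MvPolynomial.monomial k 1) := by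
    rw [show MvPolynomial.monomial (m + k) (1 : ℝ) =
      MvPolynomial.monomial m 1 * MvPolynomial.monomial k 1 by simp [monomial_mul]]
    ring
  intro l hl
  rw [h1] at hl
  rw [map_add]
  rcases Finset.mem_union.1 (support_add hl) with h | h
  · obtain ⟨a, ha, b, hb, rfl⟩ := Finset.mem_add.1 (support_mul _ _ h)
    rw [map_add]
    exact add_lt_add_of_lt_of_le (hp a ha) (hq.degree_le hb)
  · obtain ⟨a, ha, b, hb, rfl⟩ := Finset.mem_add.1 (support_mul _ _ h)
    rw [map_add, Finset.mem_singleton.1 (support_monomial_subset ha)]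
    exact add_lt_add_right (hq b hb) _

theorem pow (hp : p.HasLeadingMonomial m) (n : ℕ) : (p ^ n).HasLeadingMonomial (n • m) := by
  induction n with
  | zero => simpa using HasLeadingMonomial.monomial (0 : ι →₀ ℕ)
  | succ n ih => rw [pow_succ, succ_nsmul]; exact ih.mul hp

theorem prod {α : Type*} (s : Finset α) {p : α → MvPolynomial ι ℝ} {m : α → ι →₀ ℕ}
    (h : ∀ i ∈ s, (p i).HasLeadingMonomial (m i)) :
    (∏ i ∈ s, p i).HasLeadingMonomial (∑ i ∈ s, m i) := by
  classical
  induction s using Finset.induction_on with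
  | empty => simpa using HasLeadingMonomial.monomial (0 : ι →₀ ℕ)
  | insert a s ha ih =>
    rw [Finset.prod_insert ha, Finset.sum_insert ha]
    exact (h a (by simp)).mul (ih fun i hi => h i (by simp [hi]))

end HasLeadingMonomial

theorem hasLeadingMonomial_X_pow_sub {ι : Type*} {D : ι → ℕ}
    {h : ι → MvPolynomial ι ℝ} (hh : ∀ i, ∀ m ∈ (h i).support, m.degree < D i) (i : ι) :
    (X i ^ D i - h i).HasLeadingMonomial (Finsupp.single i (D i)) := by
  intro k hk
  rw [X_pow_eq_monomial, sub_sub_cancel_left, support_neg] at hk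
  rw [Finsupp.degree_single]
  exact hh i k hk

theorem mem_of_forall_monomial_mem {ι : Type*} {M : Submodule ℝ (MvPolynomial ι ℝ)}
    {p : MvPolynomial ι ℝ} (hp : ∀ m ∈ p.support, monomial m 1 ∈ M) : p ∈ M := by
  rw [p.as_sum]
  refine M.sum_mem fun m hm => ?_
  rw [← mul_one (p.coeff m), ← smul_eq_mul, ← smul_monomial]
  exact M.smul_mem _ (hp m hm)

section Reduction

variable {ι : Type*} [Fintype ι] (D : ι → ℕ) (h : ι → MvPolynomial ι ℝ)

/-- The linear endomorphism which replaces `X i ^ D i` by `X i ^ D i - h i` in each monomial. -/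
noncomputable def substPow : MvPolynomial ι ℝ →ₗ[ℝ] MvPolynomial ι ℝ :=
  (basisMonomials ι ℝ).constr ℝ fun m =>
    ∏ i, ((X i ^ D i - h i) ^ (m i / D i) * X i ^ (m i % D i))

/-- The linear projection onto the span of the monomials with exponents smaller than `D`. -/
noncomputable def reducedPart : MvPolynomial ι ℝ →ₗ[ℝ] MvPolynomial ι ℝ := by
  classical
  exact (basisMonomials ι ℝ).constr ℝ fun m => if ∀ i, m i < D i then monomial m 1 else 0

theorem substPow_monomial (m : ι →₀ ℕ) : substPow D h (monomial m 1) =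
    ∏ i, ((X i ^ D i - h i) ^ (m i / D i) * X i ^ (m i % D i)) := by
  have := (basisMonomials ι ℝ).constr_basis ℝ (fun m : ι →₀ ℕ =>
    ∏ i, ((X i ^ D i - h i) ^ (m i / D i) * X i ^ (m i % D i))) m
  rwa [coe_basisMonomials] at this

open Classical in
theorem reducedPart_monomial (m : ι →₀ ℕ) : reducedPart D (monomial m 1) =
    if ∀ i, m i < D i then monomial m 1 else 0 := by
  have := (basisMonomials ι ℝ).constr_basis ℝ (fun m : ι →₀ ℕ =>
    if ∀ i, m i < D i then monomial m (1 : ℝ) else 0) m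
  rwa [coe_basisMonomials] at this

theorem substPow_monomial_of_lt {m : ι →₀ ℕ} (hm : ∀ i, m i < D i) :
    substPow D h (monomial m 1) = monomial m 1 := by
  rw [substPow_monomial, monomial_eq, Finsupp.prod_fintype _ _ (by simp)]
  simp [Nat.div_eq_of_lt (hm _), Nat.mod_eq_of_lt (hm _)]

variable {D h}

theorem hasLeadingMonomial_substPow (hh : ∀ i, ∀ m ∈ (h i).support, m.degree < D i)
    (m : ι →₀ ℕ) : (substPow D h (monomial m 1)).HasLeadingMonomial m := by
  rw [substPow_monomial]
  have key := HasLeadingMonomial.prod Finset.univ (p := fun i : ι =>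
    (X i ^ D i - h i) ^ (m i / D i) * X i ^ (m i % D i))
    (m := fun i => (m i / D i) • Finsupp.single i (D i) + Finsupp.single i (m i % D i))
    fun i _ => ((hasLeadingMonomial_X_pow_sub hh i).pow _).mul (by
      rw [X_pow_eq_monomial]; exact HasLeadingMonomial.monomial _)
  convert key
  refine Eq.trans (Finsupp.univ_sum_single m).symm (Finset.sum_congr rfl fun i _ => ?_)
  rw [Finsupp.smul_single, ← Finsupp.single_add, smul_eq_mul, Nat.div_add_mod']

theorem substPow_injective (hh : ∀ i, ∀ m ∈ (h i).support, m.degree < D i) :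
    Function.Injective (substPow D h) := by
  classical
  rw [injective_iff_map_eq_zero]
  intro p hp
  by_contra hne
  obtain ⟨m, hm, hmax⟩ := p.support.exists_max_image Finsupp.degree (support_nonempty.2 hne)
  have h1 : (substPow D h p).coeff m = p.coeff m := by
    conv_lhs => rw [p.as_sum, map_sum, coeff_sum]
    rw [Finset.sum_eq_single m]
    · rw [← mul_one (p.coeff m), ← smul_eq_mul, ← smul_monomial, map_smul, coeff_smul,
        (hasLeadingMonomial_substPow hh m).coeff_eq le_rfl]
      simp
    · intro k hk hkm
      rw [← mul_one (p.coeff k), ← smul_eq_mul, ← smul_monomial, map_smul, coeff_smul,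
        (hasLeadingMonomial_substPow hh k).coeff_eq (hmax k hk)]
      simp [hkm]
    · intro h; exact absurd hm h
  rw [hp, coeff_zero] at h1
  exact mem_support_iff.1 hm h1.symm

theorem substPow_surjective (hh : ∀ i, ∀ m ∈ (h i).support, m.degree < D i) :
    Function.Surjective (substPow D h) := by
  rw [← LinearMap.range_eq_top, eq_top_iff]
  have key : ∀ n, ∀ m : ι →₀ ℕ, m.degree = n → monomial m 1 ∈ (substPow D h).range := by
    intro n
    induction n using Nat.strong_induction_on with
    | _ n ih =>
    rintro m rfl
    rw [← sub_sub_cancel (substPow D h (monomial m 1)) (monomial m 1)]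
    refine Submodule.sub_mem _ ⟨_, rfl⟩ (mem_of_forall_monomial_mem fun k hk => ?_)
    exact ih _ (hasLeadingMonomial_substPow hh m k hk) k rfl
  exact fun p _ => mem_of_forall_monomial_mem fun m _ => key _ m rfl

theorem mul_substPow_monomial (hD : ∀ i, 0 < D i) (i : ι) (m : ι →₀ ℕ) :
    (X i ^ D i - h i) * substPow D h (monomial m 1) =
      substPow D h (monomial (m + Finsupp.single i (D i)) 1) := by
  classical
  rw [substPow_monomial, substPow_monomial,
    ← Finset.mul_prod_erase _ _ (Finset.mem_univ i),
    ← Finset.mul_prod_erase Finset.univ (fun j => (X j ^ D j - h j) ^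
      ((m + Finsupp.single i (D i)) j / D j) * X j ^ ((m + Finsupp.single i (D i)) j % D j))
      (Finset.mem_univ i)]
  have h1 : ∏ j ∈ Finset.univ.erase i, ((X j ^ D j - h j) ^
      ((m + Finsupp.single i (D i)) j / D j) * X j ^ ((m + Finsupp.single i (D i)) j % D j)) =
      ∏ j ∈ Finset.univ.erase i, ((X j ^ D j - h j) ^ (m j / D j) * X j ^ (m j % D j)) := by
    refine Finset.prod_congr rfl fun j hj => ?_
    simp [(Finset.ne_of_mem_erase hj)]
  rw [h1]
  simp only [Finsupp.add_apply, Finsupp.single_eq_same, Nat.add_mod_right,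
    Nat.add_div_right _ (hD i), pow_succ]
  ring

theorem exists_substPow_eq_of_mem_span (hh : ∀ i, ∀ m ∈ (h i).support, m.degree < D i)
    (hD : ∀ i, 0 < D i) {p : MvPolynomial ι ℝ}
    (hp : p ∈ Ideal.span (Set.range fun i => X i ^ D i - h i)) :
    ∃ q, substPow D h q = p ∧ reducedPart D q = 0 := by
  suffices p ∈ (LinearMap.ker (reducedPart D)).map (substPow D h) by
    obtain ⟨q, hq, rfl⟩ := this
    exact ⟨q, rfl, hq⟩
  obtain ⟨c, rfl⟩ := Ideal.mem_span_range_iff_exists_fun.1 hp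
  refine Submodule.sum_mem _ fun i _ => ?_
  obtain ⟨q, hq⟩ := substPow_surjective hh (c i)
  rw [← hq, mul_comm]
  have : q ∈ Submodule.comap ((LinearMap.mulLeft ℝ (X i ^ D i - h i)) ∘ₗ substPow D h)
      ((LinearMap.ker (reducedPart D)).map (substPow D h)) := by
    refine mem_of_forall_monomial_mem fun m _ => ?_
    refine ⟨monomial (m + Finsupp.single i (D i)) 1, ?_, (mul_substPow_monomial hD i m).symm⟩
    rw [SetLike.mem_coe, LinearMap.mem_ker, reducedPart_monomial, if_neg]
    intro hlt
    simpa using hlt i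
  exact this

theorem eq_zero_of_mem_span (hh : ∀ i, ∀ m ∈ (h i).support, m.degree < D i)
    (hD : ∀ i, 0 < D i) {p : MvPolynomial ι ℝ} (hred : ∀ m ∈ p.support, ∀ i, m i < D i)
    (hp : p ∈ Ideal.span (Set.range fun i => X i ^ D i - h i)) : p = 0 := by
  obtain ⟨q, hq, h0⟩ := exists_substPow_eq_of_mem_span hh hD hp
  have h1 : p ∈ LinearMap.eqLocus (substPow D h) LinearMap.id :=
    mem_of_forall_monomial_mem fun m hm => substPow_monomial_of_lt D h (hred m hm)
  have h2 : p ∈ LinearMap.eqLocus (reducedPart D) LinearMap.id :=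
    mem_of_forall_monomial_mem fun m hm => by
      simp [reducedPart_monomial, hred m hm]
  have h3 : substPow D h p = p := h1
  have h4 : reducedPart D p = p := h2
  rw [substPow_injective hh (hq.trans h3.symm), h4] at h0
  exact h0

end Reduction

end MvPolynomial

namespace MvPolynomial

section Solutions

variable {ι κ A : Type*} [Fintype ι] [Fintype κ] {D : ι → ℕ} {h : ι → MvPolynomial ι ℝ}
  [CommRing A] [Algebra ℝ A]

theorem map_monomial_mem {f : MvPolynomial ι ℝ →ₐ[ℝ] A} (hf : ∀ i, f (X i ^ D i - h i) = 0)
    {V : Submodule ℝ A}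
    (hV : ∀ m : ι →₀ ℕ, (∀ i, m i < D i) → Even m.degree → f (monomial m 1) ∈ V)
    (hh : ∀ i, ∀ m ∈ (h i).support, m.degree < D i)
    (hpar : ∀ i, ∀ m ∈ (h i).support, (Even m.degree ↔ Even (D i)))
    (m : ι →₀ ℕ) (hm : Even m.degree) : f (monomial m 1) ∈ V := by
  classical
  induction hn : m.degree using Nat.strong_induction_on generalizing m with
  | _ n ih =>
  subst hn
  by_cases hred : ∀ i, m i < D i
  · exact hV m hred hm
  push Not at hred
  obtain ⟨i, hi⟩ := hred
  obtain ⟨k, rfl⟩ : ∃ k, m = k + Finsupp.single i (D i) :=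
    ⟨m - Finsupp.single i (D i), (tsub_add_cancel_of_le (by simpa using hi)).symm⟩
  have h1 : f (monomial (k + Finsupp.single i (D i)) 1) = f (monomial k 1 * h i) := by
    rw [← sub_eq_zero, ← map_sub, show monomial (k + Finsupp.single i (D i)) (1 : ℝ) =
      monomial k 1 * X i ^ D i by rw [X_pow_eq_monomial, monomial_mul, one_mul], ← mul_sub,
      map_mul, hf, mul_zero]
  rw [h1]
  have h2 : monomial k 1 * h i ∈ V.comap f.toLinearMap := by
    refine mem_of_forall_monomial_mem fun l hl => ?_
    obtain ⟨a, ha, b, hb, rfl⟩ := Finset.mem_add.1 (support_mul _ _ hl)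
    rw [Finset.mem_singleton.1 (support_monomial_subset ha)]
    refine ih _ ?_ _ ?_ rfl
    · rw [map_add, map_add, Finsupp.degree_single]
      exact add_lt_add_right (hh i b hb) _
    · rw [map_add, Finsupp.degree_single, Nat.even_add] at hm
      rw [map_add, Nat.even_add, hm, hpar i b hb]
  exact h2

theorem exists_eigenvector_X_mul_X {f : MvPolynomial ι ℝ →ₐ[ℝ] A}
    (hf : ∀ p, f p = 0 ↔ p ∈ Ideal.span (Set.range fun i => X i ^ D i - h i))
    (hD : ∀ i, 0 < D i) (hh : ∀ i, ∀ m ∈ (h i).support, m.degree < D i)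
    (hpar : ∀ i, ∀ m ∈ (h i).support, (Even m.degree ↔ Even (D i)))
    (e : κ → ι →₀ ℕ) (he : Function.Injective e)
    (hred : ∀ m, m ∈ Set.range e ↔ (∀ i, m i < D i) ∧ Even m.degree)
    (hκ : Odd (Fintype.card κ)) :
    ∃ u : A, u ≠ 0 ∧ ∀ i j, ∃ c : ℝ, f (X i * X j) * u = c • u := by
  classical
  let b : κ → A := fun k => f (monomial (e k) 1)
  have hb : LinearIndependent ℝ b := by
    rw [Fintype.linearIndependent_iff]
    intro c hc k
    have h1 : ∑ k, monomial (e k) (c k) ∈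
        Ideal.span (Set.range fun i => X i ^ D i - h i) := by
      rw [← hf, map_sum, ← hc]
      refine Finset.sum_congr rfl fun k _ => ?_
      rw [← map_smul, smul_monomial, smul_eq_mul, mul_one]
    have h2 := eq_zero_of_mem_span hh hD (fun m hm => ?_) h1
    · have h3 := congrArg (coeff (e k)) h2
      rw [coeff_sum, coeff_zero] at h3
      simpa [coeff_monomial, he.eq_iff] using h3
    · obtain ⟨k, -, hk⟩ := Finset.mem_biUnion.1 (support_sum hm)
      rw [Finset.mem_singleton.1 (support_monomial_subset hk)]
      exact ((hred _).1 ⟨k, rfl⟩).1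
  let V := Submodule.span ℝ (Set.range b)
  have hV : ∀ m : ι →₀ ℕ, Even m.degree → f (monomial m 1) ∈ V :=
    map_monomial_mem (fun i => (hf _).2 (Ideal.subset_span ⟨i, rfl⟩)) (fun m hm1 hm2 => by
      obtain ⟨k, rfl⟩ := (hred m).2 ⟨hm1, hm2⟩
      exact Submodule.subset_span ⟨k, rfl⟩) hh hpar
  let L (p : ι × ι) : Module.End ℝ A := LinearMap.mulLeft ℝ (f (X p.1 * X p.2))
  obtain ⟨u, -, hu, huL⟩ := Module.End.exists_common_eigenvector_of_odd_finrank L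
    (fun p q => by
      ext v
      simp only [L, Module.End.mul_apply, LinearMap.mulLeft_apply]
      ring) V
    (by rwa [finrank_span_eq_card hb]) (by
      intro p v hv
      have : V ≤ V.comap (L p) := by
        refine Submodule.span_le.2 ?_
        rintro _ ⟨k, rfl⟩
        have h1 : (X p.1 * X p.2 : MvPolynomial ι ℝ) * monomial (e k) 1 =
            monomial (Finsupp.single p.1 1 + Finsupp.single p.2 1 + e k) 1 := by
          simp [X, monomial_mul]
        rw [SetLike.mem_coe, Submodule.mem_comap, LinearMap.mulLeft_apply, ← map_mul, h1]
        refine hV _ ?_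
        have := ((hred _).1 ⟨k, rfl⟩).2
        simp only [map_add, Finsupp.degree_single, Nat.even_add]
        simp [this]
      exact this hv)
  exact ⟨u, hu, fun i j => huL (i, j)⟩

end Solutions

section CommonZero

variable {ι A : Type*} [CommRing A] [Algebra ℝ A]

theorem eval_eq_zero_of_eigenvector {f : MvPolynomial ι ℝ →ₐ[ℝ] A} {u : A} (hu : u ≠ 0)
    {v : ι → ℝ} (hv : ∀ i, f (X i) * u = v i • u) {p : MvPolynomial ι ℝ} (hp : f p = 0) :
    eval v p = 0 := by
  have key (p : MvPolynomial ι ℝ) : f p * u = eval v p • u := by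
    induction p using MvPolynomial.induction_on with
    | C a => rw [eval_C, Algebra.smul_def, ← algebraMap_eq, AlgHom.commutes]
    | add p q hp hq => rw [map_add, map_add, add_mul, hp, hq, add_smul]
    | mul_X p i hp =>
      rw [map_mul, map_mul, mul_assoc, hv, mul_smul_comm, hp, smul_smul, eval_X, mul_comm]
  have h1 := key p
  rw [hp, zero_mul] at h1
  exact (smul_eq_zero.1 h1.symm).resolve_right hu

theorem exists_common_zero {f : MvPolynomial ι ℝ →ₐ[ℝ] A} {u : A} (hu : u ≠ 0) {c : ι → ι → ℝ}
    (hc : ∀ i j, f (X i * X j) * u = c i j • u) {k : ι} (hk : 0 < c k k) :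
    ∃ v : ι → ℝ, ∀ p, f p = 0 → eval v p = 0 := by
  set s := √(c k k)
  have hs : s ≠ 0 := (Real.sqrt_pos.2 hk).ne'
  have hss : c k k = s * s := (Real.mul_self_sqrt hk.le).symm
  have hc' (i j : ι) : f (X i) * (f (X j) * u) = c i j • u := by
    rw [← mul_assoc, ← hc, map_mul]
  obtain ⟨w, t, hw, ht, hwk, hwc⟩ : ∃ (w : A) (t : ℝ), w ≠ 0 ∧ t ≠ 0 ∧
      f (X k) * w = t • w ∧ ∀ i j, f (X i) * (f (X j) * w) = c i j • w := by
    by_cases h0 : f (X k) * u + s • u = 0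
    · exact ⟨u, -s, hu, neg_ne_zero.2 hs, by rw [neg_smul]; exact eq_neg_of_add_eq_zero_left h0,
        hc'⟩
    · refine ⟨_, s, h0, hs, ?_, fun i j => ?_⟩
      · rw [mul_add, hc', hss, mul_smul_comm, smul_add, smul_smul, add_comm]
      · rw [show f (X i) * (f (X j) * (f (X k) * u + s • u)) =
          f (X k) * (f (X i) * (f (X j) * u)) + s • (f (X i) * (f (X j) * u)) by
            simp only [mul_add, mul_smul_comm]; ring, hc', smul_add, mul_smul_comm, smul_comm s]
  refine ⟨fun i => t⁻¹ * c i k, fun p hp => eval_eq_zero_of_eigenvector hw (fun i => ?_) hp⟩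
  rw [mul_smul, ← hwc, hwk, mul_smul_comm, smul_smul, inv_mul_cancel₀ ht, one_smul]

end CommonZero

end MvPolynomial

namespace MvPolynomial

/-- A polynomial version of the Borsuk–Ulam theorem. -/
theorem exists_abs_eval_le_of_odd {d : ℕ} {f : Fin d → MvPolynomial (Fin (d + 1)) ℝ}
    (hf : ∀ i, ∀ m ∈ (f i).support, Odd m.degree) {ε : ℝ} (hε : 0 < ε) :
    ∃ x : Fin (d + 1) → ℝ, x 0 ^ 6 + ∑ i, x i ^ 2 = 1 ∧ ∀ i, |eval x (f i)| ≤ ε := by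
  classical
  set N := 2 * (∑ i, (f i).totalDegree) + 1 with hN
  have hNodd : Odd N := ⟨_, hN⟩
  let D : Fin (d + 1) → ℕ := Fin.cons 6 fun _ => N
  let h : Fin (d + 1) → MvPolynomial (Fin (d + 1)) ℝ :=
    Fin.cons (1 - ∑ i, X i ^ 2) fun i => C ε⁻¹ * f i
  have hD : ∀ i, 0 < D i := Fin.cases (by simp [D]) fun i => by simp [D, hN]
  have h0 : ∀ m ∈ (1 - ∑ i, X i ^ 2 : MvPolynomial (Fin (d + 1)) ℝ).support,
      m.degree = 0 ∨ m.degree = 2 := by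
    intro m hm
    rcases Finset.mem_union.1 (support_sub _ _ _ hm) with h | h
    · left
      rw [support_one, Finset.mem_singleton] at h
      simp [h]
    · right
      obtain ⟨i, -, hi⟩ := Finset.mem_biUnion.1 (support_sum h)
      rw [X_pow_eq_monomial] at hi
      rw [Finset.mem_singleton.1 (support_monomial_subset hi), Finsupp.degree_single]
  have h1 : ∀ i, ∀ m ∈ (C ε⁻¹ * f i).support, m ∈ (f i).support := by
    intro i m hm
    rw [mem_support_iff, coeff_C_mul] at hm
    exact mem_support_iff.2 (right_ne_zero_of_mul hm)
  have hh : ∀ i, ∀ m ∈ (h i).support, m.degree < D i := by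
    refine Fin.cases (fun m hm => ?_) fun i m hm => ?_
    · rcases h0 m hm with h | h <;> simp [D, h]
    · have h2 : m.degree ≤ (f i).totalDegree := by
        have := le_totalDegree (h1 i m hm)
        exact this
      have h3 := Finset.single_le_sum (f := fun i => (f i).totalDegree) (fun _ _ => Nat.zero_le _)
        (Finset.mem_univ i)
      simp only [D, Fin.cons_succ]
      omega
  have hpar : ∀ i, ∀ m ∈ (h i).support, (Even m.degree ↔ Even (D i)) := by
    refine Fin.cases (fun m hm => ?_) fun i m hm => ?_
    · rcases h0 m hm with h | h <;> simp only [D, h, Fin.cons_zero] <;> decide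
    · simp only [D, Fin.cons_succ]
      rw [← Nat.not_odd_iff_even, ← Nat.not_odd_iff_even]
      simp [hf i m (h1 i m hm), hNodd]
  let e : Fin 3 × (Fin d → Fin N) → Fin (d + 1) →₀ ℕ := fun k => Finsupp.equivFunOnFinite.symm
    (Fin.cons (2 * k.1 + (∑ i, (k.2 i : ℕ)) % 2) fun i => (k.2 i : ℕ))
  have he0 (k) : e k 0 = 2 * k.1 + (∑ i, (k.2 i : ℕ)) % 2 := rfl
  have hes (k) (i : Fin d) : e k i.succ = k.2 i := rfl
  have he : Function.Injective e := by
    intro k l hkl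
    have h2 : k.2 = l.2 := by
      funext i
      rw [← Fin.val_inj, ← hes, ← hes, hkl]
    have h3 : k.1 = l.1 := by
      have := DFunLike.congr_fun hkl 0
      rw [he0, he0, h2] at this
      rw [← Fin.val_inj]
      omega
    exact Prod.ext h3 h2
  have hdeg (m : Fin (d + 1) →₀ ℕ) : m.degree = m 0 + ∑ i : Fin d, m i.succ := by
    rw [Finsupp.degree_eq_sum, Fin.sum_univ_succ]
  have hred : ∀ m, m ∈ Set.range e ↔ (∀ i, m i < D i) ∧ Even m.degree := by
    intro m
    constructor
    · rintro ⟨k, rfl⟩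
      refine ⟨fun i => ?_, ?_⟩
      · refine Fin.cases ?_ (fun i => ?_) i
        · rw [he0]
          simp only [D, Fin.cons_zero]
          omega
        · rw [hes]
          exact (k.2 i).2
      · rw [hdeg, he0]
        simp only [hes, Nat.even_iff]
        omega
    · rintro ⟨hm, hev⟩
      have hm0 : m 0 < 6 := hm 0
      refine ⟨(⟨m 0 / 2, by omega⟩, fun i => ⟨m i.succ, hm i.succ⟩), Finsupp.ext ?_⟩
      refine Fin.cases ?_ fun i => rfl
      rw [he0]
      rw [hdeg, Nat.even_iff] at hev
      dsimp only
      omega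
  have hκ : Odd (Fintype.card (Fin 3 × (Fin d → Fin N))) := by
    simp only [Fintype.card_prod, Fintype.card_fin, Fintype.card_fun]
    exact (by decide : Odd 3).mul hNodd.pow
  let I := Ideal.span (Set.range fun i => X i ^ D i - h i)
  have hI (p : MvPolynomial (Fin (d + 1)) ℝ) : Ideal.Quotient.mkₐ ℝ I p = 0 ↔ p ∈ I := by
    rw [Ideal.Quotient.mkₐ_eq_mk, Ideal.Quotient.eq_zero_iff_mem]
  obtain ⟨u, hu, hu'⟩ := exists_eigenvector_X_mul_X hI hD hh hpar e he hred hκ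
  choose c hc using hu'
  have hI0 : X 0 ^ 6 + ∑ i, X i ^ 2 - 1 ∈ I := by
    have : X 0 ^ D 0 - h 0 ∈ I := Ideal.subset_span ⟨0, rfl⟩
    convert this using 1
    simp only [D, h, Fin.cons_zero]
    ring
  obtain ⟨k, hk⟩ : ∃ k, 0 < c k k := by
    by_contra! hneg
    have h2 := (hI _).2 hI0
    have h3 : Ideal.Quotient.mkₐ ℝ I (X 0 ^ 6 + ∑ i, X i ^ 2 - 1) * u =
        (c 0 0 ^ 3 + ∑ i, c i i - 1) • u := by
      rw [show (X 0 : MvPolynomial (Fin (d + 1)) ℝ) ^ 6 = X 0 * X 0 * (X 0 * X 0) * (X 0 * X 0) by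
        ring]
      simp only [map_sub, map_add, map_sum, sq, map_mul (Ideal.Quotient.mkₐ ℝ I) (_ * _),
        sub_mul, add_mul, Finset.sum_mul, mul_assoc (Ideal.Quotient.mkₐ ℝ I (X 0 * X 0)), hc,
        mul_smul_comm, map_one, one_mul, sub_smul, add_smul, Finset.sum_smul, one_smul, smul_smul]
      congr 3
      ring
    rw [h2, zero_mul] at h3
    have h4 := (smul_eq_zero.1 h3.symm).resolve_right hu
    have h5 : ∑ i, c i i ≤ 0 := Finset.sum_nonpos fun i _ => hneg i
    have h6 : c 0 0 ^ 3 ≤ 0 := Odd.pow_nonpos (by decide) (hneg 0)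
    linarith
  obtain ⟨x, hx⟩ := exists_common_zero hu hc hk
  have hx0 := hx _ ((hI _).2 hI0)
  simp only [map_sub, map_add, map_pow, eval_X, map_sum, map_one] at hx0
  have hx1 : x 0 ^ 6 + ∑ i, x i ^ 2 = 1 := by linarith
  refine ⟨x, hx1, fun i => ?_⟩
  have hIi : X i.succ ^ N - C ε⁻¹ * f i ∈ I := Ideal.subset_span ⟨i.succ, rfl⟩
  have hxi := hx _ ((hI _).2 hIi)
  simp only [map_sub, map_mul, map_pow, eval_X, eval_C] at hxi
  have h2 : eval x (f i) = ε * x i.succ ^ N := by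
    rw [sub_eq_zero.1 hxi, mul_inv_cancel_left₀ hε.ne']
  have h3 : |x i.succ| ≤ 1 := by
    rw [← sq_le_one_iff_abs_le_one]
    have h4 := Finset.single_le_sum (f := fun i => x i ^ 2) (fun i _ => sq_nonneg (x i))
      (Finset.mem_univ i.succ)
    have h5 : 0 ≤ x 0 ^ 6 := by positivity
    linarith
  rw [h2, abs_mul, abs_pow, abs_of_pos hε]
  exact mul_le_of_le_one_right hε.le (pow_le_one₀ (abs_nonneg _) h3)

theorem exists_odd_part {ι : Type*} [Fintype ι] (p : MvPolynomial ι ℝ) :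
    ∃ q : MvPolynomial ι ℝ, (∀ m ∈ q.support, Odd m.degree) ∧
      ∀ x, eval x q = (eval x p - eval (-x) p) / 2 := by
  classical
  refine ⟨∑ m ∈ p.support with Odd m.degree, monomial m (p.coeff m), fun m hm => ?_, fun x => ?_⟩
  · obtain ⟨k, hk, hmk⟩ := Finset.mem_biUnion.1 (support_sum hm)
    rw [Finset.mem_singleton.1 (support_monomial_subset hmk)]
    exact (Finset.mem_filter.1 hk).2
  · rw [map_sum, eval_eq', eval_eq', ← Finset.sum_sub_distrib, Finset.sum_div, Finset.sum_filter]
    refine Finset.sum_congr rfl fun m _ => ?_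
    have h1 : ∏ i, (-x) i ^ m i = (-1) ^ m.degree * ∏ i, x i ^ m i := by
      rw [Finsupp.degree_eq_sum, ← Finset.prod_pow_eq_pow_sum, ← Finset.prod_mul_distrib]
      refine Finset.prod_congr rfl fun i _ => ?_
      rw [Pi.neg_apply, neg_pow]
    rw [h1]
    split_ifs with h
    · rw [eval_monomial, Finsupp.prod_fintype _ _ (by simp), h.neg_one_pow]
      ring
    · rw [(Nat.not_odd_iff_even.1 h).neg_one_pow]
      ring

theorem exists_forall_abs_eval_sub_lt {ι : Type*} {K : Set (ι → ℝ)} (hK : IsCompact K)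
    {g : (ι → ℝ) → ℝ} (hg : ContinuousOn g K) {ε : ℝ} (hε : 0 < ε) :
    ∃ p : MvPolynomial ι ℝ, ∀ x ∈ K, |eval x p - g x| < ε := by
  have : CompactSpace K := isCompact_iff_compactSpace.1 hK
  let coord (i : ι) : C(K, ℝ) := ⟨fun x => x.1 i, (continuous_apply i).comp continuous_subtype_val⟩
  have hA : (aeval (R := ℝ) coord).range.SeparatesPoints := by
    intro x y hxy
    obtain ⟨i, hi⟩ := Function.ne_iff.1 (Subtype.coe_ne_coe.2 hxy)
    exact ⟨_, ⟨coord i, ⟨X i, aeval_X _ _⟩, rfl⟩, hi⟩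
  obtain ⟨⟨_, p, rfl⟩, hp⟩ :=
    ContinuousMap.exists_mem_subalgebra_near_continuous_of_separatesPoints _ hA (K.domRestrict g)
      hg.domRestrict ε hε
  refine ⟨p, fun x hx => ?_⟩
  have h1 (q : MvPolynomial ι ℝ) : eval x q = (aeval (R := ℝ) coord q) ⟨x, hx⟩ := by
    induction q using MvPolynomial.induction_on with
    | C a => simp
    | add p q hp hq => simp [hp, hq]
    | mul_X p i hp => simp [hp, coord]
  rw [h1]
  exact hp ⟨x, hx⟩

end MvPolynomial

/-- The Borsuk–Ulam theorem, for odd maps on a punctured Euclidean space. -/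
theorem exists_eq_zero_of_odd_of_continuousOn {d : ℕ} {G : (Fin (d + 1) → ℝ) → Fin d → ℝ}
    (hG : ContinuousOn G {0}ᶜ) (hodd : ∀ x, G (-x) = -G x) : ∃ x ≠ 0, G x = 0 := by
  by_contra! hne
  let K : Set (Fin (d + 1) → ℝ) := {x | x 0 ^ 6 + ∑ i, x i ^ 2 = 1}
  have hK0 : K ⊆ {0}ᶜ := by
    rintro x hx rfl
    simp [K] at hx
  have hKc : IsCompact K := by
    refine Metric.isCompact_of_isClosed_isBounded
      (isClosed_eq (by fun_prop) continuous_const) ?_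
    refine Metric.isBounded_closedBall (x := 0) (r := 1) |>.subset fun x hx => ?_
    rw [mem_closedBall_zero_iff, pi_norm_le_iff_of_nonneg zero_le_one]
    intro i
    rw [Real.norm_eq_abs, ← sq_le_one_iff_abs_le_one]
    have h4 := Finset.single_le_sum (f := fun i => x i ^ 2) (fun i _ => sq_nonneg (x i))
      (Finset.mem_univ i)
    have h5 : 0 ≤ x 0 ^ 6 := by positivity
    have h6 : x 0 ^ 6 + ∑ i, x i ^ 2 = 1 := hx
    linarith
  have hKn : K.Nonempty := by
    obtain ⟨x, hx, -⟩ := MvPolynomial.exists_abs_eval_le_of_odd (d := d) (f := fun _ => 0)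
      (by simp) one_pos
    exact ⟨x, hx⟩
  have hKneg : ∀ x ∈ K, -x ∈ K := by
    intro x hx
    simpa [K, Even.neg_pow (by decide : Even 6)] using hx
  obtain ⟨y, hy, hmin⟩ := hKc.exists_isMinOn hKn (hG.mono hK0).norm
  have hδ : 0 < ‖G y‖ := norm_pos_iff.2 (hne y (hK0 hy))
  have hp (i : Fin d) := MvPolynomial.exists_forall_abs_eval_sub_lt hKc
    (g := fun x => G x i) ((continuous_apply i).comp_continuousOn (hG.mono hK0))
    (ε := ‖G y‖ / 4) (by linarith)
  choose p hp using hp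
  choose q hq hqe using fun i => MvPolynomial.exists_odd_part (p i)
  obtain ⟨x, hx, hxq⟩ := MvPolynomial.exists_abs_eval_le_of_odd hq (ε := ‖G y‖ / 4) (by linarith)
  have h1 : ‖G x‖ ≤ ‖G y‖ / 2 := by
    rw [pi_norm_le_iff_of_nonneg (by linarith)]
    intro i
    have h2 := abs_lt.1 (hp i x hx)
    have h3 := abs_lt.1 (hp i (-x) (hKneg x hx))
    have h4 := abs_le.1 (hxq i)
    rw [hqe] at h4
    simp only [hodd, Pi.neg_apply] at h3
    rw [Real.norm_eq_abs, abs_le]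
    constructor <;> linarith
  have h2 : ‖G y‖ ≤ ‖G x‖ := hmin hx
  linarith

section CrossPolytope

variable {d : ℕ}

/-- The map which sends the vertices `e i` and `-e i` of the cross-polytope to the vertices `i` and
`d + 1 + i` of a simplex, extended linearly to the orthants. -/
noncomputable def orthantMap (x : Fin (d + 1) → ℝ) : Fin (2 * d + 3) → ℝ :=
  ∑ i : Fin (d + 1), (Pi.single ⟨i, by omega⟩ (max (x i) 0) +
    Pi.single ⟨d + 1 + i, by omega⟩ (max (-x i) 0))

theorem continuous_orthantMap : Continuous (orthantMap (d := d)) := by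
  refine continuous_finsetSum _ fun i _ => ?_
  refine Continuous.add ?_ ?_
  · exact (continuous_single (A := fun _ => ℝ) _).comp (by fun_prop)
  · exact (continuous_single (A := fun _ => ℝ) _).comp (by fun_prop)

theorem orthantMap_nonneg (x : Fin (d + 1) → ℝ) : 0 ≤ orthantMap x :=
  Finset.sum_nonneg fun _ _ => add_nonneg (Pi.single_nonneg.2 (le_max_right _ _))
    (Pi.single_nonneg.2 (le_max_right _ _))

theorem sum_orthantMap (x : Fin (d + 1) → ℝ) : ∑ j, orthantMap x j = ∑ i, |x i| := by
  simp only [orthantMap, Finset.sum_apply]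
  rw [Finset.sum_comm]
  refine Finset.sum_congr rfl fun i _ => ?_
  simp only [Pi.add_apply, Finset.sum_add_distrib, Finset.sum_pi_single', Finset.mem_univ,
    if_true]
  rcases le_total 0 (x i) with h | h
  · rw [max_eq_left h, max_eq_right (by linarith), abs_of_nonneg h, add_zero]
  · rw [max_eq_right h, max_eq_left (by linarith), abs_of_nonpos h, zero_add]

theorem exists_of_orthantMap_ne_zero {x : Fin (d + 1) → ℝ} {j : Fin (2 * d + 3)}
    (hj : orthantMap x j ≠ 0) :
    ∃ i : Fin (d + 1), (0 < x i ∧ j.1 = i) ∨ (x i < 0 ∧ j.1 = d + 1 + i) := by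
  rw [orthantMap, Finset.sum_apply] at hj
  obtain ⟨i, -, hi⟩ := Finset.exists_ne_zero_of_sum_ne_zero hj
  refine ⟨i, ?_⟩
  by_contra! hne
  refine hi ?_
  rw [Pi.add_apply, Pi.single_apply, Pi.single_apply]
  simp only [Fin.ext_iff]
  rcases lt_trichotomy (x i) 0 with h | h | h
  · rw [if_neg (hne.2 h), max_eq_right h.le]
    simp
  · simp [h]
  · rw [if_neg (hne.1 h), max_eq_right (by linarith : -x i ≤ 0)]
    simp

theorem ncard_support_orthantMap_le (x : Fin (d + 1) → ℝ) :
    {j | orthantMap x j ≠ 0}.ncard ≤ d + 1 := by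
  have h1 : {j | orthantMap x j ≠ 0} ⊆ Set.range fun i : Fin (d + 1) =>
      if 0 < x i then (⟨i, by omega⟩ : Fin (2 * d + 3)) else ⟨d + 1 + i, by omega⟩ := by
    intro j hj
    obtain ⟨i, ⟨h, hi⟩ | ⟨h, hi⟩⟩ := exists_of_orthantMap_ne_zero hj
    · exact ⟨i, by simp [h, Fin.ext_iff, hi]⟩
    · exact ⟨i, by simp [h.not_gt, Fin.ext_iff, hi]⟩
  refine (Set.ncard_le_ncard h1).trans ?_
  rw [← Set.image_univ]
  exact (Set.ncard_image_le).trans (by simp [Set.ncard_univ])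

theorem disjoint_support_orthantMap_neg (x : Fin (d + 1) → ℝ) :
    Disjoint {j | orthantMap x j ≠ 0} {j | orthantMap (-x) j ≠ 0} := by
  refine Set.disjoint_left.2 fun j h1 h2 => ?_
  obtain ⟨i, hi⟩ := exists_of_orthantMap_ne_zero h1
  obtain ⟨k, hk⟩ := exists_of_orthantMap_ne_zero h2
  rw [Pi.neg_apply, neg_pos, neg_lt_zero] at hk
  have hik : i = k := by
    rw [Fin.ext_iff]
    rcases hi with hi | hi <;> rcases hk with hk | hk <;> omega
  subst hik
  rcases hi with hi | hi <;> rcases hk with hk | hk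
  · exact lt_asymm hi.1 hk.1
  · omega
  · omega
  · exact lt_asymm hi.1 hk.1

theorem sum_abs_pos_of_ne_zero {x : Fin (d + 1) → ℝ} (hx : x ≠ 0) : 0 < ∑ i, |x i| := by
  obtain ⟨i, hi⟩ := Function.ne_iff.1 hx
  exact Finset.sum_pos' (fun _ _ => abs_nonneg _) ⟨i, Finset.mem_univ i, abs_pos.2 hi⟩

theorem support_smul_orthantMap {x : Fin (d + 1) → ℝ} (hx : x ≠ 0) :
    {j | ((∑ i, |x i|)⁻¹ • orthantMap x) j ≠ 0} = {j | orthantMap x j ≠ 0} := by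
  ext j
  simp [(sum_abs_pos_of_ne_zero hx).ne']

/-- The radial projection to the boundary of the cross-polytope, followed by the inclusion of
that boundary into the `d`-skeleton of the simplex. -/
noncomputable def toSkeleton (x : {x : Fin (d + 1) → ℝ // x ≠ 0}) :
    {x : Fin (2 * d + 3) → ℝ //
        (∀ i, 0 ≤ x i) ∧ ∑ i, x i = 1 ∧ {i | x i ≠ 0}.ncard ≤ d + 1} :=
  ⟨(∑ i, |x.1 i|)⁻¹ • orthantMap x.1,
    fun j => mul_nonneg (inv_nonneg.2 (sum_abs_pos_of_ne_zero x.2).le) (orthantMap_nonneg x.1 j),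
    by
      simp only [Pi.smul_apply, smul_eq_mul]
      rw [← Finset.mul_sum, sum_orthantMap, inv_mul_cancel₀ (sum_abs_pos_of_ne_zero x.2).ne'],
    by
      rw [support_smul_orthantMap x.2]
      exact ncard_support_orthantMap_le x.1⟩

theorem continuous_toSkeleton : Continuous (toSkeleton (d := d)) := by
  refine Continuous.subtype_mk (Continuous.smul (Continuous.inv₀ ?_ fun x =>
    (sum_abs_pos_of_ne_zero x.2).ne') (continuous_orthantMap.comp continuous_subtype_val)) _
  exact continuous_finsetSum _ fun i _ =>
    ((continuous_apply i).comp continuous_subtype_val).abs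

end CrossPolytope

/-- **Van Kampen–Flores theorem.**
Let `d ≥ 1` and let `Σ` be the `d`-skeleton of the standard `(2d+2)`-dimensional simplex
`Δ_{2d+2} ⊆ ℝ^{2d+3}`, i.e. the set of points of the simplex whose support has at most
`d + 1` elements. For every continuous map `f : Σ → ℝ^d` there are two disjoint faces of
`Σ` whose images intersect: there are disjoint sets `S, T` of vertices and points `x, y`
of `Σ` supported on `S` resp. `T` with `f x = f y`. -/
theorem van_kampen_flores
    (d : ℕ) (hd : 1 ≤ d)
    (f : {x : Fin (2 * d + 3) → ℝ //
        (∀ i, 0 ≤ x i) ∧ ∑ i, x i = 1 ∧ {i | x i ≠ 0}.ncard ≤ d + 1} → (Fin d → ℝ))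
    (hf : Continuous f) :
    ∃ S T : Set (Fin (2 * d + 3)), Disjoint S T ∧
      ∃ x y : {x : Fin (2 * d + 3) → ℝ //
          (∀ i, 0 ≤ x i) ∧ ∑ i, x i = 1 ∧ {i | x i ≠ 0}.ncard ≤ d + 1},
        {i | x.1 i ≠ 0} ⊆ S ∧ {i | y.1 i ≠ 0} ⊆ T ∧ f x = f y := by
  classical
  let G (x : Fin (d + 1) → ℝ) : Fin d → ℝ := if hx : x ≠ 0 then
    f (toSkeleton ⟨x, hx⟩) - f (toSkeleton ⟨-x, neg_ne_zero.2 hx⟩) else 0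
  have hG : ContinuousOn G {0}ᶜ := by
    rw [continuousOn_iff_continuous_domRestrict]
    have h1 : Continuous fun x : {x : Fin (d + 1) → ℝ // x ≠ 0} =>
        f (toSkeleton x) - f (toSkeleton ⟨-x.1, neg_ne_zero.2 x.2⟩) :=
      (hf.comp continuous_toSkeleton).sub (hf.comp (continuous_toSkeleton.comp
        (continuous_subtype_val.neg.subtype_mk _)))
    refine h1.congr fun x => ?_
    have hx : G x.1 = _ := dif_pos x.2
    exact hx.symm
  have hodd (x) : G (-x) = -G x := by
    by_cases hx : x = 0
    · simp [G, hx]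
    · simp [G, hx]
  obtain ⟨x, hx, h0⟩ := exists_eq_zero_of_odd_of_continuousOn hG hodd
  refine ⟨_, _, disjoint_support_orthantMap_neg x, toSkeleton ⟨x, hx⟩,
    toSkeleton ⟨-x, neg_ne_zero.2 hx⟩, (support_smul_orthantMap hx).subset,
    (support_smul_orthantMap (neg_ne_zero.2 hx)).subset, ?_⟩
  simpa [G, hx, sub_eq_zero] using h0
end

section
/- Let d ≥ 1 be an integer and let ℱ be a finite family of subsets of ℝ^d such that for every nonempty subfamily ℱ' ⊆ ℱ the intersection ⋂ℱ' is either empty or d-connected. Then ⋂ℱ = ∅ if and only if there exists a subfamily 𝒢 ⊆ ℱ with at most d+1 elements and ⋂𝒢 = ∅. -/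
/-- A topological space is `k`-connected if it is nonempty, path-connected, and its
homotopy groups `π_j` are trivial for all `1 ≤ j ≤ k`. -/
def IsKConnectedSpace (k : ℕ) (X : Type) [TopologicalSpace X] : Prop :=
  Nonempty X ∧ PathConnectedSpace X ∧
    ∀ j : ℕ, 1 ≤ j → j ≤ k → ∀ x : X, Subsingleton (HomotopyGroup (Fin j) X x)

section DiscreteCochains

variable {ι : Type*} [DecidableEq ι]

/-- The mod 2 cup product of the coboundaries of the `0`-cochains in a list, as a cubical cochain
on the grid `ι → ℕ`: its value on the cube based at `x` spanned by the directions in `J`. -/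
def cupCoboundaries : List ((ι → ℕ) → ZMod 2) → Finset ι → (ι → ℕ) → ZMod 2
  | [], _, _ => 1
  | l :: L, J, x => ∑ j ∈ J, (l (x + Pi.single j 1) + l x) *
      cupCoboundaries L (J.erase j) (x + Pi.single j 1)

/-- The mod 2 cubical coboundary on the grid `ι → ℕ`. -/
def cubeCoboundary (c : Finset ι → (ι → ℕ) → ZMod 2) (J : Finset ι) (x : ι → ℕ) : ZMod 2 :=
  ∑ j ∈ J, (c (J.erase j) (x + Pi.single j 1) + c (J.erase j) x)

theorem sum_sum_erase_eq_zero {J : Finset ι} (F : ι → ι → ZMod 2) (hF : ∀ j k, F j k = F k j) :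
    ∑ j ∈ J, ∑ k ∈ J.erase j, F j k = 0 := by
  rw [Finset.sum_sigma']
  refine Finset.sum_involution (fun p _ => ⟨p.2, p.1⟩) ?_ ?_ ?_ ?_
  · rintro ⟨j, k⟩ _
    simp only [hF k j]
    exact CharTwo.add_self_eq_zero _
  · rintro ⟨j, k⟩ h _ heq
    simp only [Finset.mem_sigma, Finset.mem_erase] at h
    simp only [Sigma.mk.injEq] at heq
    exact h.2.1 heq.1
  · rintro ⟨j, k⟩ h
    simp only [Finset.mem_sigma, Finset.mem_erase] at h ⊢
    exact ⟨h.2.2, h.2.1.symm, h.1⟩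
  · rintro ⟨j, k⟩ _
    rfl

theorem cubeCoboundary_cubeCoboundary (c : Finset ι → (ι → ℕ) → ZMod 2) (J : Finset ι)
    (x : ι → ℕ) : cubeCoboundary (cubeCoboundary c) J x = 0 := by
  simp only [cubeCoboundary, ← Finset.sum_add_distrib]
  refine sum_sum_erase_eq_zero _ fun j k => ?_
  rw [Finset.erase_right_comm, add_right_comm x]
  ring

theorem cubeCoboundary_cupCoboundaries (L : List ((ι → ℕ) → ZMod 2)) :
    (∀ J x, cubeCoboundary (cupCoboundaries L) J x = 0) ∧
    ∀ l J x, cupCoboundaries (l :: L) J x =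
      cubeCoboundary (fun J x => l x * cupCoboundaries L J x) J x := by
  have key : ∀ L : List ((ι → ℕ) → ZMod 2),
      (∀ J x, cubeCoboundary (cupCoboundaries L) J x = 0) →
      ∀ l J x, cupCoboundaries (l :: L) J x =
        cubeCoboundary (fun J x => l x * cupCoboundaries L J x) J x := by
    intro L hL l J x
    have h := congrArg (l x * ·) (hL J x)
    simp only [cubeCoboundary, mul_zero, Finset.mul_sum] at h
    rw [← add_zero (cupCoboundaries (l :: L) J x), ← h]
    simp only [cupCoboundaries, cubeCoboundary, ← Finset.sum_add_distrib]
    refine Finset.sum_congr rfl fun j _ => ?_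
    linear_combination CharTwo.add_self_eq_zero
      (l x * cupCoboundaries L (J.erase j) (x + Pi.single j 1))
  suffices h : ∀ J x, cubeCoboundary (cupCoboundaries L) J x = 0 from ⟨h, key L h⟩
  induction L with
  | nil =>
    intro J x
    exact Finset.sum_eq_zero fun j _ => CharTwo.add_self_eq_zero _
  | cons l L ih =>
    intro J x
    have : cupCoboundaries (l :: L) = cubeCoboundary (fun J x => l x * cupCoboundaries L J x) := by
      ext J x
      exact key L ih l J x
    rw [this, cubeCoboundary_cubeCoboundary]

theorem cupCoboundaries_eq_zero {l : (ι → ℕ) → ZMod 2} {a : ZMod 2}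
    {L : List ((ι → ℕ) → ZMod 2)} (hl : l ∈ L) {J : Finset ι} {x : ι → ℕ}
    (h : ∀ y, x ≤ y → (∀ i, y i ≤ x i + if i ∈ J then 1 else 0) → l y = a) :
    cupCoboundaries L J x = 0 := by
  induction L generalizing J x with
  | nil => simp at hl
  | cons m L ih =>
    refine Finset.sum_eq_zero fun j hj => ?_
    rcases List.mem_cons.1 hl with rfl | hl
    · rw [h x le_rfl (fun i => by simp), h (x + Pi.single j 1) (by simp) ?_,
        CharTwo.add_self_eq_zero, zero_mul]
      intro i
      by_cases hi : i = j
      · subst hi; simp [hj]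
      · simp [hi]
    · rw [ih hl, mul_zero]
      intro y hy hy'
      refine h y (le_trans (by simp) hy) fun i => (hy' i).trans ?_
      by_cases hi : i = j
      · subst hi; simp [hj]
      · simp [hi]

/-- The base points of the unit cubes of the face of `{0, …, N} ^ ι` with directions `J`
through `b`. -/
def gridBox [Fintype ι] (N : ℕ) (J : Finset ι) (b : ι → ℕ) : Finset (ι → ℕ) :=
  Fintype.piFinset fun i => if i ∈ J then Finset.range N else {b i}

theorem mem_gridBox [Fintype ι] {N : ℕ} {J : Finset ι} {b x : ι → ℕ} :
    x ∈ gridBox N J b ↔ ∀ i, (i ∈ J → x i < N) ∧ (i ∉ J → x i = b i) := by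
  simp only [gridBox, Fintype.mem_piFinset]
  refine forall_congr' fun i => ?_
  by_cases h : i ∈ J <;> simp [h]

theorem sum_gridBox [Fintype ι] {N : ℕ} {J : Finset ι} {b : ι → ℕ} {j : ι} (hj : j ∈ J)
    (h : (ι → ℕ) → ZMod 2) :
    ∑ x ∈ gridBox N J b, h x =
      ∑ t ∈ Finset.range N, ∑ x ∈ gridBox N (J.erase j) b, h (Function.update x j t) := by
  rw [← Finset.sum_product']
  refine Finset.sum_nbij' (fun z => (z j, Function.update z j (b j)))
    (fun p => Function.update p.2 j p.1) ?_ ?_ ?_ ?_ ?_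
  · intro z hz
    rw [mem_gridBox] at hz
    simp only [Finset.mem_product, Finset.mem_range, mem_gridBox]
    refine ⟨(hz j).1 hj, fun i => ?_⟩
    by_cases hi : i = j
    · subst hi; simp
    · simpa [hi] using hz i
  · rintro ⟨t, x⟩ hx
    simp only [Finset.mem_product, Finset.mem_range, mem_gridBox] at hx ⊢
    intro i
    by_cases hi : i = j
    · subst hi; simp [hj, hx.1]
    · simpa [hi] using hx.2 i
  · intro z _
    simp
  · rintro ⟨t, x⟩ hx
    simp only [Finset.mem_product, mem_gridBox] at hx
    have : x j = b j := (hx.2 j).2 (by simp)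
    simp [← this]
  · intro z _
    simp

theorem sum_gridBox_update [Fintype ι] {N : ℕ} {J : Finset ι} {b : ι → ℕ} {j : ι} (hj : j ∉ J)
    (t : ℕ) (h : (ι → ℕ) → ZMod 2) :
    ∑ x ∈ gridBox N J b, h (Function.update x j t) =
      ∑ x ∈ gridBox N J (Function.update b j t), h x := by
  refine Finset.sum_nbij' (fun z => Function.update z j t) (fun z => Function.update z j (b j))
    ?_ ?_ ?_ ?_ ?_
  · intro z hz
    rw [mem_gridBox] at hz ⊢
    intro i
    by_cases hi : i = j
    · subst hi; simp [hj]
    · simpa [hi] using hz i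
  · intro z hz
    rw [mem_gridBox] at hz ⊢
    intro i
    by_cases hi : i = j
    · subst hi; simp [hj]
    · simpa [hi] using hz i
  · intro z hz
    rw [mem_gridBox] at hz
    simp [← (hz j).2 hj]
  · intro z hz
    rw [mem_gridBox] at hz
    have := (hz j).2 hj
    simp only [Function.update_self] at this
    simp [← this]
  · intro z _
    rfl

theorem sum_gridBox_shift [Fintype ι] {N : ℕ} {J : Finset ι} {b : ι → ℕ} {j : ι} (hj : j ∈ J)
    (h : (ι → ℕ) → ZMod 2) :
    ∑ x ∈ gridBox N J b, (h (x + Pi.single j 1) + h x) =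
      ∑ x ∈ gridBox N (J.erase j) (Function.update b j N), h x +
        ∑ x ∈ gridBox N (J.erase j) (Function.update b j 0), h x := by
  have hupd : ∀ (x : ι → ℕ) (t : ℕ),
      Function.update x j t + Pi.single j 1 = Function.update x j (t + 1) := by
    intro x t
    ext i
    by_cases hi : i = j
    · subst hi; simp
    · simp [hi]
  rw [sum_gridBox hj]
  simp only [hupd, Finset.sum_add_distrib,
    sum_gridBox_update (Finset.notMem_erase j J) _ h]
  generalize hg : (fun t => ∑ x ∈ gridBox N (J.erase j) (Function.update b j t), h x) = g
  simp only [funext_iff] at hg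
  simp only [hg]
  rw [← Finset.sum_add_distrib]
  clear hg
  induction N with
  | zero => simp [CharTwo.add_self_eq_zero]
  | succ N ih =>
    rw [Finset.sum_range_succ, ih]
    linear_combination CharTwo.add_self_eq_zero (g N)

theorem sum_cupCoboundaries [Fintype ι] {N : ℕ} {l : ι → (ι → ℕ) → ZMod 2}
    (h0 : ∀ i x, x i = 0 → l i x = 0) (hN : ∀ i x, x i = N → l i x = 1)
    (D : List ι) (hD : D.Nodup) (b : ι → ℕ) :
    ∑ x ∈ gridBox N D.toFinset b, cupCoboundaries (D.map l) D.toFinset x = 1 := by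
  induction D generalizing b with
  | nil =>
    have : gridBox N ∅ b = {b} := by
      ext x
      simp [mem_gridBox, funext_iff]
    simp [this, cupCoboundaries]
  | cons d D ih =>
    rw [List.nodup_cons] at hD
    simp only [List.map_cons, (cubeCoboundary_cupCoboundaries _).2]
    simp only [cubeCoboundary]
    rw [Finset.sum_comm]
    have hface : ∀ j ∈ D, ∀ (t : ℕ) (a : ZMod 2), (∀ y, y j = t → l j y = a) →
        ∑ x ∈ gridBox N ((d :: D).toFinset.erase j) (Function.update b j t),
          l d x * cupCoboundaries (D.map l) ((d :: D).toFinset.erase j) x = 0 := by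
      intro j hj t a hta
      refine Finset.sum_eq_zero fun x hx => ?_
      rw [cupCoboundaries_eq_zero (List.mem_map_of_mem hj) (a := a), mul_zero]
      intro y hy hy'
      have hxj := ((mem_gridBox.1 hx) j).2 (by simp)
      rw [Function.update_self] at hxj
      refine hta y (le_antisymm ?_ (hxj ▸ hy j))
      simpa [hxj] using hy' j
    have hd : (d :: D).toFinset.erase d = D.toFinset := by
      rw [List.toFinset_cons, Finset.erase_insert (by simpa using hD.1)]
    have hterm := fun j (hj : j ∈ (d :: D).toFinset) =>
      sum_gridBox_shift (N := N) (b := b) hj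
        (fun x => l d x * cupCoboundaries (D.map l) ((d :: D).toFinset.erase j) x)
    rw [Finset.sum_congr rfl hterm, Finset.sum_eq_single_of_mem d (by simp)]
    · rw [hd]
      have hNsum : ∀ (t : ℕ) (a : ZMod 2), (∀ y, y d = t → l d y = a) →
          ∑ x ∈ gridBox N D.toFinset (Function.update b d t),
            l d x * cupCoboundaries (D.map l) D.toFinset x = a := by
        intro t a hta
        have : ∀ x ∈ gridBox N D.toFinset (Function.update b d t),
            l d x * cupCoboundaries (D.map l) D.toFinset x =
              a * cupCoboundaries (D.map l) D.toFinset x := by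
          intro x hx
          rw [hta x]
          simpa using ((mem_gridBox.1 hx) d).2 (by simpa using hD.1)
        rw [Finset.sum_congr rfl this, ← Finset.mul_sum, ih hD.2, mul_one]
      rw [hNsum N 1 (hN d), hNsum 0 0 (h0 d), add_zero]
    · intro j hj hjd
      have hjD : j ∈ D := by simpa [hjd] using hj
      rw [hface j hjD N 1 (hN j), hface j hjD 0 0 (h0 j), add_zero]

/-- **Kuhn's cubical Sperner lemma**. -/
theorem exists_cube_of_boundary_labels [Fintype ι] {N : ℕ} {l : ι → (ι → ℕ) → ZMod 2}
    (h0 : ∀ i x, x i = 0 → l i x = 0) (hN : ∀ i x, x i = N → l i x = 1) :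
    ∃ x : ι → ℕ, (∀ i, x i < N) ∧ ∀ i a, ∃ y, x ≤ y ∧ (∀ k, y k ≤ x k + 1) ∧ l i y = a := by
  have hsum := sum_cupCoboundaries h0 hN (Finset.univ : Finset ι).toList
    (Finset.nodup_toList _) 0
  rw [Finset.toList_toFinset] at hsum
  obtain ⟨x, hx, hne⟩ := Finset.exists_ne_zero_of_sum_ne_zero (hsum.trans_ne one_ne_zero)
  refine ⟨x, fun i => (mem_gridBox.1 hx i).1 (Finset.mem_univ i), fun i a => ?_⟩
  by_contra! hcon
  refine hne (cupCoboundaries_eq_zero (l := l i) (a := a + 1)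
    (List.mem_map_of_mem (by simp)) fun y hy hy' => ?_)
  have hZ : ∀ u a : ZMod 2, u ≠ a → u = a + 1 := by decide
  exact hZ _ _ (hcon y hy (by simpa using hy'))

end DiscreteCochains

/-- **Poincaré–Miranda theorem**. -/
theorem poincare_miranda {ι : Type*} [Fintype ι] {H : (ι → ℝ) → ι → ℝ} (hH : Continuous H)
    (h0 : ∀ x ∈ Set.Icc (0 : ι → ℝ) 1, ∀ i, x i = 0 → 0 ≤ H x i)
    (h1 : ∀ x ∈ Set.Icc (0 : ι → ℝ) 1, ∀ i, x i = 1 → H x i ≤ 0) :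
    ∃ x ∈ Set.Icc (0 : ι → ℝ) 1, H x = 0 := by
  classical
  have hK : IsCompact (Set.Icc (0 : ι → ℝ) 1) := isCompact_Icc
  obtain ⟨x, hx, hmin⟩ := hK.exists_isMinOn ⟨0, by simp⟩ (hH.norm.continuousOn)
  refine ⟨x, hx, ?_⟩
  by_contra hne
  have hε : 0 < ‖H x‖ := norm_pos_iff.2 hne
  obtain ⟨δ, hδ, huc⟩ := Metric.uniformContinuousOn_iff.1
    (hK.uniformContinuousOn_of_continuous hH.continuousOn) ‖H x‖ hε
  obtain ⟨n, hn⟩ := exists_nat_one_div_lt hδ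
  set N := n + 1 with hN
  have hNpos : (0 : ℝ) < N := by positivity
  have hn' : 1 / (N : ℝ) < δ := by simpa [hN] using hn
  let p : (ι → ℕ) → ι → ℝ := fun y i => y i / N
  obtain ⟨q, hq, hlab⟩ := exists_cube_of_boundary_labels (N := N)
    (l := fun i y => if y i = 0 then 0 else if y i = N then 1 else if H (p y) i < 0 then 1 else 0)
    (fun i y hy => by simp [hy]) (fun i y hy => by simp [hy, hN])
  have hmem : ∀ y : ι → ℕ, (∀ i, y i ≤ q i + 1) → p y ∈ Set.Icc (0 : ι → ℝ) 1 := by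
    intro y hy
    refine ⟨fun i => by simp only [p, Pi.zero_apply]; positivity, fun i => ?_⟩
    have : y i ≤ N := (hy i).trans (hq i)
    simp only [p, Pi.one_apply]
    exact div_le_one_of_le₀ (by exact_mod_cast this) hNpos.le
  have hqm := hmem q fun i => by simp
  have hclose : ∀ y : ι → ℕ, q ≤ y → (∀ i, y i ≤ q i + 1) →
      ∀ i, |H (p y) i - H (p q) i| < ‖H x‖ := by
    intro y hy hy' i
    have hd : dist (p y) (p q) < δ := by
      refine lt_of_le_of_lt ((dist_pi_le_iff (by positivity)).2 fun k => ?_) hn'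
      simp only [p, Real.dist_eq, ← sub_div, abs_div, Nat.abs_cast]
      gcongr
      have h1 : (q k : ℝ) ≤ y k := by exact_mod_cast hy k
      have h2 : (y k : ℝ) ≤ q k + 1 := by exact_mod_cast hy' k
      rw [abs_le]
      constructor <;> linarith
    have := huc _ (hmem y hy') _ hqm hd
    rw [← Real.dist_eq]
    exact (dist_le_pi_dist _ _ i).trans_lt this
  have hlt : ‖H (p q)‖ < ‖H x‖ := by
    refine (pi_norm_lt_iff hε).2 fun i => ?_
    obtain ⟨y, hy, hy', hly⟩ := hlab i 0
    obtain ⟨z, hz, hz', hlz⟩ := hlab i 1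
    have hyc := abs_lt.1 (hclose y hy hy' i)
    have hzc := abs_lt.1 (hclose z hz hz' i)
    have hypos : 0 ≤ H (p y) i := by
      by_cases c1 : y i = 0
      · exact h0 _ (hmem y hy') i (by simp [p, c1])
      · by_cases c2 : y i = N
        · simp [c2, hN] at hly
        · by_contra! c3
          simp [c1, c2, c3] at hly
    have hzneg : H (p z) i ≤ 0 := by
      by_cases c1 : z i = 0
      · simp [c1] at hlz
      · by_cases c2 : z i = N
        · exact h1 _ (hmem z hz') i (by simp [p, c2, hNpos.ne'])
        · by_contra! c3
          simp [c1, c2, c3.le.not_gt] at hlz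
    rw [Real.norm_eq_abs, abs_lt]
    constructor <;> linarith
  exact absurd (hmin hqm) (not_le.2 hlt)

section BallExtension

open scoped unitInterval

/-- A continuous map from the cube `[-1, 1] ^ ι` to `ℝ ^ ι × ℝ` that avoids the origin, contracts
the boundary of the cube to a point, and meets every ray from the origin. -/
noncomputable def rayParam {ι : Type*} [Fintype ι] (u : ι → ℝ) : (ι → ℝ) × ℝ :=
  ((1 - ‖u‖) • u, 2 * ‖u‖ - 1)

variable {ι : Type*} [Fintype ι]

theorem continuous_rayParam : Continuous (rayParam (ι := ι)) := by
  unfold rayParam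
  fun_prop

theorem rayParam_ne_zero (u : ι → ℝ) : rayParam u ≠ 0 := by
  intro h
  simp only [rayParam, Prod.mk_eq_zero, smul_eq_zero, sub_eq_zero] at h
  obtain ⟨h1 | h1, h2⟩ := h
  · rw [← h1] at h2; norm_num at h2
  · simp [h1] at h2

theorem rayParam_of_norm_eq_one {u : ι → ℝ} (h : ‖u‖ = 1) : rayParam u = (0, 1) := by
  simp only [rayParam, h]
  norm_num

theorem rayParam_ray_injective {u u' : ι → ℝ} (hu : ‖u‖ ≤ 1) (hu' : ‖u'‖ ≤ 1) {s : ℝ} (hs : 0 < s)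
    (h : rayParam u = s • rayParam u') : u = u' ∨ (‖u‖ = 1 ∧ ‖u'‖ = 1) := by
  simp only [rayParam, Prod.smul_mk, Prod.mk.injEq, smul_eq_mul] at h
  obtain ⟨h1, h2⟩ := h
  have h3 := congrArg norm h1
  simp only [norm_smul, Real.norm_eq_abs, abs_of_nonneg (sub_nonneg.2 hu),
    abs_of_nonneg (sub_nonneg.2 hu'), abs_of_pos hs] at h3
  set m := ‖u‖
  set m' := ‖u'‖
  have hm : 0 ≤ m := norm_nonneg u
  have hm' : 0 ≤ m' := norm_nonneg u'
  have h4 : s * ((m - m') * (m * m' + (1 - m) * (1 - m'))) = 0 := by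
    linear_combination (s * m' * (1 - m')) * h2 - (s * (2 * m' - 1)) * h3
  rcases hu'.eq_or_lt with e' | l'
  · rcases hu.eq_or_lt with e | l
    · exact .inr ⟨e, e'⟩
    · rw [e'] at h2 h3
      have : m = 0 := by nlinarith
      rw [this] at h2
      linarith
  · rcases hu.eq_or_lt with e | l
    · rw [e] at h2 h3
      have h5 : m' = 0 := by
        have : s * (1 - m') * m' = 0 := by linarith
        have h6 : 0 < s * (1 - m') := mul_pos hs (by linarith)
        exact (mul_eq_zero.1 this).resolve_left h6.ne'
      rw [h5] at h2
      linarith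
    · have hp : 0 < m * m' + (1 - m) * (1 - m') :=
        add_pos_of_nonneg_of_pos (mul_nonneg hm hm') (mul_pos (by linarith) (by linarith))
      have hmm : m = m' := by
        rcases mul_eq_zero.1 h4 with h | h
        · exact absurd h hs.ne'
        · rcases mul_eq_zero.1 h with h | h
          · linarith
          · exact absurd h hp.ne'
      left
      rcases hm'.eq_or_lt with e | l0
      · have e1 : u' = 0 := norm_eq_zero.1 e.symm
        have e2 : u = 0 := norm_eq_zero.1 (hmm.trans e.symm)
        rw [e1, e2]
      · have hs1 : s = 1 := by
          rw [hmm] at h3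
          have h6 : 0 < (1 - m') * m' := mul_pos (by linarith) l0
          have : (s - 1) * ((1 - m') * m') = 0 := by linear_combination -h3
          linarith [(mul_eq_zero.1 this).resolve_right h6.ne']
        rw [hs1, one_smul, hmm] at h1
        exact smul_right_injective _ (sub_ne_zero.2 l'.ne') h1

theorem exists_rayParam_eq_smul [Nonempty ι] {z : (ι → ℝ) × ℝ} (hz : z ≠ 0) :
    ∃ u : ι → ℝ, ‖u‖ ≤ 1 ∧ ∃ s : ℝ, 0 < s ∧ rayParam u = s • z := by
  obtain ⟨a, b⟩ := z
  by_cases ha : a = 0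
  · subst ha
    have hb : b ≠ 0 := fun h => hz (by rw [h]; rfl)
    rcases hb.lt_or_gt with hb | hb
    · refine ⟨0, by simp, -b⁻¹, by simpa using hb, ?_⟩
      simp [rayParam, hb.ne]
    · have h1 : ‖(1 : ι → ℝ)‖ = 1 := by simp
      refine ⟨1, h1.le, b⁻¹, by simpa using hb, ?_⟩
      rw [rayParam_of_norm_eq_one h1]
      simp [hb.ne']
  · have hα : 0 < ‖a‖ := norm_pos_iff.2 ha
    obtain ⟨m, ⟨hm0, hm1⟩, hm⟩ : ∃ m ∈ Set.Icc (0 : ℝ) 1,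
        (fun m : ℝ => (2 * m - 1) * ‖a‖ - b * (m * (1 - m))) m = 0 := by
      refine intermediate_value_Icc zero_le_one (Continuous.continuousOn (by fun_prop)) ?_
      constructor <;> norm_num
    simp only at hm
    have hm0' : 0 < m := by
      refine hm0.lt_of_ne' fun h => ?_
      rw [h] at hm; linarith
    have hm1' : m < 1 := by
      refine hm1.lt_of_ne fun h => ?_
      rw [h] at hm; linarith
    have hn : ‖(m / ‖a‖) • a‖ = m := by
      rw [norm_smul, Real.norm_eq_abs, abs_of_pos (div_pos hm0' hα), div_mul_cancel₀ _ hα.ne']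
    refine ⟨(m / ‖a‖) • a, hn.trans_le hm1, m * (1 - m) / ‖a‖, by
      have : 0 < 1 - m := by linarith
      positivity, ?_⟩
    simp only [rayParam, hn, Prod.smul_mk, smul_smul, Prod.mk.injEq, smul_eq_mul]
    constructor
    · congr 1; ring
    · field_simp
      linarith

/-- The affine map from the unit cube to the cube `[-1, 1] ^ ι`. -/
def centerCube (y : ι → I) : ι → ℝ := fun i => 2 * (y i : ℝ) - 1

theorem norm_centerCube_le (y : ι → I) : ‖centerCube y‖ ≤ 1 := by
  refine (pi_norm_le_iff_of_nonneg zero_le_one).2 fun i => ?_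
  have h0 := (y i).2.1
  have h1 := (y i).2.2
  rw [Real.norm_eq_abs, abs_le]
  constructor <;> simp only [centerCube] <;> linarith

theorem norm_centerCube_eq_one_iff {y : ι → I} :
    ‖centerCube y‖ = 1 ↔ y ∈ Cube.boundary ι := by
  constructor
  · intro h
    by_contra hy
    refine h.not_lt ((pi_norm_lt_iff one_pos).2 fun i => ?_)
    have h0 : (0 : ℝ) < y i := (y i).2.1.lt_of_ne fun h => hy ⟨i, .inl (Subtype.ext h.symm)⟩
    have h1 : (y i : ℝ) < 1 := (y i).2.2.lt_of_ne fun h => hy ⟨i, .inr (Subtype.ext h)⟩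
    rw [Real.norm_eq_abs, abs_lt]
    constructor <;> simp only [centerCube] <;> linarith
  · rintro ⟨i, hi⟩
    refine le_antisymm (norm_centerCube_le y) ?_
    refine le_trans ?_ (norm_le_pi_norm _ i)
    rcases hi with hi | hi <;> simp only [centerCube, hi] <;> norm_num

theorem exists_centerCube_eq {u : ι → ℝ} (hu : ‖u‖ ≤ 1) : ∃ y : ι → I, centerCube y = u := by
  have h := fun i => abs_le.1 ((Real.norm_eq_abs _).symm.trans_le ((norm_le_pi_norm u i).trans hu))
  refine ⟨fun i => ⟨(u i + 1) / 2, by linarith [(h i).1], by linarith [(h i).2]⟩, ?_⟩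
  ext i
  simp only [centerCube]
  ring

theorem centerCube_injective {κ : Type*} : Function.Injective (centerCube (ι := κ)) := by
  intro y y' h
  ext i
  have := congrFun h i
  simp only [centerCube] at this
  linarith

/-- A continuous surjection from the cube onto the unit sphere of `ℝ ^ ι × ℝ` contracting the
boundary of the cube to a point. -/
noncomputable def cubeToSphere : C(ι → I, Metric.sphere (0 : (ι → ℝ) × ℝ) 1) where
  toFun y := ⟨‖rayParam (centerCube y)‖⁻¹ • rayParam (centerCube y), by
    simp [norm_smul, rayParam_ne_zero]⟩
  continuous_toFun := by
    have h : Continuous fun y : ι → I => rayParam (centerCube y) :=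
      continuous_rayParam.comp (by unfold centerCube; fun_prop)
    exact Continuous.subtype_mk ((h.norm.inv₀ fun y => by simp [rayParam_ne_zero]).smul h) _

theorem cubeToSphere_eq_of_mem_boundary {y y' : ι → I} (hy : y ∈ Cube.boundary ι)
    (hy' : y' ∈ Cube.boundary ι) : cubeToSphere y = cubeToSphere y' := by
  ext1
  simp [cubeToSphere, rayParam_of_norm_eq_one (norm_centerCube_eq_one_iff.2 hy),
    rayParam_of_norm_eq_one (norm_centerCube_eq_one_iff.2 hy')]

theorem eq_or_mem_boundary_of_cubeToSphere_eq {y y' : ι → I}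
    (h : cubeToSphere y = cubeToSphere y') :
    y = y' ∨ (y ∈ Cube.boundary ι ∧ y' ∈ Cube.boundary ι) := by
  have hpos : ∀ y : ι → I, 0 < ‖rayParam (centerCube y)‖ := fun y =>
    norm_pos_iff.2 (rayParam_ne_zero _)
  have h' := congrArg Subtype.val h
  simp only [cubeToSphere, ContinuousMap.coe_mk] at h'
  rw [inv_smul_eq_iff₀ (hpos y).ne', smul_smul] at h'
  rcases rayParam_ray_injective (norm_centerCube_le y) (norm_centerCube_le y')
    (mul_pos (hpos y) (inv_pos.2 (hpos y'))) h' with h | h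
  · exact .inl (centerCube_injective h)
  · exact .inr ⟨norm_centerCube_eq_one_iff.1 h.1, norm_centerCube_eq_one_iff.1 h.2⟩

theorem cubeToSphere_surjective [Nonempty ι] : Function.Surjective (cubeToSphere (ι := ι)) := by
  rintro ⟨z, hz⟩
  rw [mem_sphere_zero_iff_norm] at hz
  obtain ⟨u, hu, s, hs, h⟩ := exists_rayParam_eq_smul (z := z) fun h => by simp [h] at hz
  obtain ⟨y, rfl⟩ := exists_centerCube_eq hu
  refine ⟨y, Subtype.ext ?_⟩
  simp [cubeToSphere, h, norm_smul, hz, abs_of_pos hs, smul_smul, hs.ne']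

/-- If all homotopy groups of a space modelled on `ι` are trivial, then every map from the
unit sphere of `ℝ ^ ι × ℝ` to it extends to the unit ball. -/
theorem exists_extension_closedBall_of_subsingleton_homotopyGroup [Nonempty ι] {X : Type*}
    [TopologicalSpace X] (hX : ∀ x : X, Subsingleton (HomotopyGroup ι X x))
    (f : C(Metric.sphere (0 : (ι → ℝ) × ℝ) 1, X)) :
    ∃ F : C(Metric.closedBall (0 : (ι → ℝ) × ℝ) 1, X),
      ∀ z (hz : z ∈ Metric.sphere (0 : (ι → ℝ) × ℝ) 1),
        F ⟨z, Metric.sphere_subset_closedBall hz⟩ = f ⟨z, hz⟩ := by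
  let y₀ : ι → I := fun _ => 0
  have hy₀ : y₀ ∈ Cube.boundary ι := ⟨Classical.arbitrary ι, .inl rfl⟩
  let x₀ : X := f (cubeToSphere y₀)
  let γ : GenLoop ι X x₀ := ⟨f.comp cubeToSphere, fun y hy => by
    simp only [ContinuousMap.comp_apply, x₀, cubeToSphere_eq_of_mem_boundary hy hy₀]⟩
  obtain ⟨H⟩ : GenLoop.Homotopic γ GenLoop.const :=
    Quotient.exact (@Subsingleton.elim (HomotopyGroup ι X x₀) (hX x₀) ⟦γ⟧ ⟦GenLoop.const⟧)
  have hH0 : ∀ y, H (0, y) = f (cubeToSphere y) := fun y => H.apply_zero y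
  have hH1 : ∀ y, H (1, y) = x₀ := fun y => H.apply_one y
  have hHb : ∀ t, ∀ y ∈ Cube.boundary ι, H (t, y) = x₀ := fun t y hy =>
    (H.eq_fst t hy).trans (γ.2 y hy)
  have hqc : Continuous fun p : I × (ι → I) =>
      (1 - (p.1 : ℝ)) • (cubeToSphere p.2 : (ι → ℝ) × ℝ) :=
    (continuous_const.sub (continuous_subtype_val.comp continuous_fst)).smul
      (continuous_subtype_val.comp (cubeToSphere.continuous.comp continuous_snd))
  have hqm : ∀ p : I × (ι → I), (1 - (p.1 : ℝ)) • (cubeToSphere p.2 : (ι → ℝ) × ℝ) ∈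
      Metric.closedBall (0 : (ι → ℝ) × ℝ) 1 := by
    intro p
    have := p.1.2.1
    have := p.1.2.2
    rw [mem_closedBall_zero_iff, norm_smul, norm_eq_of_mem_sphere, mul_one, Real.norm_eq_abs,
      abs_le]
    constructor <;> linarith
  let q : C(I × (ι → I), Metric.closedBall (0 : (ι → ℝ) × ℝ) 1) :=
    { toFun := fun p => ⟨(1 - (p.1 : ℝ)) • (cubeToSphere p.2 : (ι → ℝ) × ℝ), hqm p⟩
      continuous_toFun := hqc.subtype_mk hqm }
  have hqn : ∀ p, ‖(q p : (ι → ℝ) × ℝ)‖ = 1 - p.1 := by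
    intro p
    simp [q, norm_smul, abs_of_nonneg (sub_nonneg.2 p.1.2.2)]
  have hqs : Function.Surjective q := by
    rintro ⟨z, hz⟩
    rw [mem_closedBall_zero_iff] at hz
    by_cases h0 : z = 0
    · refine ⟨(1, y₀), Subtype.ext ?_⟩
      simp [q, h0]
    · obtain ⟨y, hy⟩ := cubeToSphere_surjective (ι := ι) ⟨‖z‖⁻¹ • z, by simp [norm_smul, h0]⟩
      refine ⟨(⟨1 - ‖z‖, by linarith, by linarith [norm_nonneg z]⟩, y), Subtype.ext ?_⟩
      simp [q, hy, smul_smul, h0]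
  have hq : Topology.IsQuotientMap q :=
    Topology.IsQuotientMap.of_surjective_continuous hqs q.continuous
  have hcompat : ∀ p p', q p = q p' → H p = H p' := by
    rintro ⟨t, y⟩ ⟨t', y'⟩ h
    have htt : t = t' := by
      have h1 := hqn (t, y)
      rw [h, hqn] at h1
      ext
      simp only at h1
      linarith
    subst htt
    by_cases ht : t = 1
    · rw [ht, hH1, hH1]
    · have ht' : 1 - (t : ℝ) ≠ 0 := fun h =>
        ht (Subtype.ext (by simpa using (sub_eq_zero.1 h).symm))
      have := congrArg Subtype.val h
      simp only [q, ContinuousMap.coe_mk] at this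
      rcases eq_or_mem_boundary_of_cubeToSphere_eq
        (Subtype.ext (smul_right_injective _ ht' this)) with h | h
      · rw [h]
      · rw [hHb t y h.1, hHb t y' h.2]
  refine ⟨hq.lift H.toContinuousMap hcompat, fun z hz => ?_⟩
  obtain ⟨y, hy⟩ := cubeToSphere_surjective ⟨z, hz⟩
  have hqy : q (0, y) = ⟨z, Metric.sphere_subset_closedBall hz⟩ := by
    ext1
    simp [q, hy]
  rw [← hqy, ← hy, ← hH0 y]
  exact DFunLike.congr_fun (hq.lift_comp H.toContinuousMap hcompat) (0, y)

end BallExtension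

section CubeExtension

/-- The boundary of the unit cube. -/
def cubeBoundary (M : Type*) : Set (M → ℝ) :=
  {z | z ∈ Set.Icc 0 1 ∧ ∃ i, z i = 0 ∨ z i = 1}

theorem norm_affine_le_one_iff {M : Type*} [Fintype M] {z : M → ℝ} :
    ‖fun m => 2 * z m - 1‖ ≤ 1 ↔ z ∈ Set.Icc (0 : M → ℝ) 1 := by
  simp only [pi_norm_le_iff_of_nonneg zero_le_one, Real.norm_eq_abs, abs_le, Set.mem_Icc,
    Pi.le_def, ← forall_and, Pi.zero_apply, Pi.one_apply]
  refine forall_congr' fun m => ?_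
  constructor <;> rintro ⟨h1, h2⟩ <;> constructor <;> linarith

theorem norm_affine_eq_one_iff {M : Type*} [Fintype M] {z : M → ℝ} :
    ‖fun m => 2 * z m - 1‖ = 1 ↔ z ∈ cubeBoundary M := by
  have hlt : ‖fun m => 2 * z m - 1‖ < 1 ↔ ∀ m, 0 < z m ∧ z m < 1 := by
    simp only [pi_norm_lt_iff one_pos, Real.norm_eq_abs, abs_lt]
    refine forall_congr' fun m => ?_
    constructor <;> rintro ⟨h1, h2⟩ <;> constructor <;> linarith
  have key : ‖fun m => 2 * z m - 1‖ = 1 ↔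
      ‖fun m => 2 * z m - 1‖ ≤ 1 ∧ ¬ ‖fun m => 2 * z m - 1‖ < 1 := by
    rw [not_lt]
    exact le_antisymm_iff
  rw [key, hlt, norm_affine_le_one_iff]
  refine and_congr_right fun hz => ⟨fun h => ?_, ?_⟩
  · by_contra! hcon
    exact h fun m => ⟨(hz.1 m).lt_of_ne (hcon m).1.symm, (hz.2 m).lt_of_ne (hcon m).2⟩
  · rintro ⟨i, hi | hi⟩ h
    · exact absurd hi (h i).1.ne'
    · exact absurd hi (h i).2.ne

/-- The norm-preserving identification of `ℝ ^ M` with `ℝ ^ ι × ℝ` given by `Option ι ≃ M`. -/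
theorem norm_comp_optionEquiv {ι M : Type*} [Fintype ι] [Fintype M] (e : Option ι ≃ M)
    (u : M → ℝ) : ‖((fun i => u (e (some i)), u (e none)) : (ι → ℝ) × ℝ)‖ = ‖u‖ := by
  refine le_antisymm (max_le ((pi_norm_le_iff_of_nonneg (norm_nonneg _)).2 fun i =>
    norm_le_pi_norm u _) (norm_le_pi_norm u _)) ?_
  refine (pi_norm_le_iff_of_nonneg (norm_nonneg _)).2 fun m => ?_
  obtain ⟨o, rfl⟩ := e.surjective m
  cases o with
  | none => exact le_max_right _ _
  | some i => exact (norm_le_pi_norm (fun i => u (e (some i))) i).trans (le_max_left _ _)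

/-- A map from the boundary of a cube of dimension at most `d + 1` to a `d`-connected set extends
to the cube. -/
theorem exists_extension_cube {Y : Type} [TopologicalSpace Y] {A : Set Y} {d : ℕ}
    (hA : IsKConnectedSpace d A) {M : Type*} [Fintype M] (hM : Fintype.card M ≤ d + 1)
    {f : (M → ℝ) → Y} (hf : ContinuousOn f (cubeBoundary M))
    (hfA : Set.MapsTo f (cubeBoundary M) A) :
    ∃ F : (M → ℝ) → Y, ContinuousOn F (Set.Icc 0 1) ∧ Set.MapsTo F (Set.Icc 0 1) A ∧
      Set.EqOn F f (cubeBoundary M) := by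
  obtain ⟨⟨a⟩, hpath, hπ⟩ := hA
  obtain hc | hc | ⟨k, hc⟩ : Fintype.card M = 0 ∨ Fintype.card M = 1 ∨
      ∃ k, Fintype.card M = k + 2 := by
    rcases h : Fintype.card M with _ | _ | k
    · exact .inl rfl
    · exact .inr (.inl rfl)
    · exact .inr (.inr ⟨k, rfl⟩)
  · have := Fintype.card_eq_zero_iff.1 hc
    exact ⟨fun _ => a, continuousOn_const, fun _ _ => a.2, fun z hz => isEmptyElim hz.2.choose⟩
  · obtain ⟨i, hi⟩ := Fintype.card_eq_one_iff.1 hc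
    have h0 : (0 : M → ℝ) ∈ cubeBoundary M := ⟨by simp, i, .inl rfl⟩
    have h1 : (1 : M → ℝ) ∈ cubeBoundary M := ⟨by simp, i, .inr rfl⟩
    let p : Path (⟨f 0, hfA h0⟩ : A) ⟨f 1, hfA h1⟩ := hpath.somePath _ _
    refine ⟨fun z => p.extend (z i), ?_, fun z _ => Subtype.coe_prop _, ?_⟩
    · exact Continuous.continuousOn (continuous_subtype_val.comp
        (p.continuous_extend.comp (continuous_apply i)))
    · rintro z ⟨-, j, hj⟩
      rw [hi j] at hj
      rcases hj with hj | hj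
      · have : z = 0 := funext fun m => by rw [hi m, hj]; rfl
        simp [this]
      · have : z = 1 := funext fun m => by rw [hi m, hj]; rfl
        simp [this]
  · let e : Option (Fin (k + 1)) ≃ M := Fintype.equivOfCardEq (by simp [hc])
    let toE : (M → ℝ) → (Fin (k + 1) → ℝ) × ℝ := fun z =>
      (fun i => 2 * z (e (some i)) - 1, 2 * z (e none) - 1)
    let ofE : (Fin (k + 1) → ℝ) × ℝ → M → ℝ := fun w m =>
      ((e.symm m).elim w.2 w.1 + 1) / 2
    have hto_of : ∀ w, toE (ofE w) = w := by
      rintro ⟨a, b⟩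
      simp [toE, ofE, mul_div_cancel₀]
    have hof_to : ∀ z, ofE (toE z) = z := by
      intro z
      ext m
      obtain ⟨o, rfl⟩ := e.surjective m
      cases o <;> simp [toE, ofE]
    have hnorm : ∀ z, ‖toE z‖ = ‖fun m => 2 * z m - 1‖ := fun z =>
      norm_comp_optionEquiv e fun m => 2 * z m - 1
    have htoc : Continuous toE := by fun_prop
    have hofc : Continuous ofE := by
      refine continuous_pi fun m => ?_
      rcases h : e.symm m with _ | i
      · simp only [ofE, h, Option.elim]; fun_prop
      · simp only [ofE, h, Option.elim]; fun_prop
    have hofb : ∀ w ∈ Metric.sphere (0 : (Fin (k + 1) → ℝ) × ℝ) 1, ofE w ∈ cubeBoundary M := by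
      intro w hw
      rwa [← norm_affine_eq_one_iff, ← hnorm, hto_of, ← mem_sphere_zero_iff_norm]
    have htoball : ∀ z ∈ Set.Icc (0 : M → ℝ) 1,
        toE z ∈ Metric.closedBall (0 : (Fin (k + 1) → ℝ) × ℝ) 1 := by
      intro z hz
      rwa [mem_closedBall_zero_iff, hnorm, norm_affine_le_one_iff]
    obtain ⟨F, hF⟩ := exists_extension_closedBall_of_subsingleton_homotopyGroup (X := A)
      (hπ (k + 1) (by omega) (by omega))
      ⟨fun s => ⟨f (ofE s), hfA (hofb s s.2)⟩, Continuous.subtype_mk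
        (hf.comp_continuous (hofc.comp continuous_subtype_val)
          fun s : Metric.sphere (0 : (Fin (k + 1) → ℝ) × ℝ) 1 => hofb s.1 s.2) _⟩
    classical
    refine ⟨fun z => if hz : z ∈ Set.Icc (0 : M → ℝ) 1 then F ⟨toE z, htoball z hz⟩ else a,
      ?_, ?_, ?_⟩
    · rw [continuousOn_iff_continuous_domRestrict]
      have : Continuous fun z : Set.Icc (0 : M → ℝ) 1 =>
          (F ⟨toE z, htoball z z.2⟩ : Y) :=
        continuous_subtype_val.comp (F.continuous.comp
          ((htoc.comp continuous_subtype_val).subtype_mk _))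
      convert! this using 1
      ext z
      simp only [Set.domRestrict_apply, dif_pos z.2]
    · intro z hz
      simp only [dif_pos hz]
      exact Subtype.coe_prop _
    · intro z hz
      have hs : toE z ∈ Metric.sphere (0 : (Fin (k + 1) → ℝ) × ℝ) 1 := by
        rwa [mem_sphere_zero_iff_norm, hnorm, norm_affine_eq_one_iff]
      simp only [dif_pos hz.1]
      rw [hF _ hs]
      simp [hof_to]

end CubeExtension

section CubeSkeleton

variable {ι : Type*}

open Classical in
/-- The coordinates of a point of the unit cube that are `0` or `1`; a function
`ι → Option Bool` encodes a face of the cube, with `none` marking the free directions. -/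
noncomputable def facePattern (x : ι → ℝ) (i : ι) : Option Bool :=
  if x i = 0 then some false else if x i = 1 then some true else none

theorem facePattern_eq_false {x : ι → ℝ} {i : ι} : facePattern x i = some false ↔ x i = 0 := by
  unfold facePattern
  split_ifs <;> simp_all

theorem facePattern_eq_true {x : ι → ℝ} {i : ι} : facePattern x i = some true ↔ x i = 1 := by
  unfold facePattern
  split_ifs <;> simp_all

theorem facePattern_eq_none {x : ι → ℝ} {i : ι} :
    facePattern x i = none ↔ x i ≠ 0 ∧ x i ≠ 1 := by
  unfold facePattern
  split_ifs <;> simp_all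

/-- The closed face of the unit cube encoded by `w`. -/
def cubeFace (w : ι → Option Bool) : Set (ι → ℝ) :=
  {x | x ∈ Set.Icc 0 1 ∧ ∀ i, w i ≠ none → facePattern x i = w i}

theorem isClosed_cubeFace (w : ι → Option Bool) : IsClosed (cubeFace w) := by
  have : cubeFace w = Set.Icc 0 1 ∩ ⋂ i, {x : ι → ℝ | w i ≠ none → facePattern x i = w i} := by
    ext x
    simp [cubeFace]
  rw [this]
  refine isClosed_Icc.inter (isClosed_iInter fun i => ?_)
  rcases h : w i with _ | _ | _
  · simp
  · simp only [ne_eq, reduceCtorEq, not_false_eq_true, forall_const, facePattern_eq_false]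
    exact isClosed_eq (continuous_apply i) continuous_const
  · simp only [ne_eq, reduceCtorEq, not_false_eq_true, forall_const, facePattern_eq_true]
    exact isClosed_eq (continuous_apply i) continuous_const

variable [Fintype ι]

/-- The dimension of the face encoded by `w`. -/
def faceDim (w : ι → Option Bool) : ℕ := (Finset.univ.filter fun i => w i = none).card

/-- The union of the faces of the unit cube of dimension less than `k`. -/
def cubeSkeleton (ι : Type*) [Fintype ι] (k : ℕ) : Set (ι → ℝ) :=
  {x | x ∈ Set.Icc 0 1 ∧ faceDim (facePattern x) < k}

theorem filter_facePattern_subset {w : ι → Option Bool} {x : ι → ℝ} (hx : x ∈ cubeFace w) :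
    (Finset.univ.filter fun i => facePattern x i = none) ⊆
      Finset.univ.filter fun i => w i = none := by
  intro i
  simp only [Finset.mem_filter, Finset.mem_univ, true_and]
  intro h
  by_contra hw
  exact hw ((hx.2 i hw).symm.trans h)

theorem faceDim_facePattern_le {w : ι → Option Bool} {x : ι → ℝ} (hx : x ∈ cubeFace w) :
    faceDim (facePattern x) ≤ faceDim w :=
  Finset.card_le_card (filter_facePattern_subset hx)

theorem facePattern_eq_of_faceDim_le {w : ι → Option Bool} {x : ι → ℝ} (hx : x ∈ cubeFace w)
    (h : faceDim w ≤ faceDim (facePattern x)) : facePattern x = w := by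
  have heq := Finset.eq_of_subset_of_card_le (filter_facePattern_subset hx) h
  ext1 i
  by_cases hw : w i = none
  · have : i ∈ Finset.univ.filter fun i => w i = none := by simpa using hw
    rw [← heq] at this
    rw [hw]
    simpa using this
  · exact hx.2 i hw

theorem cubeSkeleton_eq_iUnion (k : ℕ) :
    cubeSkeleton ι k = ⋃ w : {w : ι → Option Bool // faceDim w < k}, cubeFace w.1 := by
  ext x
  simp only [Set.mem_iUnion]
  constructor
  · rintro ⟨hx, hk⟩
    exact ⟨⟨facePattern x, hk⟩, hx, fun _ _ => rfl⟩
  · rintro ⟨⟨w, hw⟩, hx⟩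
    exact ⟨hx.1, (faceDim_facePattern_le hx).trans_lt hw⟩

theorem isClosed_cubeSkeleton (k : ℕ) : IsClosed (cubeSkeleton ι k) := by
  rw [cubeSkeleton_eq_iUnion]
  exact isClosed_iUnion_of_finite fun w => isClosed_cubeFace w.1

/-- A map from the boundary of a face of dimension at most `d + 1` to a `d`-connected set extends
to the face. -/
theorem exists_extension_cubeFace {Y : Type} [TopologicalSpace Y] {A : Set Y} {d : ℕ}
    (hA : IsKConnectedSpace d A) (w : ι → Option Bool) (hw : faceDim w ≤ d + 1)
    {f : (ι → ℝ) → Y} (hf : ContinuousOn f (cubeFace w ∩ cubeSkeleton ι (faceDim w)))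
    (hfA : Set.MapsTo f (cubeFace w ∩ cubeSkeleton ι (faceDim w)) A) :
    ∃ F : (ι → ℝ) → Y, ContinuousOn F (cubeFace w) ∧ Set.MapsTo F (cubeFace w) A ∧
      Set.EqOn F f (cubeFace w ∩ cubeSkeleton ι (faceDim w)) := by
  let emb : ({i // w i = none} → ℝ) → ι → ℝ := fun z i =>
    if h : w i = none then z ⟨i, h⟩ else if w i = some true then 1 else 0
  let res : (ι → ℝ) → {i // w i = none} → ℝ := fun x i => x i
  have hembc : Continuous emb := by
    refine continuous_pi fun i => ?_
    by_cases h : w i = none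
    · simp only [emb, dif_pos h]; fun_prop
    · simp only [emb, dif_neg h]; fun_prop
  have hpat : ∀ z i, w i ≠ none → facePattern (emb z) i = w i := by
    intro z i hi
    rcases h : w i with _ | _ | _
    · exact absurd h hi
    · rw [facePattern_eq_false]; simp [emb, h]
    · rw [facePattern_eq_true]; simp [emb, h]
  have hembf : ∀ z ∈ Set.Icc (0 : {i // w i = none} → ℝ) 1, emb z ∈ cubeFace w := by
    intro z hz
    refine ⟨⟨fun i => ?_, fun i => ?_⟩, hpat z⟩
    · by_cases h : w i = none
      · simp only [emb, dif_pos h]; exact hz.1 ⟨i, h⟩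
      · simp only [emb, dif_neg h]; split_ifs <;> simp
    · by_cases h : w i = none
      · simp only [emb, dif_pos h]; exact hz.2 ⟨i, h⟩
      · simp only [emb, dif_neg h]; split_ifs <;> simp
  have hembb : ∀ z ∈ cubeBoundary {i // w i = none},
      emb z ∈ cubeFace w ∩ cubeSkeleton ι (faceDim w) := by
    rintro z ⟨hz, ⟨i, hi⟩, hzi⟩
    refine ⟨hembf z hz, (hembf z hz).1, ?_⟩
    by_contra! hle
    have h := congrFun (facePattern_eq_of_faceDim_le (hembf z hz) hle) i
    rw [hi, facePattern_eq_none] at h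
    simp only [emb, dif_pos hi] at h
    tauto
  have hemb_res : ∀ x ∈ cubeFace w, emb (res x) = x := by
    intro x hx
    ext i
    rcases h : w i with _ | _ | _
    · simp [emb, res, h]
    · have := hx.2 i (by simp [h])
      rw [h, facePattern_eq_false] at this
      simp [emb, h, this]
    · have := hx.2 i (by simp [h])
      rw [h, facePattern_eq_true] at this
      simp [emb, h, this]
  have hresI : ∀ x ∈ cubeFace w, res x ∈ Set.Icc (0 : {i // w i = none} → ℝ) 1 :=
    fun x hx => ⟨fun i => hx.1.1 i, fun i => hx.1.2 i⟩
  obtain ⟨F, hFc, hFA, hFf⟩ := exists_extension_cube hA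
    (M := {i // w i = none}) (by rwa [Fintype.card_subtype]) (f := f ∘ emb)
    (hf.comp hembc.continuousOn hembb) (hfA.comp hembb)
  refine ⟨F ∘ res, hFc.comp (by fun_prop) hresI, hFA.comp hresI, ?_⟩
  rintro x ⟨hx, -, hdim⟩
  have hb : res x ∈ cubeBoundary {i // w i = none} := by
    refine ⟨hresI x hx, ?_⟩
    by_contra! hcon
    refine hdim.not_ge (Finset.card_le_card fun i => ?_)
    simp only [Finset.mem_filter, Finset.mem_univ, true_and]
    intro hi
    exact facePattern_eq_none.2 (hcon ⟨i, hi⟩)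
  simp only [Function.comp_apply, hFf hb, hemb_res x hx]

/-- Skeletal construction of a map from a skeleton of the cube carried by a monotone family
of sufficiently connected sets. -/
theorem exists_continuousOn_cubeSkeleton {Y : Type} [TopologicalSpace Y] [Nonempty Y] {d : ℕ}
    {A : (ι → Option Bool) → Set Y}
    (hmono : ∀ w w', (∀ i, w i ≠ none → w' i = w i) → A w' ⊆ A w) {k : ℕ} (hk : k ≤ d + 2)
    (hA : ∀ w, faceDim w < k → IsKConnectedSpace d (A w)) :
    ∃ f : (ι → ℝ) → Y, ContinuousOn f (cubeSkeleton ι k) ∧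
      ∀ x ∈ cubeSkeleton ι k, f x ∈ A (facePattern x) := by
  classical
  induction k with
  | zero =>
    have : cubeSkeleton ι 0 = ∅ := by ext x; simp [cubeSkeleton]
    rw [this]
    exact ⟨fun _ => Classical.arbitrary Y, continuousOn_empty _, fun x hx => hx.elim⟩
  | succ k ih =>
    obtain ⟨f, hfc, hfA⟩ := ih (by omega) fun w hw => hA w (by omega)
    have hext : ∀ w : ι → Option Bool, ∃ F : (ι → ℝ) → Y, faceDim w = k →
        ContinuousOn F (cubeFace w) ∧ Set.MapsTo F (cubeFace w) (A w) ∧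
          Set.EqOn F f (cubeFace w ∩ cubeSkeleton ι k) := by
      intro w
      by_cases hw : faceDim w = k
      · subst hw
        obtain ⟨F, hF⟩ := exists_extension_cubeFace (hA w (Nat.lt_succ_self _)) w (by omega)
          (hfc.mono Set.inter_subset_right)
          (fun x hx => hmono w (facePattern x) hx.1.2 (hfA x hx.2))
        exact ⟨F, fun _ => hF⟩
      · exact ⟨f, fun h => absurd h hw⟩
    choose F hF using hext
    let g : (ι → ℝ) → Y := fun x =>
      if faceDim (facePattern x) < k then f x else F (facePattern x) x
    refine ⟨g, ?_, ?_⟩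
    · rw [cubeSkeleton_eq_iUnion]
      refine (locallyFinite_of_finite _).continuousOn_iUnion (fun w => isClosed_cubeFace w.1) ?_
      rintro ⟨w, hw⟩
      rcases Nat.lt_succ_iff_lt_or_eq.1 hw with hlt | heq
      · have hsub : cubeFace w ⊆ cubeSkeleton ι k := fun x hx =>
          ⟨hx.1, (faceDim_facePattern_le hx).trans_lt hlt⟩
        refine (hfc.mono hsub).congr fun x hx => ?_
        simp only [g, if_pos (hsub hx).2]
      · refine (hF w heq).1.congr fun x hx => ?_
        by_cases hx' : faceDim (facePattern x) < k
        · simp only [g, if_pos hx']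
          exact ((hF w heq).2.2 ⟨hx, hx.1, hx'⟩).symm
        · simp only [g, if_neg hx']
          rw [facePattern_eq_of_faceDim_le hx (by omega)]
    · rintro x ⟨hx, hdim⟩
      by_cases hx' : faceDim (facePattern x) < k
      · simp only [g, if_pos hx']
        exact hfA x ⟨hx, hx'⟩
      · simp only [g, if_neg hx']
        exact (hF _ (by omega)).2.1 ⟨hx, fun _ _ => rfl⟩

end CubeSkeleton

section Helly

/-- The members of the family constraining the values on the face `w` of the cube: `j` occurs
when the `j`-th coordinate is `1` or an earlier coordinate is `0`. -/
def faceCarrier {n : ℕ} (w : Fin n → Option Bool) : Finset (Fin (n + 1)) :=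
  Finset.univ.filter fun j =>
    (∃ i, i.castSucc = j ∧ w i = some true) ∨ ∃ i, i.castSucc < j ∧ w i = some false

theorem mem_faceCarrier {n : ℕ} {w : Fin n → Option Bool} {j : Fin (n + 1)} :
    j ∈ faceCarrier w ↔
      (∃ i, i.castSucc = j ∧ w i = some true) ∨ ∃ i, i.castSucc < j ∧ w i = some false := by
  simp [faceCarrier]

theorem faceCarrier_mono {n : ℕ} {w w' : Fin n → Option Bool}
    (h : ∀ i, w i ≠ none → w' i = w i) : faceCarrier w ⊆ faceCarrier w' := by
  intro j
  simp only [mem_faceCarrier]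
  rintro (⟨i, hi, hw⟩ | ⟨i, hi, hw⟩)
  · exact .inl ⟨i, hi, (h i (by simp [hw])).trans hw⟩
  · exact .inr ⟨i, hi, (h i (by simp [hw])).trans hw⟩

theorem faceCarrier_ne_univ {n : ℕ} (w : Fin n → Option Bool) : faceCarrier w ≠ Finset.univ := by
  intro h
  have hall : ∀ j, j ∈ faceCarrier w := fun j => h ▸ Finset.mem_univ j
  have htrue : ∀ i, w i = some true := by
    intro i
    induction i using WellFoundedLT.induction with
    | _ i ih =>
      rcases mem_faceCarrier.1 (hall i.castSucc) with ⟨i', hi', hw⟩ | ⟨i', hi', hw⟩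
      · rwa [← Fin.castSucc_injective _ hi']
      · simp [ih i' (Fin.castSucc_lt_castSucc_iff.1 hi')] at hw
  rcases mem_faceCarrier.1 (hall (Fin.last n)) with ⟨i, hi, -⟩ | ⟨i, -, hw⟩
  · exact Fin.castSucc_ne_last i hi
  · simp [htrue i] at hw

theorem faceDim_lt_iff_faceCarrier_nonempty {n : ℕ} {w : Fin n → Option Bool} :
    faceDim w < n ↔ (faceCarrier w).Nonempty := by
  have h1 : faceDim w < n ↔ ∃ i, w i ≠ none := by
    have := Finset.card_lt_iff_ne_univ (Finset.univ.filter fun i => w i = none)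
    simpa [faceDim, Finset.eq_univ_iff_forall] using this
  rw [h1]
  constructor
  · rintro ⟨i, hi⟩
    rcases h : w i with _ | _ | _
    · exact absurd h hi
    · exact ⟨Fin.last n, mem_faceCarrier.2 (.inr ⟨i, Fin.castSucc_lt_last i, h⟩)⟩
    · exact ⟨i.castSucc, mem_faceCarrier.2 (.inl ⟨i, rfl, h⟩)⟩
  · rintro ⟨j, hj⟩
    rcases mem_faceCarrier.1 hj with ⟨i, -, hw⟩ | ⟨i, -, hw⟩ <;> exact ⟨i, by simp [hw]⟩

theorem isClosed_setOf_mem_faceCarrier {n : ℕ} (j : Fin (n + 1)) :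
    IsClosed {x : Fin n → ℝ | j ∈ faceCarrier (facePattern x)} := by
  have : {x : Fin n → ℝ | j ∈ faceCarrier (facePattern x)} =
      (⋃ i : {i : Fin n // i.castSucc = j}, {x | x i = 1}) ∪
        ⋃ i : {i : Fin n // i.castSucc < j}, {x | x i = 0} := by
    ext x
    simp [mem_faceCarrier, facePattern_eq_true, facePattern_eq_false]
  rw [this]
  exact (isClosed_iUnion_of_finite fun i =>
    isClosed_eq (continuous_apply _) continuous_const).union
      (isClosed_iUnion_of_finite fun i => isClosed_eq (continuous_apply _) continuous_const)

/-- Nonnegative smooth functions on `ℝ ^ d` without common zeros, precomposed with a continuous map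
from the cube, cannot vanish in the pattern prescribed by `faceCarrier`. -/
theorem exists_common_zero_of_faceCarrier {d : ℕ} {F : (Fin (d + 1) → ℝ) → Fin d → ℝ}
    (hF : Continuous F) {h : Fin (d + 2) → (Fin d → ℝ) → ℝ} (hh : ∀ j, ContDiff ℝ 1 (h j))
    (hpos : ∀ j y, 0 ≤ h j y)
    (hzero : ∀ x ∈ Set.Icc (0 : Fin (d + 1) → ℝ) 1, ∀ j ∈ faceCarrier (facePattern x),
      h j (F x) = 0) :
    ∃ y, ∀ j, h j y = 0 := by
  by_contra! hne
  obtain ⟨p, hp, hpr⟩ : ∃ p : Fin (d + 2) → ℝ, (∀ j, 0 < p j) ∧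
      p ∉ Set.range fun q : ℝ × (Fin d → ℝ) => fun j => q.1 * h j q.2 := by
    have hd : Dense (Set.range fun q : ℝ × (Fin d → ℝ) => fun j => q.1 * h j q.2)ᶜ := by
      refine ContDiff.dense_compl_range_of_finrank_lt_finrank ?_ (by simp; omega)
      exact contDiff_pi.2 fun j => contDiff_fst.mul ((hh j).comp contDiff_snd)
    have ho : IsOpen {p : Fin (d + 2) → ℝ | ∀ j, 0 < p j} := by
      simp only [Set.ofPred_forall]
      exact isOpen_iInter_of_finite fun j => isOpen_lt continuous_const (continuous_apply j)
    obtain ⟨p, h1, h2⟩ := hd.inter_open_nonempty _ ho ⟨1, fun j => one_pos⟩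
    exact ⟨p, h1, h2⟩
  let P : Fin (d + 1) → ℝ := fun i => ∑ j ∈ Finset.Ioi i.castSucc, p j
  let S : Fin (d + 1) → (Fin (d + 1) → ℝ) → ℝ := fun i x =>
    ∑ j ∈ Finset.Ioi i.castSucc, h j (F x)
  have hP : ∀ i, 0 < P i := fun i =>
    Finset.sum_pos (fun j _ => hp j) ⟨Fin.last _, by simp [Fin.castSucc_lt_last]⟩
  have hhF : ∀ j, Continuous fun x => h j (F x) := fun j => (hh j).continuous.comp hF
  obtain ⟨x, hx, hHx⟩ := poincare_miranda
    (H := fun x i => h i.castSucc (F x) * P i - p i.castSucc * S i x)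
    (continuous_pi fun i => ((hhF _).mul continuous_const).sub
      (continuous_const.mul (continuous_finsetSum _ fun j _ => hhF j)))
    (by
      intro x hx i hi
      have hS : S i x = 0 := Finset.sum_eq_zero fun j hj => hzero x hx j
        (mem_faceCarrier.2 (.inr ⟨i, Finset.mem_Ioi.1 hj, facePattern_eq_false.2 hi⟩))
      simp only [hS, mul_zero, sub_zero]
      exact mul_nonneg (hpos _ _) (hP i).le)
    (by
      intro x hx i hi
      have h0 : h i.castSucc (F x) = 0 := hzero x hx _
        (mem_faceCarrier.2 (.inl ⟨i, rfl, facePattern_eq_true.2 hi⟩))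
      simp only [h0, zero_mul, zero_sub, Left.neg_nonpos_iff]
      exact mul_nonneg (hp _).le (Finset.sum_nonneg fun j _ => hpos _ _))
  obtain ⟨μ, hμ⟩ : ∃ μ : ℝ, ∀ j, h j (F x) = μ * p j := by
    refine ⟨h (Fin.last _) (F x) / p (Fin.last _), fun j => ?_⟩
    induction j using WellFoundedGT.induction with
    | _ j ih =>
      induction j using Fin.lastCases with
      | last => rw [div_mul_cancel₀ _ (hp _).ne']
      | cast i =>
        have hS : S i x = h (Fin.last _) (F x) / p (Fin.last _) * P i := by
          simp only [S, P, Finset.mul_sum]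
          exact Finset.sum_congr rfl fun j hj => ih j (Finset.mem_Ioi.1 hj)
        have hi := congrFun hHx i
        simp only [hS, Pi.zero_apply] at hi
        refine mul_right_cancel₀ (hP i).ne' ?_
        linear_combination hi
  have hμ0 : μ ≠ 0 := by
    rintro rfl
    obtain ⟨j, hj⟩ := hne (F x)
    exact hj (by rw [hμ, zero_mul])
  refine hpr ⟨(μ⁻¹, F x), ?_⟩
  ext j
  simp only [hμ]
  rw [inv_mul_cancel_left₀ hμ0]

theorem nonempty_iInter_of_isKConnectedSpace {d : ℕ} {G : Fin (d + 2) → Set (Fin d → ℝ)}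
    (hG : ∀ J : Finset (Fin (d + 2)), J.Nonempty → J ≠ Finset.univ →
      IsKConnectedSpace d ↥(⋂ j ∈ J, G j)) :
    (⋂ j, G j).Nonempty := by
  obtain ⟨f, hfc, hfA⟩ := exists_continuousOn_cubeSkeleton (ι := Fin (d + 1)) (d := d)
    (k := d + 1) (A := fun w => ⋂ j ∈ faceCarrier w, G j)
    (fun w w' h => Set.biInter_subset_biInter_left (faceCarrier_mono h)) (by omega)
    (fun w hw => hG _ (faceDim_lt_iff_faceCarrier_nonempty.1 hw) (faceCarrier_ne_univ w))
  obtain ⟨F, hF⟩ := ContinuousMap.exists_restrict_eq (isClosed_cubeSkeleton (d + 1))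
    (⟨_, continuousOn_iff_continuous_domRestrict.1 hfc⟩ :
      C(cubeSkeleton (Fin (d + 1)) (d + 1), Fin d → ℝ))
  have hFf : ∀ x ∈ cubeSkeleton (Fin (d + 1)) (d + 1), F x = f x := fun x hx =>
    DFunLike.congr_fun hF ⟨x, hx⟩
  let C : Fin (d + 2) → Set (Fin d → ℝ) := fun j =>
    F '' (Set.Icc 0 1 ∩ {x | j ∈ faceCarrier (facePattern x)})
  have hC : ∀ j, IsClosed (C j) := fun j =>
    ((isCompact_Icc.inter_right (isClosed_setOf_mem_faceCarrier j)).image F.continuous).isClosed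
  have hCG : ∀ j, C j ⊆ G j := by
    rintro j _ ⟨x, ⟨hx, hj⟩, rfl⟩
    have hxs : x ∈ cubeSkeleton (Fin (d + 1)) (d + 1) :=
      ⟨hx, faceDim_lt_iff_faceCarrier_nonempty.2 ⟨j, hj⟩⟩
    rw [hFf x hxs]
    exact Set.mem_iInter₂.1 (hfA x hxs) j hj
  have hsm := fun j => (hC j).isOpen_compl.exists_contDiff_support_eq (n := 1)
  choose h hsupp hsmooth hrange using hsm
  have hmem : ∀ j y, h j y = 0 ↔ y ∈ C j := by
    intro j y
    rw [← not_iff_not, ← Set.mem_compl_iff, ← hsupp j, Function.mem_support]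
  obtain ⟨y, hy⟩ := exists_common_zero_of_faceCarrier F.continuous hsmooth
    (fun j y => (hrange j ⟨y, rfl⟩).1)
    (fun x hx j hj => (hmem j _).2 ⟨x, ⟨hx, hj⟩, rfl⟩)
  exact ⟨y, Set.mem_iInter.2 fun j => hCG j ((hmem j y).1 (hy j))⟩

end Helly

/-- **Matoušek's Helly-type theorem from the topological Radon theorem.**
Let `d ≥ 1` and let `ℱ` be a finite family of subsets of `ℝ^d` such that the intersection
of every nonempty subfamily is empty or `d`-connected. Then `⋂ℱ = ∅` iff some subfamily
with at most `d + 1` members has empty intersection. -/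
theorem helly_from_topological_radon
    (d : ℕ) (hd : 1 ≤ d)
    (ℱ : Finset (Set (Fin d → ℝ)))
    (hconn : ∀ ℱ' : Finset (Set (Fin d → ℝ)), ℱ' ⊆ ℱ → ℱ'.Nonempty →
      ⋂₀ (ℱ' : Set (Set (Fin d → ℝ))) = ∅ ∨
        IsKConnectedSpace d ↥(⋂₀ (ℱ' : Set (Set (Fin d → ℝ))))) :
    ⋂₀ (ℱ : Set (Set (Fin d → ℝ))) = ∅ ↔
      ∃ 𝒢 ⊆ ℱ, 𝒢.card ≤ d + 1 ∧ ⋂₀ (𝒢 : Set (Set (Fin d → ℝ))) = ∅ := by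
  classical
  constructor
  swap
  · rintro ⟨𝒢, hsub, -, hempty⟩
    exact Set.subset_eq_empty (Set.sInter_subset_sInter (Finset.coe_subset.2 hsub)) hempty
  intro hℱ
  by_contra! hcon
  suffices hall : ∀ n, ∀ 𝒢 ⊆ ℱ, 𝒢.card = n → (⋂₀ (𝒢 : Set (Set (Fin d → ℝ)))).Nonempty from
    (hall _ ℱ subset_rfl rfl).ne_empty hℱ
  intro n
  induction n using Nat.strong_induction_on with
  | _ n ih =>
    intro 𝒢 h𝒢 hn
    by_cases hle : 𝒢.card ≤ d + 1
    · exact hcon 𝒢 h𝒢 hle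
    obtain ⟨e⟩ : Nonempty (Fin (d + 2) ↪ 𝒢) :=
      Function.Embedding.nonempty_of_card_le (by simp; omega)
    let π : Set (Fin d → ℝ) → Fin (d + 2) := fun A =>
      if hA : A ∈ 𝒢 then Function.invFun e ⟨A, hA⟩ else 0
    have hπ : ∀ j, ∃ A ∈ 𝒢, π A = j := fun j =>
      ⟨e j, (e j).2, by simp [π, Function.leftInverse_invFun e.injective j]⟩
    have hinter : ∀ J : Finset (Fin (d + 2)),
        ⋂ j ∈ J, ⋂₀ {A | A ∈ 𝒢 ∧ π A = j} =
          ⋂₀ ((𝒢.filter fun A => π A ∈ J : Finset _) : Set (Set (Fin d → ℝ))) := by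
      intro J
      ext x
      simp only [Set.mem_iInter, Set.mem_sInter, Finset.coe_filter, Set.mem_ofPred_eq]
      exact ⟨fun h A hA => h _ hA.2 A ⟨hA.1, rfl⟩, fun h j hj A hA => h A ⟨hA.1, hA.2 ▸ hj⟩⟩
    obtain ⟨x, hx⟩ := nonempty_iInter_of_isKConnectedSpace
      (G := fun j => ⋂₀ {A | A ∈ 𝒢 ∧ π A = j}) (by
        intro J hJ hJu
        rw [hinter]
        obtain ⟨j, hj⟩ := hJ
        obtain ⟨A, hA, hAj⟩ := hπ j
        obtain ⟨j', hj'⟩ : ∃ j', j' ∉ J := by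
          by_contra! h
          exact hJu (Finset.eq_univ_iff_forall.2 h)
        obtain ⟨A', hA', hAj'⟩ := hπ j'
        have hlt : (𝒢.filter fun A => π A ∈ J).card < n := by
          rw [← hn]
          exact Finset.card_lt_card (Finset.filter_ssubset.2 ⟨A', hA', by rwa [hAj']⟩)
        have hsub : (𝒢.filter fun A => π A ∈ J) ⊆ ℱ := (Finset.filter_subset _ _).trans h𝒢
        exact (hconn _ hsub ⟨A, Finset.mem_filter.2 ⟨hA, by rwa [hAj]⟩⟩).resolve_left
          (ih _ hlt _ hsub rfl).ne_empty)
    exact ⟨x, fun A hA => (Set.mem_iInter.1 hx (π A)) A ⟨hA, rfl⟩⟩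
end

section
/- Let d ≥ 1 be an integer and let ℱ be a finite family of subsets of ℝ^d such that for every nonempty subfamily ℱ' ⊆ ℱ the intersection ⋂ℱ' is either empty or (⌈d/2⌉−1)-connected. Then ⋂ℱ = ∅ if and only if there exists a subfamily 𝒢 ⊆ ℱ with at most d+2 elements and ⋂𝒢 = ∅. -/
section

open Finset Topology

/-- Augmented ordered simplicial chains modulo 2: a simplex is a list of points, and the empty
list is the simplex of degree `-1`. -/
abbrev OrdChain (E : Type*) := List E →₀ ZMod 2

namespace OrdChain

variable {E : Type*}

theorem add_self (c : OrdChain E) : c + c = 0 := by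
  ext l; simpa using CharTwo.add_self_eq_zero (c l)

/-- Join with a vertex put in front. -/
noncomputable def cone (p : E) : OrdChain E →ₗ[ZMod 2] OrdChain E :=
  Finsupp.lmapDomain _ _ (List.cons p)

/-- Push-forward along a map of vertices. -/
noncomputable def push {F : Type*} (a : E → F) : OrdChain E →ₗ[ZMod 2] OrdChain F :=
  Finsupp.lmapDomain _ _ (List.map a)

/-- The boundary of a single ordered simplex. -/
noncomputable def bdryList : List E → OrdChain E
  | [] => 0
  | p :: l => Finsupp.single l 1 + cone p (bdryList l)

/-- The augmented boundary operator. -/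
noncomputable def bdry : OrdChain E →ₗ[ZMod 2] OrdChain E :=
  Finsupp.linearCombination (ZMod 2) bdryList

/-- The prism over a single ordered simplex, between the vertex maps `a` and `b`. -/
noncomputable def prismList {F : Type*} (a b : E → F) : List E → OrdChain F
  | [] => 0
  | p :: l => Finsupp.single (a p :: b p :: l.map b) 1 + cone (a p) (prismList a b l)

/-- The prism operator between the vertex maps `a` and `b`. -/
noncomputable def prism {F : Type*} (a b : E → F) : OrdChain E →ₗ[ZMod 2] OrdChain F :=
  Finsupp.linearCombination (ZMod 2) (prismList a b)

@[simp] theorem cone_single (p : E) (l : List E) (r : ZMod 2) :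
    cone p (Finsupp.single l r) = Finsupp.single (p :: l) r := by
  simp [cone]

@[simp] theorem push_single {F : Type*} (a : E → F) (l : List E) (r : ZMod 2) :
    push a (Finsupp.single l r) = Finsupp.single (l.map a) r := by
  simp [push]

@[simp] theorem bdry_single (l : List E) : bdry (Finsupp.single l 1) = bdryList l := by
  simp [bdry]

@[simp] theorem prism_single {F : Type*} (a b : E → F) (l : List E) :
    prism a b (Finsupp.single l 1) = prismList a b l := by
  simp [prism]

/-- Linear maps on chains are determined by their values on the simplices in a support. -/
theorem eqOn_supported {M : Type*} [AddCommMonoid M] [Module (ZMod 2) M] {P : Set (List E)}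
    {f g : OrdChain E →ₗ[ZMod 2] M}
    (h : ∀ l ∈ P, f (Finsupp.single l 1) = g (Finsupp.single l 1)) {c : OrdChain E}
    (hc : c ∈ Finsupp.supported (ZMod 2) (ZMod 2) P) : f c = g c := by
  rw [Finsupp.supported_eq_span_single] at hc
  refine LinearMap.eqOn_span (s := (fun i ↦ Finsupp.single i (1 : ZMod 2)) '' P) ?_ hc
  rintro _ ⟨l, hl, rfl⟩
  exact h l hl

theorem map_mem_supported {F : Type*} {P : Set (List E)} {Q : Set (List F)}
    (f : OrdChain E →ₗ[ZMod 2] OrdChain F)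
    (h : ∀ l ∈ P, f (Finsupp.single l 1) ∈ Finsupp.supported (ZMod 2) (ZMod 2) Q)
    {c : OrdChain E} (hc : c ∈ Finsupp.supported (ZMod 2) (ZMod 2) P) :
    f c ∈ Finsupp.supported (ZMod 2) (ZMod 2) Q := by
  rw [Finsupp.supported_eq_span_single] at hc
  suffices Submodule.span (ZMod 2) ((fun i ↦ Finsupp.single i (1 : ZMod 2)) '' P) ≤
      (Finsupp.supported (ZMod 2) (ZMod 2) Q).comap f from this hc
  rw [Submodule.span_le]
  rintro _ ⟨l, hl, rfl⟩
  exact h l hl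

theorem hom_ext {M : Type*} [AddCommMonoid M] [Module (ZMod 2) M]
    {f g : OrdChain E →ₗ[ZMod 2] M}
    (h : ∀ l, f (Finsupp.single l 1) = g (Finsupp.single l 1)) : f = g :=
  LinearMap.ext fun c ↦ eqOn_supported (P := Set.univ) (fun l _ ↦ h l) (by simp)

theorem bdry_cone (p : E) (c : OrdChain E) : bdry (cone p c) = c + cone p (bdry c) := by
  have : bdry ∘ₗ cone p = LinearMap.id + cone p ∘ₗ bdry := hom_ext fun l ↦ by simp [bdryList]
  exact LinearMap.congr_fun this c

theorem bdry_bdry (c : OrdChain E) : bdry (bdry c) = 0 := by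
  have : (bdry : OrdChain E →ₗ[ZMod 2] _) ∘ₗ bdry = 0 := by
    refine hom_ext fun l ↦ ?_
    induction l with
    | nil => simp [bdryList]
    | cons p l ih =>
      simp only [LinearMap.comp_apply, bdry_single, LinearMap.zero_apply, bdryList] at ih ⊢
      simp [bdry_cone, ih, add_self]
  exact LinearMap.congr_fun this c

theorem push_cone {F : Type*} (a : E → F) (p : E) (c : OrdChain E) :
    push a (cone p c) = cone (a p) (push a c) := by
  have : push a ∘ₗ cone p = cone (a p) ∘ₗ push a := hom_ext fun l ↦ by simp
  exact LinearMap.congr_fun this c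

theorem bdry_push {F : Type*} (a : E → F) (c : OrdChain E) :
    bdry (push a c) = push a (bdry c) := by
  have : bdry ∘ₗ push a = push a ∘ₗ bdry := by
    refine hom_ext fun l ↦ ?_
    induction l with
    | nil => simp [bdryList]
    | cons p l ih =>
      simp only [LinearMap.comp_apply, bdry_single, push_single] at ih ⊢
      simp [bdryList, ih, push_cone]
  exact LinearMap.congr_fun this c

theorem push_push {F G : Type*} (a : E → F) (b : F → G) (c : OrdChain E) :
    push b (push a c) = push (b ∘ a) c := by
  have : push b ∘ₗ push a = push (b ∘ a) := hom_ext fun l ↦ by simp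
  exact LinearMap.congr_fun this c

theorem push_id (c : OrdChain E) : push id c = c := by
  have : push (id : E → E) = LinearMap.id := hom_ext fun l ↦ by simp
  exact LinearMap.congr_fun this c

theorem prism_cone {F : Type*} (a b : E → F) (p : E) (c : OrdChain E) :
    prism a b (cone p c) = cone (a p) (cone (b p) (push b c)) + cone (a p) (prism a b c) := by
  have : prism a b ∘ₗ cone p =
      cone (a p) ∘ₗ cone (b p) ∘ₗ push b + cone (a p) ∘ₗ prism a b :=
    hom_ext fun l ↦ by simp [prismList]
  exact LinearMap.congr_fun this c

theorem bdry_prism {F : Type*} (a b : E → F) (c : OrdChain E) :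
    bdry (prism a b c) = push a c + push b c + prism a b (bdry c) := by
  have : bdry ∘ₗ prism a b = push a + push b + prism a b ∘ₗ bdry := by
    refine hom_ext fun l ↦ ?_
    induction l with
    | nil => simp [bdryList, prismList, add_self]
    | cons p l ih =>
      simp only [LinearMap.comp_apply, LinearMap.add_apply, bdry_single, prism_single,
        push_single] at ih ⊢
      have hb := bdry_push b (Finsupp.single l 1)
      simp only [bdry_single, push_single] at hb
      simp only [prismList, bdryList, map_add, bdry_single, bdry_cone, ih, prism_single,
        prism_cone, List.map_cons, cone_single, hb]
      have e := add_self (Finsupp.single (a p :: l.map b) (1 : ZMod 2))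
      symm
      refine (add_zero _).symm.trans ?_
      rw [← e]
      abel
  exact LinearMap.congr_fun this c

/-- The cup product of a `0`-cochain `f` with a cochain `φ`. -/
noncomputable def cup (f : E → ZMod 2) (φ : OrdChain E →ₗ[ZMod 2] ZMod 2) :
    OrdChain E →ₗ[ZMod 2] ZMod 2 :=
  Finsupp.linearCombination (ZMod 2) fun
    | [] => 0
    | p :: l => f p * φ (Finsupp.single (p :: l) 1)

@[simp] theorem cup_nil (f : E → ZMod 2) (φ : OrdChain E →ₗ[ZMod 2] ZMod 2) :
    cup f φ (Finsupp.single [] 1) = 0 := by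
  simp [cup]

theorem cup_single_cons (f : E → ZMod 2) (φ : OrdChain E →ₗ[ZMod 2] ZMod 2) (p : E)
    (l : List E) :
    cup f φ (Finsupp.single (p :: l) 1) = f p * φ (Finsupp.single (p :: l) 1) := by
  simp [cup]

theorem cup_cone (f : E → ZMod 2) (φ : OrdChain E →ₗ[ZMod 2] ZMod 2) (p : E)
    (c : OrdChain E) : cup f φ (cone p c) = f p * φ (cone p c) := by
  have : cup f φ ∘ₗ cone p = f p • (φ ∘ₗ cone p) := hom_ext fun l ↦ by simp [cup_single_cons]
  exact LinearMap.congr_fun this c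

/-- The cup product of the coboundaries of the first `k` among the `0`-cochains `s`. -/
noncomputable def cupCobdry (s : ℕ → E → ZMod 2) : ℕ → OrdChain E →ₗ[ZMod 2] ZMod 2
  | 0 => Finsupp.lapply [] ∘ₗ bdry
  | k + 1 => cup (s k) (cupCobdry s k) ∘ₗ bdry

theorem cupCobdry_bdry (s : ℕ → E → ZMod 2) (k : ℕ) (c : OrdChain E) :
    cupCobdry s k (bdry c) = 0 := by
  cases k <;> simp [cupCobdry, bdry_bdry]

theorem cupCobdry_nil (s : ℕ → E → ZMod 2) (k : ℕ) :
    cupCobdry s k (Finsupp.single [] 1) = 0 := by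
  cases k <;> simp [cupCobdry, bdryList]

theorem cupCobdry_succ_singleton (s : ℕ → E → ZMod 2) (k : ℕ) (p : E) :
    cupCobdry s (k + 1) (Finsupp.single [p] 1) = 0 := by
  simp [cupCobdry, bdryList]

theorem cupCobdry_succ_cons_cons (s : ℕ → E → ZMod 2) (k : ℕ) (p q : E) (l : List E) :
    cupCobdry s (k + 1) (Finsupp.single (p :: q :: l) 1) =
      (s k p + s k q) * cupCobdry s k (Finsupp.single (q :: l) 1) := by
  have h := cupCobdry_bdry s k (Finsupp.single (p :: q :: l) 1)
  simp only [bdry_single, bdryList, map_add, cone_single] at h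
  simp only [cupCobdry, LinearMap.comp_apply, bdry_single, bdryList, map_add, cone_single,
    cup_single_cons, cup_cone]
  have h2 : (2 : ZMod 2) = 0 := rfl
  linear_combination s k p * h - s k p * cupCobdry s k (Finsupp.single (q :: l) 1) * h2

/-- If one of the first `k` cochains is constant on a simplex, the product of coboundaries
vanishes there. -/
theorem cupCobdry_eq_zero (s : ℕ → E → ZMod 2) {i : ℕ} {l : List E}
    (h : ∀ p ∈ l, ∀ q ∈ l, s i p = s i q) {k : ℕ} (hik : i < k) :
    cupCobdry s k (Finsupp.single l 1) = 0 := by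
  induction k generalizing l with
  | zero => omega
  | succ k ih =>
    match l with
    | [] => exact cupCobdry_nil s _
    | [p] => exact cupCobdry_succ_singleton s k p
    | p :: q :: l =>
      rw [cupCobdry_succ_cons_cons]
      rcases Nat.lt_succ_iff_lt_or_eq.1 hik with hik | rfl
      · rw [ih (fun a ha b hb ↦ h a (by simp_all) b (by simp_all)) hik, mul_zero]
      · rw [h p (by simp) q (by simp), CharTwo.add_self_eq_zero, zero_mul]

/-- The product of coboundaries of odd cochains is invariant. -/
theorem cupCobdry_map (s : ℕ → E → ZMod 2) (T : E → E) {l : List E}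
    (h : ∀ i, ∀ p ∈ l, s i (T p) = s i p + 1) (k : ℕ) :
    cupCobdry s k (Finsupp.single (l.map T) 1) = cupCobdry s k (Finsupp.single l 1) := by
  induction k generalizing l with
  | zero =>
    rw [← push_single]
    simp only [cupCobdry, LinearMap.comp_apply, bdry_push]
    generalize bdry (Finsupp.single l 1) = c
    have : Finsupp.lapply [] ∘ₗ push T = (Finsupp.lapply [] : OrdChain E →ₗ[ZMod 2] ZMod 2) := by
      refine hom_ext fun l ↦ ?_
      cases l <;> simp
    exact LinearMap.congr_fun this c
  | succ k ih =>
    match l with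
    | [] => rfl
    | [p] => simp [cupCobdry_succ_singleton]
    | p :: q :: l =>
      have := ih (l := q :: l) fun i a ha ↦ h i a (by simp_all)
      simp only [List.map_cons] at this ⊢
      rw [cupCobdry_succ_cons_cons, cupCobdry_succ_cons_cons, this, h k p (by simp),
        h k q (by simp)]
      have h2 : (2 : ZMod 2) = 0 := rfl
      linear_combination cupCobdry s k (Finsupp.single (q :: l) 1) * h2

theorem cup_add_push (s : ℕ → E → ZMod 2) (T : E → E) {S : Set E}
    (h : ∀ i, ∀ p ∈ S, s i (T p) = s i p + 1) (k : ℕ) {c : OrdChain E}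
    (hc : c ∈ Finsupp.supported (ZMod 2) (ZMod 2) {l | ∀ p ∈ l, p ∈ S}) :
    cup (s k) (cupCobdry s k) (c + push T c) = cupCobdry s k c := by
  refine eqOn_supported (f := cup (s k) (cupCobdry s k) ∘ₗ (LinearMap.id + push T))
    (fun l hl ↦ ?_) hc
  match l with
  | [] => simp [cupCobdry_nil]
  | p :: l =>
    have := cupCobdry_map s T (l := p :: l) (fun i a ha ↦ h i a (hl a ha)) k
    simp only [List.map_cons] at this
    simp only [LinearMap.comp_apply, LinearMap.add_apply, LinearMap.id_apply, map_add,
      push_single, List.map_cons, cup_single_cons, this, h k p (hl p (by simp))]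
    have h2 : (2 : ZMod 2) = 0 := rfl
    linear_combination s k p * cupCobdry s k (Finsupp.single (p :: l) 1) * h2

/-- Evaluation of a product of coboundaries of odd cochains on a tower of hemispheres. -/
theorem cupCobdry_hemispheres (s : ℕ → E → ZMod 2) (T : E → E) {S : Set E}
    (h : ∀ i, ∀ p ∈ S, s i (T p) = s i p + 1) (c : ℕ → OrdChain E) (n : ℕ)
    (hc : ∀ k < n, c k ∈ Finsupp.supported (ZMod 2) (ZMod 2) {l | ∀ p ∈ l, p ∈ S})
    (h0 : bdry (c 0) = Finsupp.single [] 1)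
    (hb : ∀ k < n, bdry (c (k + 1)) = c k + push T (c k)) {k : ℕ} (hk : k ≤ n) :
    cupCobdry s k (c k) = 1 := by
  induction k with
  | zero => simp [cupCobdry, h0]
  | succ k ih =>
    rw [← ih (by omega), ← cup_add_push s T h k (hc k (by omega)), ← hb k (by omega)]
    rfl

theorem prismList_mem_supported {F : Type*} (a b : E → F) (l : List E) :
    prismList a b l ∈
      Finsupp.supported (ZMod 2) (ZMod 2) {l' | ∀ q ∈ l', ∃ p ∈ l, q = a p ∨ q = b p} := by
  induction l with
  | nil => exact Submodule.zero_mem _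
  | cons p l ih =>
    refine Submodule.add_mem _ (Finsupp.single_mem_supported _ _ ?_)
      (map_mem_supported (cone (a p)) (fun l' hl' ↦ ?_) ih)
    · intro q hq
      simp only [List.mem_cons, List.mem_map] at hq
      rcases hq with rfl | rfl | ⟨r, hr, rfl⟩
      · exact ⟨p, by simp, by simp⟩
      · exact ⟨p, by simp, by simp⟩
      · exact ⟨r, by simp [hr], by simp⟩
    · rw [cone_single]
      refine Finsupp.single_mem_supported _ _ fun q hq ↦ ?_
      rcases List.mem_cons.1 hq with rfl | hq
      · exact ⟨p, by simp, by simp⟩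
      · obtain ⟨r, hr, h⟩ := hl' q hq
        exact ⟨r, by simp [hr], h⟩

theorem bdry_sum_prism {F : Type*} (a : ℕ → E → F) {z : OrdChain E} (hz : bdry z = 0) (m : ℕ) :
    bdry (∑ t ∈ range m, prism (a t) (a (t + 1)) z) = push (a 0) z + push (a m) z := by
  induction m with
  | zero => simp [add_self]
  | succ m ih =>
    have e := add_self (push (a m) z)
    rw [sum_range_succ, map_add, ih, bdry_prism, hz, map_zero, add_zero]
    calc _ = push (a 0) z + (push (a m) z + push (a m) z) + push (a (m + 1)) z := by abel
      _ = _ := by rw [e, add_zero]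

/-- Small cycles bound small chains in the join with a point. -/
theorem exists_bdry_eq {E : Type*} [NormedAddCommGroup E] [NormedSpace ℝ E] (e : E) {S : Set E}
    {δ ε D : ℝ} (hδ : 0 ≤ δ) (hε : 0 < ε) (hD : ∀ p ∈ S, dist p e ≤ D) {z : OrdChain E}
    (hz : bdry z = 0)
    (hzS : z ∈ Finsupp.supported (ZMod 2) (ZMod 2)
      {l | (∀ p ∈ l, p ∈ S) ∧ ∀ p ∈ l, ∀ q ∈ l, dist p q ≤ δ}) :
    ∃ c, bdry c = z ∧ c ∈ Finsupp.supported (ZMod 2) (ZMod 2)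
      {l | (∀ p ∈ l, p = e ∨ ∃ x ∈ S, ∃ t ∈ Set.Icc (0 : ℝ) 1, p = AffineMap.lineMap x e t) ∧
        ∀ p ∈ l, ∀ q ∈ l, dist p q ≤ δ + ε} := by
  obtain ⟨m, hm⟩ := exists_nat_gt (D / ε)
  have hm0 : 0 < m + 1 := by omega
  have hm0' : (0 : ℝ) < (m + 1 : ℕ) := by positivity
  let a : ℕ → E → E := fun t x ↦ AffineMap.lineMap x e ((t : ℝ) / (m + 1 : ℕ))
  have ha0 : a 0 = id := by ext x; simp [a]
  have ham : a (m + 1) = fun _ ↦ e := by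
    ext x; simp only [a]; rw [div_self hm0'.ne']; simp
  have hlen : D / (m + 1 : ℕ) ≤ ε := by
    rw [div_le_iff₀ hm0']
    rw [div_lt_iff₀ hε] at hm
    push_cast
    nlinarith
  refine ⟨∑ t ∈ range (m + 1), prism (a t) (a (t + 1)) z + cone e (push (a (m + 1)) z), ?_, ?_⟩
  · rw [map_add, bdry_sum_prism a hz, bdry_cone, bdry_push, hz, map_zero, map_zero, add_zero,
      add_assoc, add_self, add_zero, ha0, push_id]
  refine Submodule.add_mem _ (Submodule.sum_mem _ fun t ht ↦ ?_) ?_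
  · have ht' : t + 1 ≤ m + 1 := by simpa using ht
    have htI : ∀ i ≤ m + 1, (i : ℝ) / (m + 1 : ℕ) ∈ Set.Icc (0 : ℝ) 1 := fun i hi ↦
      ⟨by positivity, (div_le_one hm0').2 (by exact_mod_cast hi)⟩
    have hcontr : ∀ i ≤ m + 1, ∀ x y, dist x y ≤ δ → dist (a i x) (a i y) ≤ δ := by
      intro i hi x y hxy
      have : a i x - a i y = (1 - (i : ℝ) / (m + 1 : ℕ)) • (x - y) := by
        simp only [a, AffineMap.lineMap_apply_module]
        module
      rw [dist_eq_norm, this, norm_smul, Real.norm_of_nonneg (by linarith [(htI i hi).2]),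
        ← dist_eq_norm]
      have h1 := (htI i hi).1
      have h2 := (htI i hi).2
      nlinarith [dist_nonneg (x := x) (y := y)]
    have hstep : ∀ x ∈ S, dist (a t x) (a (t + 1) x) ≤ ε := by
      intro x hx
      simp only [a]
      rw [dist_lineMap_lineMap, Real.dist_eq, ← sub_div, abs_div, abs_of_pos hm0']
      push_cast
      rw [show (t : ℝ) - (t + 1) = -1 by ring, abs_neg, abs_one]
      calc 1 / ((m : ℝ) + 1) * dist x e ≤ 1 / ((m : ℝ) + 1) * D := by
            gcongr; exact hD x hx
        _ = D / (m + 1 : ℕ) := by push_cast; ring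
        _ ≤ ε := hlen
    refine map_mem_supported _ (fun l hl ↦ ?_) hzS
    rw [prism_single]
    refine Finsupp.supported_mono ?_ (prismList_mem_supported (a t) (a (t + 1)) l)
    intro l' hl'
    refine ⟨fun q hq ↦ ?_, fun q hq r hr ↦ ?_⟩
    · obtain ⟨p, hp, rfl | rfl⟩ := hl' q hq
      · exact Or.inr ⟨p, hl.1 p hp, _, htI t (by omega), rfl⟩
      · exact Or.inr ⟨p, hl.1 p hp, _, htI (t + 1) ht', rfl⟩
    · obtain ⟨p, hp, hqp⟩ := hl' q hq
      obtain ⟨p', hp', hrp⟩ := hl' r hr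
      have hpp := hl.2 p hp p' hp'
      have h1 := hcontr t (by omega) _ _ hpp
      have h2 := hcontr (t + 1) ht' _ _ hpp
      have h3 := hstep p (hl.1 p hp)
      have h4 := hstep p' (hl.1 p' hp')
      rcases hqp with rfl | rfl <;> rcases hrp with rfl | rfl
      · linarith
      · linarith [dist_triangle (a t p) (a (t + 1) p) (a (t + 1) p')]
      · linarith [dist_triangle (a (t + 1) p) (a (t + 1) p') (a t p'),
          dist_comm (a t p') (a (t + 1) p')]
      · linarith
  · refine map_mem_supported (cone e ∘ₗ push (a (m + 1))) (fun l hl ↦ ?_) hzS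
    rw [LinearMap.comp_apply, push_single, cone_single]
    have : ∀ p ∈ e :: l.map (a (m + 1)), p = e := by
      intro p hp
      simp only [ham, List.mem_cons, List.mem_map] at hp
      rcases hp with rfl | ⟨_, _, rfl⟩ <;> rfl
    refine Finsupp.single_mem_supported _ _ ⟨fun p hp ↦ Or.inl (this p hp), fun p hp q hq ↦ ?_⟩
    rw [this p hp, this q hq, dist_self]
    linarith

end OrdChain

/-- The octahedral `k`-sphere in the first `k + 1` coordinates. -/
def octSphere (n k : ℕ) : Set (Fin (n + 1) → ℝ) :=
  {x | ∑ i, |x i| = 1 ∧ ∀ i : Fin (n + 1), k < i → x i = 0}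

theorem neg_mem_octSphere {n k : ℕ} {x : Fin (n + 1) → ℝ} (hx : x ∈ octSphere n k) :
    -x ∈ octSphere n k :=
  ⟨by simpa using hx.1, fun i hi ↦ by simp [hx.2 i hi]⟩

theorem norm_le_one_of_sum_abs_eq_one {n : ℕ} {x : Fin n → ℝ} (hx : ∑ i, |x i| = 1) :
    ‖x‖ ≤ 1 := by
  rw [pi_norm_le_iff_of_nonneg zero_le_one]
  intro i
  rw [← hx]
  exact single_le_sum (f := fun i ↦ |x i|) (fun j _ ↦ abs_nonneg (x j)) (mem_univ i)

theorem lineMap_mem_octSphere {n k : ℕ} (hk : k + 1 < n + 1) {x : Fin (n + 1) → ℝ}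
    (hx : x ∈ octSphere n k) {t : ℝ} (ht : t ∈ Set.Icc (0 : ℝ) 1) :
    AffineMap.lineMap x (Pi.single ⟨k + 1, hk⟩ 1) t ∈ octSphere n (k + 1) := by
  have hval : ∀ i, |(AffineMap.lineMap x (Pi.single ⟨k + 1, hk⟩ 1) t : Fin (n + 1) → ℝ) i| =
      (1 - t) * |x i| + t * (Pi.single ⟨k + 1, hk⟩ 1 : Fin (n + 1) → ℝ) i := by
    intro i
    rw [AffineMap.lineMap_apply_module]
    by_cases hi : i = ⟨k + 1, hk⟩
    · subst hi
      have := hx.2 ⟨k + 1, hk⟩ (by simp)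
      simp [this, abs_of_nonneg ht.1]
    · simp [Pi.single_eq_of_ne hi, abs_mul, abs_of_nonneg (sub_nonneg.2 ht.2)]
  refine ⟨?_, fun i hi ↦ ?_⟩
  · rw [sum_congr rfl fun i _ ↦ hval i, sum_add_distrib, ← mul_sum, ← mul_sum, hx.1]
    simp
  · have := hval i
    rw [hx.2 i (by omega), Pi.single_eq_of_ne (by rintro rfl; simp at hi)] at this
    simpa using this

/-- The octahedral spheres have arbitrarily fine hemispheres, each bounded by the sphere one
dimension lower. -/
theorem exists_hemispheres (n k : ℕ) (hk : k ≤ n) (δ : ℝ) (hδ : 0 < δ) :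
    ∃ c : ℕ → OrdChain (Fin (n + 1) → ℝ),
      (∀ j ≤ k, c j ∈ Finsupp.supported (ZMod 2) (ZMod 2)
        {l | (∀ p ∈ l, p ∈ octSphere n j) ∧ ∀ p ∈ l, ∀ q ∈ l, dist p q ≤ δ}) ∧
      OrdChain.bdry (c 0) = Finsupp.single [] 1 ∧
      ∀ j < k, OrdChain.bdry (c (j + 1)) = c j + OrdChain.push Neg.neg (c j) := by
  induction k generalizing δ with
  | zero =>
    refine ⟨fun _ ↦ Finsupp.single [Pi.single 0 1] 1, fun j hj ↦ ?_, ?_, by simp⟩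
    · refine Finsupp.single_mem_supported _ _ ⟨?_, by simpa using hδ.le⟩
      obtain rfl : j = 0 := by omega
      simp only [List.mem_singleton, forall_eq]
      refine ⟨?_, fun i hi ↦ Pi.single_eq_of_ne (by rintro rfl; simp at hi) _⟩
      rw [sum_eq_single 0] <;> simp +contextual
    · simp [OrdChain.bdryList]
  | succ k ih =>
    obtain ⟨c, hc, h0, hb⟩ := ih (by omega) (δ / 2) (by positivity)
    have hz : OrdChain.bdry (c k + OrdChain.push Neg.neg (c k)) = 0 := by
      rw [map_add, OrdChain.bdry_push]
      cases k with
      | zero => simp [h0, OrdChain.add_self]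
      | succ k =>
        rw [hb k (by omega), map_add, OrdChain.push_push, neg_comp_neg, OrdChain.push_id,
          add_comm (OrdChain.push _ _) (c k), OrdChain.add_self]
    have hzS : c k + OrdChain.push Neg.neg (c k) ∈ Finsupp.supported (ZMod 2) (ZMod 2)
        {l | (∀ p ∈ l, p ∈ octSphere n k) ∧ ∀ p ∈ l, ∀ q ∈ l, dist p q ≤ δ / 2} := by
      refine Submodule.add_mem _ (hc k le_rfl) (OrdChain.map_mem_supported _ (fun l hl ↦ ?_)
        (hc k le_rfl))
      rw [OrdChain.push_single]
      refine Finsupp.single_mem_supported _ _ ⟨?_, ?_⟩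
      · simp only [List.mem_map, forall_exists_index, and_imp, forall_apply_eq_imp_iff₂]
        exact fun p hp ↦ neg_mem_octSphere (hl.1 p hp)
      · simp only [List.mem_map, forall_exists_index, and_imp, forall_apply_eq_imp_iff₂,
          dist_neg_neg]
        exact hl.2
    have hk' : k + 1 < n + 1 := by omega
    have heS : (Pi.single ⟨k + 1, hk'⟩ 1 : Fin (n + 1) → ℝ) ∈ octSphere n (k + 1) := by
      refine ⟨?_, fun i hi ↦ Pi.single_eq_of_ne (by rintro rfl; simp at hi) _⟩
      rw [sum_eq_single ⟨k + 1, hk'⟩] <;> simp +contextual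
    obtain ⟨c', hc', hc'S⟩ := OrdChain.exists_bdry_eq (Pi.single ⟨k + 1, hk'⟩ 1)
      (half_pos hδ).le (half_pos hδ) (D := 2) (S := octSphere n k) (fun p hp ↦ by
        rw [dist_eq_norm]
        linarith [norm_sub_le p (Pi.single ⟨k + 1, hk'⟩ 1), norm_le_one_of_sum_abs_eq_one hp.1,
          norm_le_one_of_sum_abs_eq_one heS.1]) hz hzS
    refine ⟨Function.update c (k + 1) c', fun j hj ↦ ?_, ?_, fun j hj ↦ ?_⟩
    · rcases eq_or_ne j (k + 1) with rfl | hjk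
      · rw [Function.update_self]
        refine Finsupp.supported_mono ?_ hc'S
        rintro l ⟨h1, h2⟩
        refine ⟨fun p hp ↦ ?_, by simpa using h2⟩
        rcases h1 p hp with rfl | ⟨x, hx, t, ht, rfl⟩
        · exact heS
        · exact lineMap_mem_octSphere hk' hx ht
      · rw [Function.update_of_ne hjk]
        refine Finsupp.supported_mono ?_ (hc j (by omega))
        exact fun l hl ↦ ⟨hl.1, fun p hp q hq ↦ (hl.2 p hp q hq).trans (by linarith)⟩
    · rw [Function.update_of_ne (by omega), h0]
    · rw [Function.update_of_ne (show j ≠ k + 1 by omega)]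
      rcases eq_or_ne j k with rfl | hjk
      · rw [Function.update_self, hc']
      · rw [Function.update_of_ne (by omega), hb j (by omega)]

/-- **Borsuk–Ulam theorem**, on the octahedral sphere. -/
theorem exists_eq_zero_of_odd {n : ℕ} {g : (Fin (n + 1) → ℝ) → Fin n → ℝ}
    (hg : ContinuousOn g {x | ∑ i, |x i| = 1})
    (hodd : ∀ x : Fin (n + 1) → ℝ, ∑ i, |x i| = 1 → g (-x) = -g x) :
    ∃ x : Fin (n + 1) → ℝ, ∑ i, |x i| = 1 ∧ g x = 0 := by
  classical
  by_contra! hne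
  set S : Set (Fin (n + 1) → ℝ) := {x | ∑ i, |x i| = 1} with hS
  have hScpt : IsCompact S := by
    refine Metric.isCompact_of_isClosed_isBounded (isClosed_eq (by fun_prop) (by fun_prop)) ?_
    exact (Metric.isBounded_closedBall (x := 0) (r := 1)).subset fun x hx ↦ by
      simpa using norm_le_one_of_sum_abs_eq_one hx
  have hSne : S.Nonempty := ⟨Pi.single 0 1, by
    rw [hS, Set.mem_ofPred_eq, sum_eq_single 0] <;> simp +contextual⟩
  obtain ⟨x₀, hx₀, hmin⟩ := hScpt.exists_isMinOn hSne hg.norm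
  have hε : 0 < ‖g x₀‖ := norm_pos_iff.2 (hne x₀ hx₀)
  obtain ⟨δ, hδ, hunif⟩ := Metric.uniformContinuousOn_iff.1
    (hScpt.uniformContinuousOn_of_continuous hg) _ hε
  let τ : (Fin (n + 1) → ℝ) → ZMod 2 := fun p ↦ if WellOrderingRel p (-p) then 1 else 0
  have hτ : ∀ p ∈ S, τ (-p) = τ p + 1 := by
    intro p hp
    have hpn : p ≠ -p := by
      intro h
      have : p = 0 := self_eq_neg.1 h
      simp [hS, this] at hp
    simp only [τ, neg_neg]
    rcases trichotomous_of WellOrderingRel p (-p) with h | h | h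
    · rw [if_pos h, if_neg (asymm h)]; rfl
    · exact absurd h hpn
    · rw [if_pos h, if_neg (asymm h)]; rfl
  let s : ℕ → (Fin (n + 1) → ℝ) → ZMod 2 := fun i p ↦
    if h : i < n then if 0 < g p ⟨i, h⟩ then 1 else if g p ⟨i, h⟩ < 0 then 0 else τ p else τ p
  have hs : ∀ i, ∀ p ∈ S, s i (-p) = s i p + 1 := by
    intro i p hp
    simp only [s, hodd p hp, Pi.neg_apply, Left.neg_neg_iff, Left.neg_pos_iff]
    split_ifs <;>
      first
        | linarith
        | rfl
        | exact hτ p hp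
  obtain ⟨c, hc, h0, hb⟩ := exists_hemispheres n n le_rfl (δ / 2) (by positivity)
  have h1 := OrdChain.cupCobdry_hemispheres s Neg.neg hs c n (fun k hk ↦
    Finsupp.supported_mono (fun l hl p hp ↦ (hl.1 p hp).1) (hc k hk.le)) h0 hb le_rfl
  have h2 : OrdChain.cupCobdry s n (c n) = (0 : OrdChain _ →ₗ[ZMod 2] ZMod 2) (c n) := by
    refine OrdChain.eqOn_supported (fun l hl ↦ ?_) (hc n le_rfl)
    match l with
    | [] => exact OrdChain.cupCobdry_nil s n
    | p :: l =>
      have hp := (hl.1 p (by simp)).1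
      have hge : ¬ ‖g p‖ < ‖g x₀‖ := not_lt.2 (hmin hp)
      rw [pi_norm_lt_iff hε] at hge
      push Not at hge
      obtain ⟨i, hi⟩ := hge
      refine OrdChain.cupCobdry_eq_zero s (i := i) ?_ i.2
      suffices h : ∀ q ∈ p :: l, s i q = s i p from fun a ha b hb ↦ (h a ha).trans (h b hb).symm
      intro q hq
      have hd : dist (g q i) (g p i) < ‖g x₀‖ := (dist_le_pi_dist _ _ i).trans_lt
        (hunif q (hl.1 q hq).1 p hp ((hl.2 q hq p (by simp)).trans_lt (by linarith)))
      rw [Real.dist_eq, abs_lt] at hd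
      rw [Real.norm_eq_abs, le_abs] at hi
      simp only [s, i.2, dite_true, Fin.eta]
      rcases hi with hi | hi
      · rw [if_pos (by linarith), if_pos (by linarith)]
      · rw [if_neg (by linarith), if_pos (by linarith), if_neg (by linarith),
          if_pos (by linarith)]
  rw [h1] at h2
  exact one_ne_zero h2

/-- **Topological Radon theorem.** -/
theorem topological_radon {n : ℕ} {F : (Fin (n + 2) → ℝ) → Fin n → ℝ}
    (hF : ContinuousOn F (stdSimplex ℝ (Fin (n + 2)))) :
    ∃ x ∈ stdSimplex ℝ (Fin (n + 2)), ∃ y ∈ stdSimplex ℝ (Fin (n + 2)),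
      (∀ i, x i = 0 ∨ y i = 0) ∧ F x = F y := by
  let L : (Fin (n + 1) → ℝ) → Fin (n + 2) → ℝ := fun x ↦ Fin.cons (-∑ i, x i) x
  have hLneg : ∀ x i, L (-x) i = -L x i := by
    intro x i
    refine Fin.cases ?_ (fun i ↦ ?_) i <;> simp [L]
  have hLsum : ∀ x, ∑ i, L x i = 0 := by
    intro x; simp [L, Fin.sum_univ_succ]
  have hLcont : Continuous L := by
    refine continuous_pi fun i ↦ ?_
    refine Fin.cases ?_ (fun i ↦ ?_) i <;> simp only [L, Fin.cons_zero, Fin.cons_succ] <;> fun_prop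
  let σ : (Fin (n + 1) → ℝ) → ℝ := fun x ↦ ∑ i, max (L x i) 0
  have hσ : ∀ x : Fin (n + 1) → ℝ, ∑ i, |x i| = 1 → 0 < σ x := by
    intro x hx
    refine lt_of_le_of_ne (sum_nonneg fun i _ ↦ le_max_right _ _) fun h ↦ ?_
    have h1 : ∀ i, L x i ≤ 0 := fun i ↦ by
      have := (sum_eq_zero_iff_of_nonneg fun i _ ↦ le_max_right (L x i) 0).1 h.symm i (mem_univ i)
      exact max_eq_right_iff.1 this
    have h2 : ∀ i, L x i = 0 := fun i ↦
      (sum_eq_zero_iff_of_nonpos fun i _ ↦ h1 i).1 (hLsum x) i (mem_univ i)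
    have h3 : ∀ i, x i = 0 := fun i ↦ by simpa [L] using h2 i.succ
    simp [h3] at hx
  have hneg : ∀ x : Fin (n + 1) → ℝ, ∑ i, |x i| = 1 → ∑ i, |(-x) i| = 1 := by
    intro x hx; simpa using hx
  let u : (Fin (n + 1) → ℝ) → Fin (n + 2) → ℝ := fun x i ↦ max (L x i) 0 / σ x
  have hu : ∀ x : Fin (n + 1) → ℝ, ∑ i, |x i| = 1 → u x ∈ stdSimplex ℝ (Fin (n + 2)) := by
    intro x hx
    refine ⟨fun i ↦ div_nonneg (le_max_right _ _) (hσ x hx).le, ?_⟩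
    simp only [u]
    rw [← sum_div]
    exact div_self (hσ x hx).ne'
  have hucont : ContinuousOn u {x | ∑ i, |x i| = 1} := by
    refine continuousOn_pi.2 fun i ↦ ContinuousOn.div ?_ ?_ fun x hx ↦ (hσ x hx).ne'
    · exact Continuous.continuousOn (by fun_prop)
    · exact Continuous.continuousOn (by fun_prop)
  obtain ⟨x, hx, hgx⟩ := exists_eq_zero_of_odd (g := fun x ↦ F (u x) - F (u (-x)))
    ((hF.comp hucont hu).sub
      (hF.comp (hucont.comp continuous_neg.continuousOn hneg) fun x hx ↦ hu _ (hneg x hx)))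
    (fun x _ ↦ by simp)
  refine ⟨u x, hu x hx, u (-x), hu _ (hneg x hx), fun i ↦ ?_, sub_eq_zero.1 hgx⟩
  rcases le_total (L x i) 0 with h | h
  · left; simp [u, max_eq_right h]
  · right; simp [u, hLneg, h]

/-- A nonnegative vector has at most `m` nonzero entries iff its elementary symmetric function of
degree `m + 1` vanishes. -/
theorem sum_prod_eq_zero_iff_card_support_le {ι : Type*} [Fintype ι] {x : ι → ℝ}
    (hx : ∀ i, 0 ≤ x i) (m : ℕ) :
    ∑ s ∈ powersetCard (m + 1) univ, ∏ i ∈ s, x i = 0 ↔ #{i | x i ≠ 0} ≤ m := by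
  rw [sum_eq_zero_iff_of_nonneg fun s _ ↦ prod_nonneg fun i _ ↦ hx i]
  constructor
  · intro h
    by_contra! hlt
    obtain ⟨s, hs, hcard⟩ := exists_subset_card_eq (Nat.succ_le_of_lt hlt)
    obtain ⟨i, hi, hi0⟩ := prod_eq_zero_iff.1 (h s (mem_powersetCard.2 ⟨subset_univ s, hcard⟩))
    simpa [hi0] using hs hi
  · intro h s hs
    by_contra hne
    rw [prod_eq_zero_iff] at hne
    push Not at hne
    have : #s ≤ #{i | x i ≠ 0} := card_le_card fun i hi ↦ by simpa using hne i hi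
    have := (mem_powersetCard.1 hs).2
    omega

/-- A **van Kampen–Flores theorem**: two points of the simplex with `d + 3` vertices whose
supports are disjoint and small have the same image in `ℝ^d`. -/
theorem van_kampen_flores_s10 {d : ℕ} {f : (Fin (d + 3) → ℝ) → Fin d → ℝ}
    (hf : ContinuousOn f (stdSimplex ℝ (Fin (d + 3)))) :
    ∃ x ∈ stdSimplex ℝ (Fin (d + 3)), ∃ y ∈ stdSimplex ℝ (Fin (d + 3)),
      (∀ i, x i = 0 ∨ y i = 0) ∧ #{i | x i ≠ 0} ≤ (d + 3) / 2 ∧ #{i | y i ≠ 0} ≤ (d + 3) / 2 ∧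
        f x = f y := by
  let h : (Fin (d + 3) → ℝ) → ℝ := fun x ↦
    ∑ s ∈ powersetCard ((d + 3) / 2 + 1) univ, ∏ i ∈ s, x i
  obtain ⟨x, hx, y, hy, hxy, hF⟩ : ∃ x ∈ stdSimplex ℝ (Fin (d + 3)),
      ∃ y ∈ stdSimplex ℝ (Fin (d + 3)), (∀ i, x i = 0 ∨ y i = 0) ∧
        (Fin.cons (h x) (f x) : Fin (d + 1) → ℝ) = Fin.cons (h y) (f y) :=
    topological_radon (n := d + 1)
    (F := fun x ↦ (Fin.cons (h x) (f x) : Fin (d + 1) → ℝ)) (by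
      refine continuousOn_pi.2 fun i ↦ ?_
      refine Fin.cases ?_ (fun i ↦ ?_) i
      · simp only [Fin.cons_zero, h]
        fun_prop
      · simpa using continuousOn_pi.1 hf i)
  obtain ⟨hh, hfxy⟩ := Fin.cons_inj.1 hF
  have hcard : #{i | x i ≠ 0} + #{i | y i ≠ 0} ≤ d + 3 := by
    rw [← card_union_of_disjoint]
    · simpa using card_le_univ (α := Fin (d + 3)) _
    · rw [disjoint_filter]
      exact fun i _ h1 h2 ↦ (hxy i).elim h1 h2
  have hx' := sum_prod_eq_zero_iff_card_support_le hx.1 ((d + 3) / 2)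
  have hy' := sum_prod_eq_zero_iff_card_support_le hy.1 ((d + 3) / 2)
  have hiff : #{i | x i ≠ 0} ≤ (d + 3) / 2 ↔ #{i | y i ≠ 0} ≤ (d + 3) / 2 := by
    rw [← hx', ← hy']
    exact iff_of_eq (congrArg (· = 0) hh)
  refine ⟨x, hx, y, hy, hxy, ?_, ?_, hfxy⟩ <;> omega

section

open scoped unitInterval

/-- The cube `[0, 1]^m` recentred at the origin. -/
def centeredCube {m : ℕ} (u : Fin m → I) : Fin m → ℝ := fun i ↦ 2 * (u i : ℝ) - 1

theorem continuous_centeredCube {m : ℕ} : Continuous (centeredCube (m := m)) := by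
  unfold centeredCube; fun_prop

theorem norm_centeredCube_le {m : ℕ} (u : Fin m → I) : ‖centeredCube u‖ ≤ 1 := by
  rw [pi_norm_le_iff_of_nonneg zero_le_one]
  intro i
  rw [centeredCube, Real.norm_eq_abs, abs_le]
  constructor <;> linarith [(u i).2.1, (u i).2.2]

theorem centeredCube_injective {m : ℕ} : Function.Injective (centeredCube (m := m)) := by
  intro u v h
  ext i
  have := congrFun h i
  simp only [centeredCube] at this
  linarith

theorem exists_centeredCube_eq {m : ℕ} {x : Fin m → ℝ} (hx : ‖x‖ ≤ 1) :
    ∃ u, centeredCube u = x := by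
  rw [pi_norm_le_iff_of_nonneg zero_le_one] at hx
  have h := fun i ↦ abs_le.1 (hx i)
  refine ⟨fun i ↦ ⟨(x i + 1) / 2, ?_, ?_⟩, ?_⟩
  · linarith [(h i).1]
  · linarith [(h i).2]
  · ext i; simp only [centeredCube]; ring

theorem mem_cubeBoundary_iff_norm {m : ℕ} (hm : 0 < m) (u : Fin m → I) :
    u ∈ Cube.boundary (Fin m) ↔ ‖centeredCube u‖ = 1 := by
  have : Nonempty (Fin m) := ⟨⟨0, hm⟩⟩
  constructor
  · rintro ⟨i, hi⟩
    refine le_antisymm (norm_centeredCube_le u) ?_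
    refine le_trans ?_ (norm_le_pi_norm (centeredCube u) i)
    rcases hi with hi | hi <;> norm_num [centeredCube, hi]
  · intro h
    obtain ⟨i, hi⟩ : ∃ i, 1 ≤ ‖centeredCube u i‖ := by
      by_contra! hlt
      exact ((pi_norm_lt_iff one_pos).2 hlt).ne h
    refine ⟨i, ?_⟩
    rw [centeredCube, Real.norm_eq_abs, le_abs] at hi
    rcases hi with hi | hi
    · right
      exact Subtype.ext (le_antisymm (u i).2.2 (by simp only [Set.Icc.coe_one]; linarith))
    · left
      exact Subtype.ext (le_antisymm (by simp only [Set.Icc.coe_zero]; linarith) (u i).2.1)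

/-- A map from the cube onto the `ℓ¹` unit sphere collapsing the boundary of the cube to a pole. -/
noncomputable def cubeCollapse {m : ℕ} (u : Fin m → I) : WithLp 1 (ℝ × (Fin m → ℝ)) :=
  WithLp.toLp 1 (1 - 2 * ‖centeredCube u‖,
    (2 * (1 - ‖centeredCube u‖) / max ‖centeredCube u‖ (1 - ‖centeredCube u‖)) • centeredCube u)

theorem max_self_one_sub_pos (r : ℝ) : 0 < max r (1 - r) := by
  rcases le_or_gt r 0 with h | h
  · exact lt_max_of_lt_right (by linarith)
  · exact lt_max_of_lt_left h

theorem continuous_cubeCollapse {m : ℕ} : Continuous (cubeCollapse (m := m)) := by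
  have h := continuous_centeredCube (m := m)
  have hne := fun u : Fin m → I ↦ (max_self_one_sub_pos ‖centeredCube u‖).ne'
  refine (WithLp.prod_continuous_toLp 1 ℝ (Fin m → ℝ)).comp (Continuous.prodMk (by fun_prop) ?_)
  exact (Continuous.div (by fun_prop) (by fun_prop) hne).smul h

/-- Over the circle of radius `r` the collapse map has radius `1 - |1 - 2 r|`. -/
theorem two_mul_one_sub_div_max_mul {r : ℝ} :
    2 * (1 - r) / max r (1 - r) * r = 1 - |1 - 2 * r| := by
  rw [div_mul_eq_mul_div, div_eq_iff (max_self_one_sub_pos r).ne']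
  rcases le_total r (1 - r) with h | h
  · rw [max_eq_right h, abs_of_nonneg (by linarith)]; ring
  · rw [max_eq_left h, abs_of_nonpos (by linarith)]; ring

theorem norm_cubeCollapse {m : ℕ} (u : Fin m → I) : ‖cubeCollapse u‖ = 1 := by
  have h1 := norm_centeredCube_le u
  rw [WithLp.prod_norm_eq_of_L1]
  simp only [cubeCollapse, WithLp.fst, WithLp.snd]
  rw [norm_smul, Real.norm_of_nonneg
    (div_nonneg (by linarith) (max_self_one_sub_pos ‖centeredCube u‖).le),
    two_mul_one_sub_div_max_mul, Real.norm_eq_abs]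
  ring

theorem cubeCollapse_of_mem_boundary {m : ℕ} (hm : 0 < m) {u : Fin m → I}
    (hu : u ∈ Cube.boundary (Fin m)) : cubeCollapse u = WithLp.toLp 1 (-1, 0) := by
  rw [mem_cubeBoundary_iff_norm hm] at hu
  simp only [cubeCollapse, hu]
  norm_num

theorem eq_or_mem_boundary_of_cubeCollapse_eq {m : ℕ} (hm : 0 < m) {u v : Fin m → I}
    (h : cubeCollapse u = cubeCollapse v) :
    u = v ∨ u ∈ Cube.boundary (Fin m) ∧ v ∈ Cube.boundary (Fin m) := by
  have h1 := congrArg WithLp.fst h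
  have h2 := congrArg WithLp.snd h
  simp only [cubeCollapse, WithLp.fst, WithLp.snd] at h1 h2
  have hr : ‖centeredCube u‖ = ‖centeredCube v‖ := by linarith
  rw [mem_cubeBoundary_iff_norm hm, mem_cubeBoundary_iff_norm hm, ← hr]
  by_cases hu : ‖centeredCube u‖ = 1
  · exact Or.inr ⟨hu, hu⟩
  · left
    rw [← hr] at h2
    have hlt := lt_of_le_of_ne (norm_centeredCube_le u) hu
    refine centeredCube_injective (smul_right_injective _ ?_ h2)
    exact (div_pos (by linarith) (max_self_one_sub_pos _)).ne'

theorem exists_cubeCollapse_eq {m : ℕ} (hm : 0 < m) {e : WithLp 1 (ℝ × (Fin m → ℝ))}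
    (he : ‖e‖ = 1) : ∃ u, cubeCollapse u = e := by
  rw [WithLp.prod_norm_eq_of_L1, Real.norm_eq_abs] at he
  have hfst : |e.fst| ≤ 1 := by linarith [norm_nonneg e.snd]
  obtain ⟨hl, hr⟩ := abs_le.1 hfst
  rcases hl.eq_or_lt with h | h
  · have hs : e.snd = 0 := by
      rw [← h] at he
      simpa using he
    refine ⟨fun _ ↦ 0, ?_⟩
    rw [cubeCollapse_of_mem_boundary hm ⟨⟨0, hm⟩, Or.inl rfl⟩, h, ← hs]
    rfl
  · set r := (1 - e.fst) / 2 with hrdef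
    set c := 2 * (1 - r) / max r (1 - r) with hcdef
    have hc : 0 < c := div_pos (by linarith) (max_self_one_sub_pos r)
    have hcr : c * r = ‖e.snd‖ := by
      rw [hcdef, two_mul_one_sub_div_max_mul, hrdef, show 1 - 2 * ((1 - e.fst) / 2) = e.fst by ring]
      linarith
    have hnorm : ‖c⁻¹ • e.snd‖ = r := by
      rw [norm_smul, norm_inv, Real.norm_of_nonneg hc.le, ← hcr]
      field_simp
    obtain ⟨u, hu⟩ := exists_centeredCube_eq (x := c⁻¹ • e.snd) (by rw [hnorm]; linarith)
    refine ⟨u, ?_⟩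
    rw [cubeCollapse, hu, hnorm, ← hcdef, smul_inv_smul₀ hc.ne', hrdef,
      show 1 - 2 * ((1 - e.fst) / 2) = e.fst by ring]
    rfl

/-- In a space with trivial `m`-th homotopy, a map on the `ℓ¹` unit `m`-sphere extends to the
ball. -/
theorem exists_extension_closedBall_of_pos {Y : Type*} [TopologicalSpace Y] {m : ℕ} (hm : 0 < m)
    (hY : ∀ y : Y, Subsingleton (HomotopyGroup (Fin m) Y y))
    {φ : WithLp 1 (ℝ × (Fin m → ℝ)) → Y} (hφ : ContinuousOn φ (Metric.sphere 0 1)) :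
    ∃ Φ : WithLp 1 (ℝ × (Fin m → ℝ)) → Y, ContinuousOn Φ (Metric.closedBall 0 1) ∧
      Set.EqOn Φ φ (Metric.sphere 0 1) := by
  classical
  set y : Y := φ (WithLp.toLp 1 (-1, 0)) with hy
  have hmem : ∀ u : Fin m → I, cubeCollapse u ∈ Metric.sphere (0 : WithLp 1 (ℝ × (Fin m → ℝ))) 1 :=
    fun u ↦ by simpa using norm_cubeCollapse u
  let γ : GenLoop (Fin m) Y y :=
    ⟨⟨fun u ↦ φ (cubeCollapse u), hφ.comp_continuous continuous_cubeCollapse hmem⟩,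
      fun u hu ↦ by simp [cubeCollapse_of_mem_boundary hm hu, hy]⟩
  have hγ : GenLoop.Homotopic γ GenLoop.const :=
    Quotient.exact (s := GenLoop.Homotopic.setoid (Fin m) y) ((hY y).elim _ _)
  obtain ⟨H⟩ := hγ
  have hball : ∀ p : I × (Fin m → I),
      ((1 - p.1 : ℝ) • cubeCollapse p.2) ∈
        Metric.closedBall (0 : WithLp 1 (ℝ × (Fin m → ℝ))) 1 := by
    intro p
    rw [mem_closedBall_zero_iff, norm_smul, norm_cubeCollapse, mul_one,
      Real.norm_of_nonneg (by linarith [p.1.2.2])]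
    linarith [p.1.2.1]
  let Q : C(I × (Fin m → I), Metric.closedBall (0 : WithLp 1 (ℝ × (Fin m → ℝ))) 1) :=
    ⟨fun p ↦ ⟨(1 - p.1 : ℝ) • cubeCollapse p.2, hball p⟩, by
      have := continuous_cubeCollapse (m := m)
      fun_prop⟩
  have hQsurj : Function.Surjective Q := by
    rintro ⟨e, he⟩
    rw [mem_closedBall_zero_iff] at he
    by_cases h0 : e = 0
    · exact ⟨(1, fun _ ↦ 0), by simp [Q, h0]⟩
    · have hn : ‖e‖ ≠ 0 := norm_ne_zero_iff.2 h0
      obtain ⟨u, hu⟩ := exists_cubeCollapse_eq hm (e := ‖e‖⁻¹ • e) (by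
        rw [norm_smul, norm_inv, norm_norm, inv_mul_cancel₀ hn])
      refine ⟨(⟨1 - ‖e‖, by linarith, by linarith [norm_nonneg e]⟩, u), ?_⟩
      ext1
      simp only [Q, ContinuousMap.coe_mk, hu]
      rw [show (1 - (1 - ‖e‖)) = ‖e‖ by ring, smul_inv_smul₀ hn]
  have hQ : IsQuotientMap Q := .of_surjective_continuous hQsurj Q.continuous
  have hfac : Function.FactorsThrough H.toContinuousMap Q := by
    rintro ⟨t, u⟩ ⟨t', u'⟩ h
    have h' : (1 - t : ℝ) • cubeCollapse u = (1 - t' : ℝ) • cubeCollapse u' :=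
      congrArg Subtype.val h
    have htt : t = t' := by
      have := congrArg norm h'
      rw [norm_smul, norm_smul, norm_cubeCollapse, norm_cubeCollapse,
        Real.norm_of_nonneg (by linarith [t.2.2]),
        Real.norm_of_nonneg (by linarith [t'.2.2])] at this
      ext; linarith
    subst htt
    by_cases ht : t = 1
    · subst ht
      exact (H.apply_one u).trans (H.apply_one u').symm
    · have ht' : (1 - t : ℝ) ≠ 0 := by
        intro h0
        exact ht (Subtype.ext (by simp only [Set.Icc.coe_one]; linarith))
      rcases eq_or_mem_boundary_of_cubeCollapse_eq hm (smul_right_injective _ ht' h') with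
        rfl | ⟨hu, hu'⟩
      · rfl
      · exact (H.eq_snd t hu).trans (H.eq_snd t hu').symm
  let Φ := hQ.lift H.toContinuousMap hfac
  have hΦ : ∀ p, Φ (Q p) = H p := fun p ↦
    DFunLike.congr_fun (hQ.lift_comp H.toContinuousMap hfac) p
  refine ⟨fun e ↦ if h : e ∈ Metric.closedBall 0 1 then Φ ⟨e, h⟩ else y, ?_, ?_⟩
  · rw [continuousOn_iff_continuous_domRestrict]
    refine Φ.continuous.congr fun e ↦ ?_
    simp only [Set.domRestrict_apply, e.2, dite_true]
  · intro e he
    obtain ⟨u, rfl⟩ := exists_cubeCollapse_eq hm (mem_sphere_zero_iff_norm.1 he)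
    simp only [Metric.sphere_subset_closedBall he, dite_true]
    have := hΦ (0, u)
    have hQu : Q (0, u) = ⟨cubeCollapse u, Metric.sphere_subset_closedBall he⟩ := by
      ext1
      simp [Q]
    rw [H.apply_zero, hQu] at this
    exact this

/-- In a path-connected space, a map on the `0`-sphere extends to the interval. -/
theorem exists_extension_closedBall_zero {Y : Type*} [TopologicalSpace Y] [PathConnectedSpace Y]
    (φ : WithLp 1 (ℝ × (Fin 0 → ℝ)) → Y) :
    ∃ Φ : WithLp 1 (ℝ × (Fin 0 → ℝ)) → Y, ContinuousOn Φ (Metric.closedBall 0 1) ∧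
      Set.EqOn Φ φ (Metric.sphere 0 1) := by
  let γ := PathConnectedSpace.somePath (φ (WithLp.toLp 1 (-1, 0))) (φ (WithLp.toLp 1 (1, 0)))
  refine ⟨fun e ↦ γ.extend ((1 + e.fst) / 2), Continuous.continuousOn (by fun_prop), ?_⟩
  intro e he
  have hsnd : e.snd = 0 := Subsingleton.elim _ _
  have hn := mem_sphere_zero_iff_norm.1 he
  rw [WithLp.prod_norm_eq_of_L1, hsnd, norm_zero, add_zero, Real.norm_eq_abs,
    abs_eq zero_le_one] at hn
  have hee : e = WithLp.toLp 1 (e.fst, 0) := by rw [← hsnd]; rfl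
  rcases hn with h | h
  · rw [hee, h]; norm_num [γ]
  · rw [hee, h]; norm_num [γ]

/-- A map from the frontier of a convex body of dimension `m + 1` to a space which is
`k`-connected for some `k ≥ m` extends to the body. -/
theorem IsKConnectedSpace.exists_extension_convex {Y : Type} [TopologicalSpace Y] {k m : ℕ}
    (hY : IsKConnectedSpace k Y) (hmk : m ≤ k) {V : Type*} [NormedAddCommGroup V]
    [NormedSpace ℝ V] [FiniteDimensional ℝ V] (hV : Module.finrank ℝ V = m + 1) {K : Set V}
    (hK : Convex ℝ K) (hKc : IsCompact K) (hKi : (interior K).Nonempty) {φ : V → Y}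
    (hφ : ContinuousOn φ (frontier K)) :
    ∃ Φ : V → Y, ContinuousOn Φ K ∧ Set.EqOn Φ φ (frontier K) := by
  have : PathConnectedSpace Y := hY.2.1
  have hfin : Module.finrank ℝ V = Module.finrank ℝ (WithLp 1 (ℝ × (Fin m → ℝ))) := by
    rw [hV, (WithLp.linearEquiv 1 ℝ (ℝ × (Fin m → ℝ))).finrank_eq]
    simp [add_comm]
  let L : V ≃L[ℝ] WithLp 1 (ℝ × (Fin m → ℝ)) := ContinuousLinearEquiv.ofFinrankEq hfin
  have hLint : L '' interior K = interior (L '' K) := L.toHomeomorph.image_interior K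
  have hfro : L '' frontier K = frontier (L '' K) := L.toHomeomorph.image_frontier K
  obtain ⟨h, -, hcl, hfr⟩ :=
    exists_homeomorph_image_interior_closure_frontier_eq_unitBall (s := L '' K)
      (hK.linear_image L.toLinearEquiv.toLinearMap) (hLint ▸ hKi.image L)
      (hKc.image L.continuous).isBounded
  rw [(hKc.image L.continuous).isClosed.closure_eq] at hcl
  rw [← hfro] at hfr
  let G : V ≃ₜ WithLp 1 (ℝ × (Fin m → ℝ)) := L.toHomeomorph.trans h
  have hGK : G '' K = Metric.closedBall 0 1 := by rw [← hcl, Set.image_image]; rfl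
  have hGf : G '' frontier K = Metric.sphere 0 1 := by rw [← hfr, Set.image_image]; rfl
  have hφ' : ContinuousOn (φ ∘ G.symm) (Metric.sphere 0 1) := by
    refine hφ.comp G.symm.continuous.continuousOn ?_
    rw [← hGf]
    rintro _ ⟨x, hx, rfl⟩
    simpa using hx
  obtain ⟨Φ, hΦ, hΦφ⟩ : ∃ Φ : WithLp 1 (ℝ × (Fin m → ℝ)) → Y,
      ContinuousOn Φ (Metric.closedBall 0 1) ∧
        Set.EqOn Φ (φ ∘ G.symm) (Metric.sphere 0 1) := by
    rcases Nat.eq_zero_or_pos m with rfl | hm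
    · exact exists_extension_closedBall_zero _
    · exact exists_extension_closedBall_of_pos hm (hY.2.2 m hm hmk) hφ'
  refine ⟨Φ ∘ G, hΦ.comp G.continuous.continuousOn ?_, ?_⟩
  · rw [← hGK]; exact Set.mapsTo_image _ _
  · intro x hx
    have := hΦφ (hGf ▸ Set.mem_image_of_mem G hx)
    simpa using this

end

theorem continuous_sum_apply {n : ℕ} : Continuous fun y : Fin n → ℝ ↦ ∑ i, y i := by fun_prop

/-- The simplex spanned by the origin and the standard basis vectors. -/
def cornerSimplex (n : ℕ) : Set (Fin n → ℝ) := {y | (∀ i, 0 ≤ y i) ∧ ∑ i, y i ≤ 1}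

theorem convex_cornerSimplex (n : ℕ) : Convex ℝ (cornerSimplex n) := by
  rintro x ⟨hx, hx'⟩ y ⟨hy, hy'⟩ a b ha hb hab
  refine ⟨fun i ↦ add_nonneg (mul_nonneg ha (hx i)) (mul_nonneg hb (hy i)), ?_⟩
  simp only [Pi.add_apply, Pi.smul_apply, smul_eq_mul, sum_add_distrib, ← mul_sum]
  nlinarith

theorem isClosed_cornerSimplex (n : ℕ) : IsClosed (cornerSimplex n) := by
  refine IsClosed.inter (s₁ := {y : Fin n → ℝ | ∀ i, 0 ≤ y i}) ?_
    (isClosed_le continuous_sum_apply continuous_const)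
  rw [Set.ofPred_forall]
  exact isClosed_iInter fun i ↦ isClosed_le continuous_const (continuous_apply i)

theorem isCompact_cornerSimplex (n : ℕ) : IsCompact (cornerSimplex n) := by
  refine (isCompact_Icc (a := (0 : Fin n → ℝ)) (b := 1)).of_isClosed_subset
    (isClosed_cornerSimplex n) fun y hy ↦ ⟨hy.1, fun i ↦ ?_⟩
  exact (single_le_sum (fun j _ ↦ hy.1 j) (mem_univ i)).trans hy.2

theorem interior_cornerSimplex (n : ℕ) :
    interior (cornerSimplex (n + 1)) = {y | (∀ i, 0 < y i) ∧ ∑ i, y i < 1} := by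
  refine subset_antisymm (fun y hy ↦ ?_) (interior_maximal ?_ ?_)
  · constructor
    · intro i
      have h : y ∈ interior ((fun z : Fin (n + 1) → ℝ ↦ z i) ⁻¹' Set.Ici 0) :=
        interior_mono (fun z hz ↦ hz.1 i) hy
      rw [← (isOpenMap_eval i).preimage_interior_eq_interior_preimage (continuous_apply i),
        interior_Ici] at h
      exact h
    · let S : (Fin (n + 1) → ℝ) →ₗ[ℝ] ℝ := ∑ i, LinearMap.proj i
      have hS : ∀ z, S z = ∑ i, z i := fun z ↦ by simp [S]
      have hsurj : Function.Surjective S := fun r ↦ ⟨Pi.single 0 r, by simp [hS]⟩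
      have h : y ∈ interior (S ⁻¹' Set.Iic 1) :=
        interior_mono (fun z hz ↦ (hS z).trans_le hz.2) hy
      rw [← (S.isOpenMap_of_finiteDimensional hsurj).preimage_interior_eq_interior_preimage
        S.continuous_of_finiteDimensional, interior_Iic] at h
      exact (hS y).symm.trans_lt h
  · exact fun y hy ↦ ⟨fun i ↦ (hy.1 i).le, hy.2.le⟩
  · refine IsOpen.inter (s := {y : Fin (n + 1) → ℝ | ∀ i, 0 < y i}) ?_
      (isOpen_lt continuous_sum_apply continuous_const)
    rw [Set.ofPred_forall]
    exact isOpen_iInter_of_finite fun i ↦ isOpen_lt continuous_const (continuous_apply i)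

theorem interior_cornerSimplex_nonempty (n : ℕ) : (interior (cornerSimplex (n + 1))).Nonempty := by
  rw [interior_cornerSimplex]
  have h : (0 : ℝ) < n + 2 := by positivity
  refine ⟨fun _ ↦ 1 / (n + 2), fun _ ↦ by positivity, ?_⟩
  rw [sum_const, card_univ, Fintype.card_fin, nsmul_eq_mul, mul_one_div, div_lt_one h]
  push_cast
  linarith

theorem mem_frontier_cornerSimplex {n : ℕ} {y : Fin (n + 1) → ℝ} :
    y ∈ frontier (cornerSimplex (n + 1)) ↔
      y ∈ cornerSimplex (n + 1) ∧ (∑ i, y i = 1 ∨ ∃ i, y i = 0) := by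
  rw [(isClosed_cornerSimplex _).frontier_eq, interior_cornerSimplex, Set.mem_sdiff]
  refine and_congr_right fun hy ↦ ?_
  rw [Set.mem_ofPred_eq, not_and_or, or_comm, not_lt, not_forall]
  refine or_congr ⟨fun h ↦ le_antisymm hy.2 h, fun h ↦ h.ge⟩ (exists_congr fun i ↦ ?_)
  exact ⟨fun h ↦ le_antisymm (not_lt.1 h) (hy.1 i), fun h ↦ by simp [h]⟩

/-- A map from the relative boundary of a face of the standard simplex to a sufficiently connected
subset extends to the face. -/
theorem IsKConnectedSpace.exists_extension_face {N k m : ℕ} {X : Type} [TopologicalSpace X]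
    {A : Set X} (hA : IsKConnectedSpace k A) (hmk : m ≤ k) {σ : Finset (Fin N)}
    (hσ : #σ = m + 2) {f : (Fin N → ℝ) → X}
    (hf : ContinuousOn f {x ∈ stdSimplex ℝ (Fin N) | (∀ i ∉ σ, x i = 0) ∧ ∃ i ∈ σ, x i = 0})
    (hfA : ∀ x ∈ stdSimplex ℝ (Fin N), (∀ i ∉ σ, x i = 0) → (∃ i ∈ σ, x i = 0) → f x ∈ A) :
    ∃ Φ : (Fin N → ℝ) → X, ContinuousOn Φ {x ∈ stdSimplex ℝ (Fin N) | ∀ i ∉ σ, x i = 0} ∧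
      (∀ x, Φ x ∈ A) ∧
      ∀ x ∈ stdSimplex ℝ (Fin N), (∀ i ∉ σ, x i = 0) → (∃ i ∈ σ, x i = 0) → Φ x = f x := by
  classical
  let s : Fin (m + 2) ↪ Fin N := (σ.orderEmbOfFin hσ).toEmbedding
  have hrange : ∀ i, i ∈ σ ↔ ∃ j, s j = i := fun i ↦ by
    rw [← mem_coe, ← range_orderEmbOfFin σ hσ]; rfl
  let inc : (Fin (m + 1) → ℝ) → Fin N → ℝ := fun y ↦
    Function.extend s (Fin.cons (1 - ∑ i, y i) y : Fin (m + 2) → ℝ) 0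
  have inc_zero : ∀ y, inc y (s 0) = 1 - ∑ i, y i := fun y ↦ s.injective.extend_apply _ _ 0
  have inc_succ : ∀ y j, inc y (s (Fin.succ j)) = y j := fun y j ↦
    s.injective.extend_apply _ _ j.succ
  have inc_of_notMem : ∀ y, ∀ i ∉ σ, inc y i = 0 := fun y i hi ↦
    Function.extend_apply' _ _ _ (by rwa [← hrange])
  have inc_cont : Continuous inc := by
    refine continuous_pi fun i ↦ ?_
    by_cases hi : i ∈ σ
    · obtain ⟨j, rfl⟩ := (hrange i).1 hi
      refine Fin.cases ?_ (fun j ↦ ?_) j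
      · simp only [inc_zero]; fun_prop
      · simp only [inc_succ]; fun_prop
    · simp only [inc_of_notMem _ i hi]; fun_prop
  let proj : (Fin N → ℝ) → Fin (m + 1) → ℝ := fun x j ↦ x (s j.succ)
  have proj_cont : Continuous proj := by fun_prop
  have sum_face : ∀ x : Fin N → ℝ, (∀ i ∉ σ, x i = 0) →
      x (s 0) + ∑ i, proj x i = ∑ i, x i := fun x hx ↦ by
    rw [← Fintype.sum_of_injective s s.injective (fun j ↦ x (s j)) x
      (fun i hi ↦ hx i (by rwa [hrange])) (fun _ ↦ rfl),
      Fin.sum_univ_succ fun j ↦ x (s j)]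
  have inc_proj : ∀ x ∈ stdSimplex ℝ (Fin N), (∀ i ∉ σ, x i = 0) → inc (proj x) = x := by
    intro x hx hxσ
    ext i
    by_cases hi : i ∈ σ
    · obtain ⟨j, rfl⟩ := (hrange i).1 hi
      refine Fin.cases ?_ (fun j ↦ ?_) j
      · rw [inc_zero]; linarith [sum_face x hxσ, hx.2]
      · exact inc_succ _ j
    · rw [inc_of_notMem _ i hi, hxσ i hi]
  have inc_mem : ∀ y ∈ cornerSimplex (m + 1), inc y ∈ stdSimplex ℝ (Fin N) := by
    refine fun y hy ↦ ⟨fun i ↦ ?_, ?_⟩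
    · by_cases hi : i ∈ σ
      · obtain ⟨j, rfl⟩ := (hrange i).1 hi
        refine Fin.cases ?_ (fun j ↦ ?_) j
        · rw [inc_zero]; linarith [hy.2]
        · rw [inc_succ]; exact hy.1 j
      · rw [inc_of_notMem _ i hi]
    · rw [← sum_face _ (inc_of_notMem y), inc_zero]
      simp only [proj, inc_succ]
      ring
  have inc_bdry : ∀ y ∈ frontier (cornerSimplex (m + 1)), ∃ i ∈ σ, inc y i = 0 := by
    intro y hy
    rcases (mem_frontier_cornerSimplex.1 hy).2 with h | ⟨j, hj⟩
    · exact ⟨s 0, (hrange _).2 ⟨0, rfl⟩, by rw [inc_zero, h, sub_self]⟩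
    · exact ⟨s j.succ, (hrange _).2 ⟨_, rfl⟩, by rw [inc_succ, hj]⟩
  have proj_mem : ∀ x ∈ stdSimplex ℝ (Fin N), (∀ i ∉ σ, x i = 0) →
      proj x ∈ cornerSimplex (m + 1) := fun x hx hxσ ↦
    ⟨fun i ↦ hx.1 _, by linarith [sum_face x hxσ, hx.2, hx.1 (s 0)]⟩
  have proj_bdry : ∀ x ∈ stdSimplex ℝ (Fin N), (∀ i ∉ σ, x i = 0) → (∃ i ∈ σ, x i = 0) →
      proj x ∈ frontier (cornerSimplex (m + 1)) := by
    rintro x hx hxσ ⟨i, hi, hxi⟩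
    refine mem_frontier_cornerSimplex.2 ⟨proj_mem x hx hxσ, ?_⟩
    obtain ⟨j, rfl⟩ := (hrange i).1 hi
    revert hxi
    refine Fin.cases (fun h ↦ ?_) (fun j h ↦ ?_) j
    · left; linarith [sum_face x hxσ, hx.2]
    · exact Or.inr ⟨j, h⟩
  obtain ⟨a⟩ := hA.1
  have inc_A : ∀ y ∈ frontier (cornerSimplex (m + 1)), f (inc y) ∈ A := fun y hy ↦
    hfA _ (inc_mem y (mem_frontier_cornerSimplex.1 hy).1) (inc_of_notMem y) (inc_bdry y hy)
  let φ : (Fin (m + 1) → ℝ) → A := fun y ↦ if h : f (inc y) ∈ A then ⟨f (inc y), h⟩ else a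
  have hφ : ∀ y ∈ frontier (cornerSimplex (m + 1)), (φ y : X) = f (inc y) := fun y hy ↦ by
    simp only [φ, dif_pos (inc_A y hy)]
  have hφc : ContinuousOn φ (frontier (cornerSimplex (m + 1))) := by
    rw [IsInducing.subtypeVal.continuousOn_iff]
    refine (hf.comp inc_cont.continuousOn fun y hy ↦ ?_).congr hφ
    exact ⟨inc_mem y (mem_frontier_cornerSimplex.1 hy).1, inc_of_notMem y, inc_bdry y hy⟩
  obtain ⟨Φ, hΦ, hΦφ⟩ := hA.exists_extension_convex hmk (Module.finrank_fin_fun ℝ)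
    (convex_cornerSimplex _) (isCompact_cornerSimplex _) (interior_cornerSimplex_nonempty _) hφc
  refine ⟨fun x ↦ Φ (proj x), ?_, fun x ↦ (Φ (proj x)).2, fun x hx hxσ hxb ↦ ?_⟩
  · exact (continuous_subtype_val.comp_continuousOn hΦ).comp proj_cont.continuousOn
      fun x hx ↦ proj_mem x hx.1 hx.2
  · have := proj_bdry x hx hxσ hxb
    simp only [hΦφ this, hφ _ this, inc_proj x hx hxσ]

theorem isClosed_stdSimplex_face {N : ℕ} (σ : Finset (Fin N)) :
    IsClosed {x ∈ stdSimplex ℝ (Fin N) | ∀ i ∉ σ, x i = 0} := by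
  refine IsClosed.inter (s₂ := {x : Fin N → ℝ | ∀ i ∉ σ, x i = 0})
    (isClosed_stdSimplex ℝ (Fin N)) ?_
  simp only [Set.ofPred_forall]
  exact isClosed_iInter fun i ↦ isClosed_iInter fun _ ↦
    isClosed_eq (continuous_apply i) continuous_const

/-- If `Y` is a monotone assignment of sufficiently connected sets to small vertex sets of a
simplex, then there is a map on the skeleton of the simplex sending each point into the set
assigned to its support. -/
theorem exists_continuousOn_skeleton {N k d : ℕ} {Y : Finset (Fin N) → Set (Fin d → ℝ)}
    (hmono : Monotone Y) (hkN : k + 2 ≤ N)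
    (hY : ∀ σ : Finset (Fin N), σ.Nonempty → #σ ≤ k + 2 → IsKConnectedSpace k (Y σ))
    (m : ℕ) (hm : m ≤ k + 1) :
    ∃ f : (Fin N → ℝ) → Fin d → ℝ,
      ContinuousOn f {x ∈ stdSimplex ℝ (Fin N) | #{i | x i ≠ 0} ≤ m + 1} ∧
      ∀ x ∈ stdSimplex ℝ (Fin N), #{i | x i ≠ 0} ≤ m + 1 → f x ∈ Y {i | x i ≠ 0} := by
  classical
  induction m with
  | zero =>
    have hp : ∀ i, (Y {i}).Nonempty := fun i ↦
      Set.nonempty_coe_sort.1 (hY {i} (singleton_nonempty i) (by simp)).1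
    choose p hp using hp
    refine ⟨fun x ↦ ∑ i, x i • p i, Continuous.continuousOn (by fun_prop), fun x hx hcard ↦ ?_⟩
    have hne : ({i | x i ≠ 0} : Finset (Fin N)).Nonempty := by
      by_contra h
      have h0 : ∀ i, x i = 0 := by simpa [filter_eq_empty_iff] using h
      simpa [h0] using hx.2
    obtain ⟨j, hj⟩ := card_eq_one.1 (le_antisymm hcard (card_pos.2 hne))
    have hz : ∀ i, i ≠ j → x i = 0 := fun i hi ↦ by
      by_contra h
      exact hi (mem_singleton.1 (hj ▸ mem_filter.2 ⟨mem_univ i, h⟩))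
    have h1 : x j = 1 := by
      rw [← hx.2, sum_eq_single j (fun i _ hi ↦ hz i hi) (by simp)]
    have hsum : ∑ i, x i • p i = p j := by
      rw [sum_eq_single j (fun i _ hi ↦ by rw [hz i hi, zero_smul]) (by simp), h1, one_smul]
    rw [hj]
    exact hsum.symm.subst (motive := (· ∈ Y {j})) (hp j)
  | succ m ih =>
    obtain ⟨f, hf, hfY⟩ := ih (by omega)
    have hsupp : ∀ {x : Fin N → ℝ} {σ : Finset (Fin N)}, (∀ i ∉ σ, x i = 0) →
        ({i | x i ≠ 0} : Finset (Fin N)) ⊆ σ := fun {x σ} h i hi ↦ by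
      by_contra hiσ
      exact (mem_filter.1 hi).2 (h i hiσ)
    have hbdry : ∀ {x : Fin N → ℝ} {σ : Finset (Fin N)}, #σ = m + 2 → (∀ i ∉ σ, x i = 0) →
        ((∃ i ∈ σ, x i = 0) ↔ #{i | x i ≠ 0} ≤ m + 1) := by
      intro x σ hσ h
      constructor
      · rintro ⟨i, hi, hxi⟩
        have hne : i ∉ ({i | x i ≠ 0} : Finset (Fin N)) := fun hi' ↦ (mem_filter.1 hi').2 hxi
        have := card_lt_card (ssubset_of_subset_of_ne (hsupp h) fun he ↦ hne (he.symm ▸ hi))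
        omega
      · intro hc
        by_contra! hne
        have := card_le_card (show σ ⊆ ({i | x i ≠ 0} : Finset (Fin N)) from
          fun i hi ↦ mem_filter.2 ⟨mem_univ i, hne i hi⟩)
        omega
    have key : ∀ σ : Finset (Fin N), ∃ Φ : (Fin N → ℝ) → Fin d → ℝ, #σ = m + 2 →
        ContinuousOn Φ {x ∈ stdSimplex ℝ (Fin N) | ∀ i ∉ σ, x i = 0} ∧ (∀ x, Φ x ∈ Y σ) ∧
        ∀ x ∈ stdSimplex ℝ (Fin N), (∀ i ∉ σ, x i = 0) → #{i | x i ≠ 0} ≤ m + 1 → Φ x = f x := by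
      intro σ
      by_cases hσ : #σ = m + 2
      · obtain ⟨Φ, h1, h2, h3⟩ := (hY σ (card_pos.1 (by omega))
          (by omega)).exists_extension_face (m := m) (by omega) hσ (f := f)
          (hf.mono fun x hx ↦ ⟨hx.1, (hbdry hσ hx.2.1).1 hx.2.2⟩)
          (fun x hx hxσ hxb ↦ hmono (hsupp hxσ) (hfY x hx ((hbdry hσ hxσ).1 hxb)))
        exact ⟨Φ, fun _ ↦ ⟨h1, h2, fun x hx hxσ hc ↦ h3 x hx hxσ ((hbdry hσ hxσ).2 hc)⟩⟩
      · exact ⟨f, fun h ↦ absurd h hσ⟩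
    choose Φ hΦ using key
    let g : (Fin N → ℝ) → Fin d → ℝ := fun x ↦
      if #{i | x i ≠ 0} ≤ m + 1 then f x else Φ {i | x i ≠ 0} x
    have hg : ∀ σ : Finset (Fin N), #σ = m + 2 →
        Set.EqOn g (Φ σ) {x ∈ stdSimplex ℝ (Fin N) | ∀ i ∉ σ, x i = 0} := by
      rintro σ hσ x ⟨hx, hxσ⟩
      by_cases hc : #{i | x i ≠ 0} ≤ m + 1
      · simp only [g, if_pos hc, (hΦ σ hσ).2.2 x hx hxσ hc]
      · have : ({i | x i ≠ 0} : Finset (Fin N)) = σ :=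
          eq_of_subset_of_card_le (hsupp hxσ) (by omega)
        simp only [g, if_neg hc, this]
    refine ⟨g, ?_, fun x hx hc ↦ ?_⟩
    · have hcover : {x ∈ stdSimplex ℝ (Fin N) | #{i | x i ≠ 0} ≤ m + 1 + 1} ⊆
          ⋃ σ : {σ : Finset (Fin N) // #σ = m + 2},
            {x ∈ stdSimplex ℝ (Fin N) | ∀ i ∉ σ.1, x i = 0} := by
        rintro x ⟨hx, hc⟩
        obtain ⟨σ, hσ, hcard⟩ := exists_superset_card_eq (n := m + 2) hc
          (by rw [Fintype.card_fin]; omega)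
        refine Set.mem_iUnion.2 ⟨⟨σ, hcard⟩, hx, fun i hi ↦ ?_⟩
        by_contra h
        exact hi (hσ (mem_filter.2 ⟨mem_univ i, h⟩))
      refine ContinuousOn.mono ?_ hcover
      refine (locallyFinite_of_finite _).continuousOn_iUnion
        (fun σ ↦ isClosed_stdSimplex_face σ.1) fun σ ↦ ?_
      exact (hΦ σ.1 σ.2).1.congr (hg σ.1 σ.2)
    · by_cases hc' : #{i | x i ≠ 0} ≤ m + 1
      · simp only [g, if_pos hc']
        exact hfY x hx hc'
      · simp only [g, if_neg hc']
        exact (hΦ _ (by omega)).2.1 x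

theorem isClosed_stdSimplex_skeleton (N m : ℕ) :
    IsClosed {x ∈ stdSimplex ℝ (Fin N) | #{i | x i ≠ 0} ≤ m} := by
  have : {x ∈ stdSimplex ℝ (Fin N) | #{i | x i ≠ 0} ≤ m} = stdSimplex ℝ (Fin N) ∩
      {x | ∑ s ∈ powersetCard (m + 1) univ, ∏ i ∈ s, x i = 0} := by
    ext x
    exact and_congr_right fun hx ↦ (sum_prod_eq_zero_iff_card_support_le hx.1 m).symm
  rw [this]
  exact (isClosed_stdSimplex ℝ (Fin N)).inter (isClosed_eq (by fun_prop) continuous_const)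

/-- The Helly-type consequence of the van Kampen–Flores theorem, for a monotone family of
sufficiently connected sets indexed by vertex sets of a simplex. -/
theorem exists_disjoint_inter_nonempty {d : ℕ} (hd : 1 ≤ d)
    {Y : Finset (Fin (d + 3)) → Set (Fin d → ℝ)} (hmono : Monotone Y)
    (hY : ∀ σ : Finset (Fin (d + 3)), σ.Nonempty → #σ ≤ (d + 3) / 2 →
      IsKConnectedSpace ((d + 1) / 2 - 1) (Y σ)) :
    ∃ σ τ, Disjoint σ τ ∧ (Y σ ∩ Y τ).Nonempty := by
  obtain ⟨f, hf, hfY⟩ := exists_continuousOn_skeleton hmono (k := (d + 1) / 2 - 1) (by omega)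
    (fun σ h h' ↦ hY σ h (by omega)) ((d + 1) / 2 - 1 + 1) le_rfl
  rw [show (d + 1) / 2 - 1 + 1 + 1 = (d + 3) / 2 by omega] at hf hfY
  obtain ⟨F, hF⟩ := ContinuousMap.exists_restrict_eq (isClosed_stdSimplex_skeleton _ _)
    ⟨_, continuousOn_iff_continuous_domRestrict.1 hf⟩
  have hFf : ∀ x ∈ stdSimplex ℝ (Fin (d + 3)), #{i | x i ≠ 0} ≤ (d + 3) / 2 → F x = f x :=
    fun x hx hc ↦ DFunLike.congr_fun hF ⟨x, hx, hc⟩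
  obtain ⟨x, hx, y, hy, hxy, hxc, hyc, h⟩ := van_kampen_flores_s10 F.continuous.continuousOn
  rw [hFf x hx hxc, hFf y hy hyc] at h
  refine ⟨_, _, ?_, f x, hfY x hx hxc, h ▸ hfY y hy hyc⟩
  rw [disjoint_left]
  intro i hi hj
  exact (hxy i).elim (mem_filter.1 hi).2 (mem_filter.1 hj).2

end

/-- **Helly-type theorem from the van Kampen–Flores theorem.**
Let `d ≥ 1` and let `ℱ` be a finite family of subsets of `ℝ^d` such that the intersection
of every nonempty subfamily is empty or `(⌈d/2⌉ − 1)`-connected. Then `⋂ℱ = ∅` iff some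
subfamily with at most `d + 2` members has empty intersection. -/
theorem helly_from_van_kampen_flores
    (d : ℕ) (hd : 1 ≤ d)
    (ℱ : Finset (Set (Fin d → ℝ)))
    (hconn : ∀ ℱ' : Finset (Set (Fin d → ℝ)), ℱ' ⊆ ℱ → ℱ'.Nonempty →
      ⋂₀ (ℱ' : Set (Set (Fin d → ℝ))) = ∅ ∨
        IsKConnectedSpace ((d + 1) / 2 - 1) ↥(⋂₀ (ℱ' : Set (Set (Fin d → ℝ))))) :
    ⋂₀ (ℱ : Set (Set (Fin d → ℝ))) = ∅ ↔
      ∃ 𝒢 ⊆ ℱ, 𝒢.card ≤ d + 2 ∧ ⋂₀ (𝒢 : Set (Set (Fin d → ℝ))) = ∅ := by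
  classical
  constructor
  · intro h
    obtain ⟨𝒢, h𝒢, hmin⟩ := Finset.exists_min_image
      (ℱ.powerset.filter fun 𝒢 : Finset (Set (Fin d → ℝ)) ↦ ⋂₀ (𝒢 : Set (Set (Fin d → ℝ))) = ∅)
      Finset.card
      ⟨ℱ, Finset.mem_filter.2 ⟨Finset.mem_powerset_self ℱ, h⟩⟩
    rw [Finset.mem_filter, Finset.mem_powerset] at h𝒢
    refine ⟨𝒢, h𝒢.1, ?_, h𝒢.2⟩
    by_contra! hcard
    obtain ⟨e⟩ : Nonempty (Fin (d + 3) ↪ 𝒢) :=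
      Function.Embedding.nonempty_of_card_le (by simpa [Nat.succ_le_iff] using hcard)
    have he : Function.Injective fun i ↦ (e i : Set (Fin d → ℝ)) :=
      Subtype.val_injective.comp e.injective
    let S : Finset (Fin (d + 3)) → Finset (Set (Fin d → ℝ)) := fun σ ↦
      𝒢 \ σ.image fun i ↦ (e i : Set (Fin d → ℝ))
    have hS : ∀ σ, S σ ⊆ ℱ := fun σ ↦ Finset.sdiff_subset.trans h𝒢.1
    have hScard : ∀ σ, Finset.card (S σ) + σ.card = 𝒢.card := fun σ ↦ by
      rw [← Finset.card_image_of_injective σ he]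
      refine Finset.card_sdiff_add_card_eq_card fun A hA ↦ ?_
      obtain ⟨i, -, rfl⟩ := Finset.mem_image.1 hA
      exact (e i).2
    obtain ⟨σ, τ, hστ, z, hzσ, hzτ⟩ := exists_disjoint_inter_nonempty hd
      (Y := fun σ ↦ ⋂₀ (S σ : Set (Set (Fin d → ℝ))))
      (fun σ τ hστ ↦ Set.sInter_subset_sInter (Finset.coe_subset.2
        (Finset.sdiff_subset_sdiff subset_rfl (Finset.image_subset_image hστ))))
      (fun σ hσ hσc ↦ by
        refine (hconn (S σ) (hS σ) (Finset.card_pos.1 ?_)).resolve_left fun h0 ↦ ?_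
        · have := hScard σ
          omega
        · have h1 := hmin (S σ) (Finset.mem_filter.2 ⟨Finset.mem_powerset.2 (hS σ), h0⟩)
          have h2 := hScard σ
          have h3 := Finset.card_pos.2 hσ
          omega)
    have hz : z ∈ ⋂₀ (𝒢 : Set (Set (Fin d → ℝ))) := fun A hA ↦ by
      by_cases hAσ : A ∈ S σ
      · exact hzσ A hAσ
      · refine hzτ A (Finset.mem_sdiff.2 ⟨hA, fun hAτ ↦ hAσ (Finset.mem_sdiff.2 ⟨hA, ?_⟩)⟩)
        rw [Finset.mem_image] at hAτ ⊢
        obtain ⟨j, hj, rfl⟩ := hAτ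
        rintro ⟨i, hi, hij⟩
        exact Finset.disjoint_left.1 hστ hi (he hij ▸ hj)
    rw [h𝒢.2] at hz
    exact hz
  · rintro ⟨𝒢, h𝒢, -, h⟩
    exact Set.subset_eq_empty (Set.sInter_subset_sInter (Finset.coe_subset.2 h𝒢)) h
end
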